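/- arXiv:2405.11851 — 2 statements merged into one kernel-verified Lean document; each statement's English description precedes it below -/
import Mathlib

section
/- (Lower bound for the small ball probability.) There exists a constant κ₄ ∈ (0, ∞) such that for every ε ∈ (0,1), P( sup_{t ∈ [0,1]} |Y(t)| ≤ ε ) ≥ exp( −κ₄ ε^{−1/β} ). -/
open MeasureTheory ProbabilityTheory Real Set Filter

/-- A process is a centered Gaussian process if every finite linear combination of its
values has a centered Gaussian distribution. -/
def IsCenteredGaussianProcess {Ω : Type*} [MeasurableSpace Ω] (P : Measure Ω)
    (X : ℝ → Ω → ℝ) : Prop :=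
  ∀ (n : ℕ) (t : Fin n → ℝ) (c : Fin n → ℝ), ∃ v : NNReal,
    P.map (fun ω => ∑ i, c i * X (t i) ω) = ProbabilityTheory.gaussianReal 0 v

/-- The covariance function of the generalized fractional Brownian motion:
`E[X s X t] = ∫_ℝ ((s−u)₊^α − (−u)₊^α)((t−u)₊^α − (−u)₊^α)|u|^{−γ} du`. -/
noncomputable def gfbmCov (α γ s t : ℝ) : ℝ :=
  ∫ u : ℝ, ((max (s - u) 0) ^ α - (max (-u) 0) ^ α) *
    ((max (t - u) 0) ^ α - (max (-u) 0) ^ α) * |u| ^ (-γ)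

/-- `X` is a generalized fractional Brownian motion with parameters `(α, γ)` under `P`. -/
def IsGFBM {Ω : Type*} [MeasurableSpace Ω] (P : Measure Ω) (α γ : ℝ)
    (X : ℝ → Ω → ℝ) : Prop :=
  IsCenteredGaussianProcess P X ∧
  (∀ ω, ContinuousOn (fun t => X t ω) (Set.Ici 0)) ∧
  (∀ ω, X 0 ω = 0) ∧
  (∀ s t : ℝ, 0 ≤ s → 0 ≤ t → ∫ ω, X s ω * X t ω ∂P = gfbmCov α γ s t)

/-- The fractional integral `Y(t) = (1/Γ(θ)) ∫₀^t (t−u)^{θ−1} X(u) du` of a process `X`. -/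
noncomputable def fracInt {Ω : Type*} (θ : ℝ) (X : ℝ → Ω → ℝ) (t : ℝ) (ω : Ω) : ℝ :=
  (Real.Gamma θ)⁻¹ * ∫ u in (0:ℝ)..t, (t - u) ^ (θ - 1) * X u ω

/-- The running maximum `M(t) = sup_{0 ≤ s ≤ t} |Y(s)|`. -/
noncomputable def runSup {Ω : Type*} (Y : ℝ → Ω → ℝ) (t : ℝ) (ω : Ω) : ℝ :=
  ⨆ s : Set.Icc (0:ℝ) t, |Y s.1 ω|

/-- The small ball function `φ(ε) = P(M(1) ≤ ε)`. -/
noncomputable def smallBall {Ω : Type*} [MeasurableSpace Ω] (P : Measure Ω)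
    (Y : ℝ → Ω → ℝ) (ε : ℝ) : ℝ :=
  (P {ω | runSup Y 1 ω ≤ ε}).toReal

/-- A standard Gaussian variable stays in `[-x, x]` with probability at least `exp (-C x ^ (-p))`,
whatever the exponent `p > 0`. -/
lemma exists_exp_rpow_le_gaussianReal_Icc {p : ℝ} (hp : 0 < p) :
    ∃ C : ℝ, 0 < C ∧ ∀ x : ℝ, 0 < x →
      Real.exp (-C * x ^ (-p)) ≤ (gaussianReal 0 1).real (Icc (-x) x) := by
  set ν := gaussianReal 0 1 with hν
  set c : ℝ := gaussianPDFReal 0 1 1 with hc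
  have hc0 : 0 < c := gaussianPDFReal_pos 0 1 1 one_ne_zero
  have hsmall : ∀ x : ℝ, 0 < x → x ≤ 1 → c * x ≤ ν.real (Icc (-x) x) := by
    intro x hx hx1
    rw [measureReal_def, hν, gaussianReal_apply_eq_integral 0 one_ne_zero,
      ENNReal.toReal_ofReal (integral_nonneg fun y => gaussianPDFReal_nonneg 0 1 y)]
    have h := setIntegral_ge_of_const_le_real (μ := volume) (s := Icc (-x) x) (c := c)
      (f := gaussianPDFReal 0 1) measurableSet_Icc (by simp) (fun y hy => ?_)
      (integrable_gaussianPDFReal 0 1).integrableOn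
    · refine le_trans ?_ h
      rw [measureReal_def, Real.volume_Icc, ENNReal.toReal_ofReal (by linarith)]
      nlinarith
    · rw [hc, gaussianPDFReal_def]
      have : y ^ 2 ≤ 1 := by
        rw [sq_le_one_iff_abs_le_one, abs_le]; exact ⟨by linarith [hy.1], by linarith [hy.2]⟩
      simp only [NNReal.coe_one, sub_zero]
      refine mul_le_mul_of_nonneg_left (Real.exp_le_exp.2 ?_) (by positivity)
      linarith
  obtain ⟨q, hq⟩ := exists_nat_ge p
  set M : ℝ := ∫ y, |y| ^ q ∂ν with hM
  have hM0 : 0 ≤ M := integral_nonneg fun y => by positivity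
  have h_int : Integrable (fun y : ℝ => |y| ^ q) ν := by
    have := (memLp_id_gaussianReal (μ := 0) (v := 1) (q : NNReal)).integrable_norm_pow'
    simpa using this
  have hlarge : ∀ x : ℝ, 0 < x → 1 - M * (x ^ q)⁻¹ ≤ ν.real (Icc (-x) x) := by
    intro x hx
    have h1 := mul_meas_ge_le_integral_of_nonneg (μ := ν) (f := fun y : ℝ => |y| ^ q)
      (ae_of_all _ fun y => by positivity) h_int (x ^ q)
    have h2 : 1 - ν.real (Icc (-x) x) ≤ ν.real {y | x ^ q ≤ |y| ^ q} := by
      rw [← probReal_compl_eq_one_sub measurableSet_Icc]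
      refine measureReal_mono (fun y hy => ?_)
      simp only [mem_compl_iff, mem_Icc, ← abs_le, not_le] at hy
      exact pow_le_pow_left₀ hx.le hy.le q
    have h3 : 0 < x ^ q := by positivity
    have h4 : ν.real {y | x ^ q ≤ |y| ^ q} ≤ M * (x ^ q)⁻¹ := by
      rw [← div_eq_mul_inv, le_div_iff₀ h3]; linarith
    linarith
  refine ⟨|Real.log c| + 1 / p + M / c + 1, by positivity, fun x hx => ?_⟩
  have hxp : 0 < x ^ (-p) := by positivity
  rcases le_total x 1 with hx1 | hx1
  · refine le_trans ?_ (hsmall x hx hx1)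
    rw [← Real.le_log_iff_exp_le (by positivity), Real.log_mul hc0.ne' hx.ne']
    have h1 : (1 : ℝ) ≤ x ^ (-p) := Real.one_le_rpow_of_pos_of_le_one_of_nonpos hx hx1 (by linarith)
    have h2 : -Real.log x ≤ x ^ (-p) / p := by
      have := Real.log_le_rpow_div (inv_nonneg.2 hx.le) hp
      rwa [Real.log_inv, Real.inv_rpow hx.le, ← Real.rpow_neg hx.le] at this
    have h3 := neg_abs_le (Real.log c)
    have h4 : 0 ≤ M / c := by positivity
    have h5 := abs_nonneg (Real.log c)
    have h6 : x ^ (-p) / p = 1 / p * x ^ (-p) := by ring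
    nlinarith
  · have hc1 : c ≤ ν.real (Icc (-x) x) :=
      le_trans (by simpa using hsmall 1 one_pos le_rfl)
        (measureReal_mono (Icc_subset_Icc (by linarith) hx1))
    have hpos : 0 < ν.real (Icc (-x) x) := hc0.trans_le hc1
    rw [← Real.le_log_iff_exp_le hpos]
    refine le_trans ?_ (Real.one_sub_inv_le_log_of_pos hpos)
    have h1 : (x ^ q)⁻¹ ≤ x ^ (-p) := by
      rw [Real.rpow_neg hx.le, ← Real.rpow_natCast]
      exact inv_anti₀ (by positivity) (Real.rpow_le_rpow_of_exponent_le hx1 hq)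
    have h2 : (ν.real (Icc (-x) x))⁻¹ - 1 ≤ M / c * x ^ (-p) := by
      have h3 : (ν.real (Icc (-x) x))⁻¹ - 1 = (1 - ν.real (Icc (-x) x)) / ν.real (Icc (-x) x) := by
        field_simp
      rw [h3]
      calc (1 - ν.real (Icc (-x) x)) / ν.real (Icc (-x) x)
          ≤ (M * (x ^ q)⁻¹) / ν.real (Icc (-x) x) := by
            gcongr; linarith [hlarge x hx]
        _ ≤ (M * (x ^ q)⁻¹) / c := by gcongr
        _ ≤ (M * x ^ (-p)) / c := by gcongr
        _ = M / c * x ^ (-p) := by ring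
    have h3 : 0 ≤ (|Real.log c| + 1 / p + 1) * x ^ (-p) := by positivity
    linarith

/-- If the Gaussian vector `Z` has the law of a random series `∑ k, ξ k • a k` with independent
standard Gaussian coefficients, then `Z` stays below `ε` as soon as `|ξ k| ≤ x k` for all `k`. -/
lemma le_measure_forall_abs_le_of_series {Ω : Type*} [MeasurableSpace Ω] {P : Measure Ω}
    [IsProbabilityMeasure P] {ι : Type*} [Fintype ι] {Z : Ω → ι → ℝ} (hZm : AEMeasurable Z P)
    {q : (ι → ℝ) → ℝ}
    (hZ : ∀ c : ι → ℝ, ∫ ω, Complex.exp ((∑ i, c i * Z ω i : ℝ) * Complex.I) ∂P =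
      Complex.exp (-(q c : ℂ) / 2))
    {κ : Type*} [Countable κ] {a : κ → ι → ℝ} {x : κ → ℝ} {ε : ℝ}
    (hq : ∀ c, HasSum (fun k => (∑ i, c i * a k i) ^ 2) (q c))
    (hε : ∀ (i : ι) (S : Finset κ), ∑ k ∈ S, x k * |a k i| ≤ ε) {L : ENNReal}
    (hL : ∀ S : Finset κ, L ≤ ∏ k ∈ S, gaussianReal 0 1 (Icc (-x k) (x k))) :
    L ≤ P {ω | ∀ i, |Z ω i| ≤ ε} := by
  classical
  obtain ⟨S, hS⟩ := Filter.exists_seq_tendsto (atTop : Filter (Finset κ))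
  have hZm' : AEMeasurable (fun ω => WithLp.toLp 2 (Z ω)) P :=
    (WithLp.measurable_toLp 2 _).comp_aemeasurable hZm
  let A : ∀ n, (S n → ℝ) → EuclideanSpace ℝ ι :=
    fun n ξ => WithLp.toLp 2 fun i => ∑ k : S n, ξ k * a k i
  have hA : ∀ n, Measurable (A n) := fun n => by
    refine (WithLp.measurable_toLp 2 _).comp (measurable_pi_iff.2 fun i => ?_)
    fun_prop
  let ν : ProbabilityMeasure (EuclideanSpace ℝ ι) :=
    ⟨P.map fun ω => WithLp.toLp 2 (Z ω), Measure.isProbabilityMeasure_map hZm'⟩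
  let νs : ℕ → ProbabilityMeasure (EuclideanSpace ℝ ι) := fun n =>
    ⟨(Measure.pi fun _ : S n => gaussianReal 0 1).map (A n),
      Measure.isProbabilityMeasure_map (hA n).aemeasurable⟩
  have hlim : Tendsto νs atTop (nhds ν) := by
    refine ProbabilityMeasure.tendsto_of_tendsto_charFun fun t => ?_
    have h1 : charFun (ν : Measure (EuclideanSpace ℝ ι)) t = Complex.exp (-(q t : ℂ) / 2) := by
      rw [← hZ]
      change charFun (P.map _) t = _
      rw [charFun_apply, integral_map hZm' (by fun_prop)]
      simp [PiLp.inner_apply]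
    have h2 : ∀ n, charFun (νs n : Measure (EuclideanSpace ℝ ι)) t =
        Complex.exp (-((∑ k ∈ S n, (∑ i, t i * a k i) ^ 2 : ℝ) : ℂ) / 2) := by
      intro n
      change charFun ((Measure.pi fun _ : S n => gaussianReal 0 1).map (A n)) t = _
      rw [charFun_apply, integral_map (hA n).aemeasurable (by fun_prop)]
      have h3 := charFun_stdGaussian (E := EuclideanSpace ℝ (S n))
        (WithLp.toLp 2 fun k : S n => ∑ i, t i * a k i)
      rw [← map_pi_eq_stdGaussian, charFun_apply,
        integral_map (WithLp.measurable_toLp 2 _).aemeasurable (by fun_prop)] at h3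
      rw [← Complex.ofReal_pow, EuclideanSpace.real_norm_sq_eq] at h3
      have h4 : ∑ k ∈ S n, (∑ i, t i * a k i) ^ 2 = ∑ k : S n, (∑ i, t i * a k i) ^ 2 :=
        (Finset.sum_coe_sort (S n) fun k => (∑ i, t i * a k i) ^ 2).symm
      rw [h4]
      refine Eq.trans ?_ h3
      refine integral_congr_ae (ae_of_all _ fun ξ => ?_)
      simp only [PiLp.inner_apply, A, RCLike.inner_apply, conj_trivial]
      congr 3
      simp_rw [Finset.mul_sum, Finset.sum_mul]
      rw [Finset.sum_comm]
      refine Finset.sum_congr rfl fun k _ => Finset.sum_congr rfl fun i _ => by ring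
    rw [h1]
    simp_rw [h2]
    have h5 := ((hq t).comp hS)
    have h6 : Continuous fun y : ℝ => Complex.exp (-(y : ℂ) / 2) := by fun_prop
    exact (h6.tendsto _).comp h5
  let F : Set (EuclideanSpace ℝ ι) := {z | ∀ i, |z i| ≤ ε}
  have hF : IsClosed F := by
    simp only [F, Set.ofPred_forall]
    refine isClosed_iInter fun i => isClosed_le ?_ continuous_const
    fun_prop
  have hport := ProbabilityMeasure.limsup_measure_closed_le_of_tendsto hlim hF
  have hνF : (ν : Measure (EuclideanSpace ℝ ι)) F = P {ω | ∀ i, |Z ω i| ≤ ε} := by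
    change (P.map _) F = _
    rw [Measure.map_apply_of_aemeasurable hZm' hF.measurableSet]
    rfl
  rw [← hνF]
  refine le_trans ?_ hport
  refine le_trans (b := limsup (fun _ : ℕ => L) atTop) (by simp) (limsup_le_limsup ?_)
  refine Eventually.of_forall fun n => ?_
  change L ≤ ((Measure.pi fun _ : S n => gaussianReal 0 1).map (A n)) F
  rw [Measure.map_apply (hA n) hF.measurableSet]
  refine (hL (S n)).trans ?_
  rw [← Finset.prod_coe_sort, ← Measure.pi_pi (fun _ : S n => gaussianReal 0 1)
    (fun k : S n => Icc (-x k) (x k))]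
  refine measure_mono fun ξ hξ i => ?_
  simp only [mem_univ_pi, mem_Icc, ← abs_le] at hξ
  refine le_trans ?_ (hε i (S n))
  rw [← Finset.sum_coe_sort (S n) fun k => x k * |a k i|]
  refine (Finset.abs_sum_le_sum_abs _ _).trans (Finset.sum_le_sum fun k _ => ?_)
  rw [abs_mul]
  exact mul_le_mul_of_nonneg_right (hξ k) (abs_nonneg _)

lemma summable_pow_natAbs {ρ : ℝ} (h0 : 0 ≤ ρ) (h1 : ρ < 1) :
    Summable fun n : ℤ => ρ ^ n.natAbs := by
  refine Summable.of_nat_of_neg ?_ ?_ <;>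
    simpa using summable_geometric_of_lt_one h0 h1

/-- The dyadic sums of `min (y ^ s) (y ^ (-s))` along `y = 2 ^ j / R` are bounded uniformly in
the scale `R ≥ 1`. -/
lemma exists_sum_min_rpow_le {s : ℝ} (hs : 0 < s) :
    ∃ G : ℝ, 0 < G ∧ ∀ R : ℝ, 1 ≤ R → ∀ J : Finset ℕ,
      ∑ j ∈ J, min (((2 : ℝ) ^ j / R) ^ s) (((2 : ℝ) ^ j / R) ^ (-s)) ≤ G := by
  set ρ : ℝ := 2 ^ (-s) with hρ
  have hρ0 : 0 < ρ := by positivity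
  have hρ1 : ρ < 1 := Real.rpow_lt_one_of_one_lt_of_neg one_lt_two (by linarith)
  have hsum := summable_pow_natAbs hρ0.le hρ1
  refine ⟨2 ^ s * ∑' n : ℤ, ρ ^ n.natAbs + 1, ?_, fun R hR J => ?_⟩
  · have : 0 ≤ ∑' n : ℤ, ρ ^ n.natAbs := tsum_nonneg fun n => by positivity
    positivity
  obtain ⟨m, hm1, hm2⟩ := exists_nat_pow_near hR one_lt_two
  have hR0 : 0 < R := by linarith
  have key : ∀ j ∈ J, min (((2 : ℝ) ^ j / R) ^ s) (((2 : ℝ) ^ j / R) ^ (-s)) ≤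
      2 ^ s * ρ ^ ((j : ℤ) - m).natAbs := by
    intro j _
    rcases le_total j m with h | h
    · refine (min_le_left _ _).trans ?_
      have h1 : ((j : ℤ) - m).natAbs = m - j := by omega
      have h2 : (2 : ℝ) ^ j / R ≤ 2 ^ (-((m - j : ℕ) : ℝ)) := by
        rw [Real.rpow_neg two_pos.le, Real.rpow_natCast, div_le_iff₀ hR0, ← div_eq_inv_mul,
          le_div_iff₀ (by positivity), ← pow_add]
        rwa [Nat.add_sub_cancel' h]
      calc ((2 : ℝ) ^ j / R) ^ s ≤ (2 ^ (-((m - j : ℕ) : ℝ))) ^ s := by gcongr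
        _ = ρ ^ (m - j) := by
          rw [hρ, ← Real.rpow_natCast, ← Real.rpow_mul two_pos.le, ← Real.rpow_mul two_pos.le]
          ring_nf
        _ ≤ 2 ^ s * ρ ^ (m - j) :=
          le_mul_of_one_le_left (by positivity) (Real.one_le_rpow one_le_two hs.le)
        _ = _ := by rw [h1]
    · refine (min_le_right _ _).trans ?_
      have h1 : ((j : ℤ) - m).natAbs = j - m := by omega
      have h2 : (2 : ℝ) ^ (((j - m : ℕ) : ℝ) - 1) ≤ 2 ^ j / R := by
        rw [Real.rpow_sub_one two_ne_zero, Real.rpow_natCast, le_div_iff₀ hR0, div_mul_eq_mul_div,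
          div_le_iff₀ two_pos]
        calc (2 : ℝ) ^ (j - m) * R ≤ 2 ^ (j - m) * 2 ^ (m + 1) := by gcongr
          _ = 2 ^ j * 2 := by rw [← pow_add, ← pow_succ]; congr 1; omega
      calc ((2 : ℝ) ^ j / R) ^ (-s) ≤ (2 ^ (((j - m : ℕ) : ℝ) - 1)) ^ (-s) :=
            Real.rpow_le_rpow_of_nonpos (by positivity) h2 (by linarith)
        _ = 2 ^ s * ρ ^ (j - m) := by
          rw [hρ, ← Real.rpow_natCast, ← Real.rpow_mul two_pos.le, ← Real.rpow_mul two_pos.le,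
            ← Real.rpow_add two_pos]
          ring_nf
        _ = _ := by rw [h1]
  refine (Finset.sum_le_sum key).trans ?_
  rw [← Finset.mul_sum]
  have h1 : ∑ j ∈ J, ρ ^ ((j : ℤ) - m).natAbs ≤ ∑' n : ℤ, ρ ^ n.natAbs := by
    have hinj : Function.Injective fun j : ℕ => (j : ℤ) - m := fun a b h => by simpa using h
    have := hsum.sum_le_tsum (J.map ⟨_, hinj⟩) (fun n _ => by positivity)
    rwa [Finset.sum_map] at this
  have : (0 : ℝ) < 2 ^ s := by positivity
  nlinarith

lemma sum_sigma_le_mul {B : Type*} {n : ℕ → ℕ}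
    {F : (Σ p : B × ℕ, Fin (n p.2)) → ℝ} (hF : ∀ k, 0 ≤ F k) {u : B → ℝ} {v : ℕ → ℝ}
    (hu : ∀ b, 0 ≤ u b) (hv : ∀ j, 0 ≤ v j)
    (huv : ∀ p : B × ℕ, ∑ i, F ⟨p, i⟩ ≤ u p.1 * v p.2) {U V : ℝ}
    (hU : ∀ T : Finset B, ∑ b ∈ T, u b ≤ U) (hV : ∀ J : Finset ℕ, ∑ j ∈ J, v j ≤ V)
    (S : Finset (Σ p : B × ℕ, Fin (n p.2))) : ∑ k ∈ S, F k ≤ U * V := by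
  classical
  set T := S.image Sigma.fst
  have h1 : S ⊆ T.sigma fun _ => Finset.univ := fun k hk => by
    simp only [Finset.mem_sigma, Finset.mem_univ, and_true]
    exact Finset.mem_image_of_mem _ hk
  have h2 : T ⊆ T.image Prod.fst ×ˢ T.image Prod.snd := fun k hk => by
    rw [Finset.mem_product]
    exact ⟨Finset.mem_image_of_mem _ hk, Finset.mem_image_of_mem _ hk⟩
  calc ∑ k ∈ S, F k ≤ ∑ k ∈ T.sigma fun _ => Finset.univ, F k :=
        Finset.sum_le_sum_of_subset_of_nonneg h1 fun k _ _ => hF k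
    _ = ∑ p ∈ T, ∑ i, F ⟨p, i⟩ := Finset.sum_sigma _ _ _
    _ ≤ ∑ p ∈ T, u p.1 * v p.2 := Finset.sum_le_sum fun p _ => huv p
    _ ≤ ∑ p ∈ T.image Prod.fst ×ˢ T.image Prod.snd, u p.1 * v p.2 :=
        Finset.sum_le_sum_of_subset_of_nonneg h2 fun p _ _ => mul_nonneg (hu _) (hv _)
    _ = (∑ b ∈ T.image Prod.fst, u b) * ∑ j ∈ T.image Prod.snd, v j := by
        rw [Finset.sum_mul_sum, Finset.sum_product]
    _ ≤ U * V := mul_le_mul (hU _) (hV _) (Finset.sum_nonneg fun j _ => hv j)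
        ((Finset.sum_nonneg fun b _ => hu b).trans (hU (T.image Prod.fst)))

/-- Choice of thresholds for a multiscale series: level `j` of block `b` carries at most `M * 2 ^ j`
Gaussian coefficients and contributes at most `D * w b * 2 ^ (-β * j)`. -/
lemma exists_thresholds {B : Type*} {w : B → ℝ} (hw0 : ∀ b, 0 < w b)
    (hw : ∀ p : ℝ, 0 < p → Summable fun b => w b ^ p) {β : ℝ} (hβ : 0 < β) (M : ℕ) {D : ℝ}
    (hD : 0 < D) :
    ∃ κ₀ : ℝ, 0 < κ₀ ∧ ∀ ε ∈ Ioo (0 : ℝ) 1,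
      ∃ x : (Σ p : B × ℕ, Fin (M * 2 ^ p.2)) → ℝ,
        (∀ a : (Σ p : B × ℕ, Fin (M * 2 ^ p.2)) → ℝ,
          (∀ p : B × ℕ, ∑ i, |a ⟨p, i⟩| ≤ D * w p.1 * 2 ^ (-(β * p.2))) →
          ∀ S : Finset _, ∑ k ∈ S, x k * |a k| ≤ ε) ∧
        ∀ S : Finset _, ENNReal.ofReal (Real.exp (-κ₀ * ε ^ (-(1 / β)))) ≤
          ∏ k ∈ S, gaussianReal 0 1 (Icc (-x k) (x k)) := by
  obtain ⟨G₁, hG₁, hsum₁⟩ := exists_sum_min_rpow_le (s := β / 2) (by positivity)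
  obtain ⟨G₂, hG₂, hsum₂⟩ := exists_sum_min_rpow_le (s := 1 / 4) (by norm_num)
  set p₁ : ℝ := 1 / (2 * β) with hp₁
  set p₂ : ℝ := 4 / β with hp₂
  have hp₁0 : 0 < p₁ := by positivity
  have hp₂0 : 0 < p₂ := by positivity
  obtain ⟨K₁, hK₁, hg₁⟩ := exists_exp_rpow_le_gaussianReal_Icc hp₁0
  obtain ⟨K₂, hK₂, hg₂⟩ := exists_exp_rpow_le_gaussianReal_Icc hp₂0
  set W : ℝ := ∑' b, w b ^ (1 / 2 : ℝ)
  set W₁ : ℝ := ∑' b, w b ^ (p₁ / 2)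
  set W₂ : ℝ := ∑' b, w b ^ (p₂ / 2)
  have hWn : 0 ≤ W := tsum_nonneg fun b => (Real.rpow_pos_of_pos (hw0 b) _).le
  have hWn₁ : 0 ≤ W₁ := tsum_nonneg fun b => (Real.rpow_pos_of_pos (hw0 b) _).le
  have hWn₂ : 0 ≤ W₂ := tsum_nonneg fun b => (Real.rpow_pos_of_pos (hw0 b) _).le
  set C : ℝ := D * (W + 1) * G₁ with hC
  have hC0 : 0 < C := by positivity
  refine ⟨M * (K₁ * C ^ p₁ * W₁ + K₂ * C ^ p₂ * W₂) * G₂ + 1, by positivity, fun ε hε => ?_⟩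
  set R : ℝ := ε ^ (-(1 / β)) with hR
  have hR1 : 1 ≤ R :=
    Real.one_le_rpow_of_pos_of_le_one_of_nonpos hε.1 hε.2.le (by simp; positivity)
  have hR0 : 0 < R := by linarith
  have hRε : R ^ (-β) = ε := by
    rw [hR, ← Real.rpow_mul hε.1.le]
    field_simp
    simp
  set y : ℕ → ℝ := fun j => 2 ^ j / R with hy
  have hy0 : ∀ j, 0 < y j := fun j => by positivity
  set X : B × ℕ → ℝ := fun p => y p.2 ^ β * w p.1 ^ (-(1 / 2) : ℝ) *
    min (y p.2 ^ (β / 2)) (y p.2 ^ (-(β / 2))) / C with hX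
  have hX0 : ∀ p, 0 < X p := fun p => by
    have := Real.rpow_pos_of_pos (hw0 p.1) (-(1 / 2))
    have h1 := Real.rpow_pos_of_pos (hy0 p.2) β
    have h2 := Real.rpow_pos_of_pos (hy0 p.2) (β / 2)
    have h3 := Real.rpow_pos_of_pos (hy0 p.2) (-(β / 2))
    have h4 : 0 < min (y p.2 ^ (β / 2)) (y p.2 ^ (-(β / 2))) := lt_min h2 h3
    positivity
  refine ⟨fun k => X k.1, fun a ha S => ?_, fun S => ?_⟩
  · have := sum_sigma_le_mul (n := fun j => M * 2 ^ j) (F := fun k => X k.1 * |a k|)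
      (fun k => mul_nonneg (hX0 _).le (abs_nonneg _))
      (u := fun b => D / C * ε * w b ^ (1 / 2 : ℝ))
      (v := fun j => min (y j ^ (β / 2)) (y j ^ (-(β / 2))))
      (fun b => by have := hw0 b; have := hε.1; positivity)
      (fun j => le_min (Real.rpow_nonneg (hy0 j).le _) (Real.rpow_nonneg (hy0 j).le _))
      (fun p => ?_) (U := D / C * ε * (W + 1)) (V := G₁) (fun T => ?_) (fun J => hsum₁ R hR1 J) S
    · refine this.trans (le_of_eq ?_)
      have : W + 1 ≠ 0 := by positivity
      rw [hC]; field_simp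
    · change ∑ i, X p * |a ⟨p, i⟩| ≤ _
      rw [← Finset.mul_sum]
      refine (mul_le_mul_of_nonneg_left (ha p) (hX0 p).le).trans (le_of_eq ?_)
      have h1 : y p.2 ^ β * 2 ^ (-(β * (p.2 : ℝ))) = ε := by
        rw [hy, Real.div_rpow (by positivity) hR0.le, ← hRε, Real.rpow_neg hR0.le,
          Real.rpow_neg two_pos.le, mul_comm β, Real.rpow_mul two_pos.le, Real.rpow_natCast]
        have : ((2 : ℝ) ^ p.2) ^ β ≠ 0 := by positivity
        field_simp
      have h2 : w p.1 ^ (-(1 / 2) : ℝ) * w p.1 = w p.1 ^ (1 / 2 : ℝ) := by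
        conv_lhs => rw [← Real.rpow_one (w p.1), ← Real.rpow_mul (hw0 _).le,
          ← Real.rpow_add (hw0 _)]
        norm_num
      rw [← h1, ← h2, hX]
      ring
    · rw [← Finset.mul_sum]
      have h1 := (hw (1 / 2) (by norm_num)).sum_le_tsum T
        (fun b _ => Real.rpow_nonneg (hw0 b).le _)
      have := hε.1
      exact mul_le_mul_of_nonneg_left (by linarith) (by positivity)
  · have hfin : ∀ k : (Σ p : B × ℕ, Fin (M * 2 ^ p.2)),
        Real.exp (-(R * (K₁ * C ^ p₁ * w k.1.1 ^ (p₁ / 2) + K₂ * C ^ p₂ * w k.1.1 ^ (p₂ / 2)) *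
          (2 ^ k.1.2)⁻¹ * min (y k.1.2 ^ (1 / 4 : ℝ)) (y k.1.2 ^ (-(1 / 4) : ℝ)))) ≤
        (gaussianReal 0 1).real (Icc (-X k.1) (X k.1)) := by
      rintro ⟨⟨b, j⟩, i⟩
      dsimp only
      have hb := hw0 b
      have hyj := hy0 j
      have hRy : R * (2 ^ j)⁻¹ = (y j)⁻¹ := by simp [hy, div_eq_mul_inv]
      have hb1 : 0 < w b ^ (p₁ / 2) := by positivity
      have hb2 : 0 < w b ^ (p₂ / 2) := by positivity
      rcases le_total (y j) 1 with h | h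
      · refine le_trans (Real.exp_le_exp.2 ?_) (hg₁ _ (hX0 _))
        have e1 : min (y j ^ (1 / 4 : ℝ)) (y j ^ (-(1 / 4) : ℝ)) = y j ^ (1 / 4 : ℝ) :=
          min_eq_left (Real.rpow_le_rpow_of_exponent_ge hyj h (by norm_num))
        have e2 : min (y j ^ (β / 2)) (y j ^ (-(β / 2))) = y j ^ (β / 2) :=
          min_eq_left (Real.rpow_le_rpow_of_exponent_ge hyj h (by linarith))
        have e3 : X (b, j) ^ (-p₁) = C ^ p₁ * w b ^ (p₁ / 2) * y j ^ (-(3 / 4) : ℝ) := by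
          rw [hX]
          dsimp only
          rw [e2, Real.div_rpow (by positivity) hC0.le, Real.mul_rpow (by positivity)
            (by positivity), Real.mul_rpow (by positivity) (by positivity), ← Real.rpow_mul hb.le,
            ← Real.rpow_mul hyj.le, ← Real.rpow_mul hyj.le, Real.rpow_neg hC0.le, div_inv_eq_mul]
          have : y j ^ (-(3 / 4) : ℝ) = y j ^ (β * -p₁) * y j ^ (β / 2 * -p₁) := by
            rw [← Real.rpow_add hyj, hp₁]; congr 1; field_simp; norm_num
          rw [this]
          ring_nf
        have e4 : (y j)⁻¹ * y j ^ (1 / 4 : ℝ) = y j ^ (-(3 / 4) : ℝ) := by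
          rw [← Real.rpow_neg_one, ← Real.rpow_add hyj]; norm_num
        rw [e1, e3, mul_right_comm R, hRy, mul_right_comm, e4, neg_mul]
        have : 0 ≤ y j ^ (-(3 / 4) : ℝ) * (K₂ * C ^ p₂ * w b ^ (p₂ / 2)) := by positivity
        nlinarith
      · refine le_trans (Real.exp_le_exp.2 ?_) (hg₂ _ (hX0 _))
        have e1 : min (y j ^ (1 / 4 : ℝ)) (y j ^ (-(1 / 4) : ℝ)) = y j ^ (-(1 / 4) : ℝ) :=
          min_eq_right (Real.rpow_le_rpow_of_exponent_le h (by norm_num))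
        have e2 : min (y j ^ (β / 2)) (y j ^ (-(β / 2))) = y j ^ (-(β / 2)) :=
          min_eq_right (Real.rpow_le_rpow_of_exponent_le h (by linarith))
        have e3 : X (b, j) ^ (-p₂) = C ^ p₂ * w b ^ (p₂ / 2) * y j ^ (-2 : ℝ) := by
          rw [hX]
          dsimp only
          rw [e2, Real.div_rpow (by positivity) hC0.le, Real.mul_rpow (by positivity)
            (by positivity), Real.mul_rpow (by positivity) (by positivity), ← Real.rpow_mul hb.le,
            ← Real.rpow_mul hyj.le, ← Real.rpow_mul hyj.le, Real.rpow_neg hC0.le, div_inv_eq_mul]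
          have : y j ^ (-2 : ℝ) = y j ^ (β * -p₂) * y j ^ (-(β / 2) * -p₂) := by
            rw [← Real.rpow_add hyj, hp₂]; congr 1; field_simp; norm_num
          rw [this]
          ring_nf
        have e4 : y j ^ (-2 : ℝ) ≤ (y j)⁻¹ * y j ^ (-(1 / 4) : ℝ) := by
          rw [← Real.rpow_neg_one, ← Real.rpow_add hyj]
          exact Real.rpow_le_rpow_of_exponent_le h (by norm_num)
        rw [e1, e3, mul_right_comm R, hRy, mul_right_comm, neg_mul, neg_le_neg_iff]
        calc K₂ * (C ^ p₂ * w b ^ (p₂ / 2) * y j ^ (-2 : ℝ))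
            = y j ^ (-2 : ℝ) * (K₂ * C ^ p₂ * w b ^ (p₂ / 2)) := by ring
          _ ≤ y j ^ (-2 : ℝ) *
              (K₁ * C ^ p₁ * w b ^ (p₁ / 2) + K₂ * C ^ p₂ * w b ^ (p₂ / 2)) := by
            gcongr
            exact le_add_of_nonneg_left (by positivity)
          _ ≤ _ := by gcongr
    have hprod : ∀ k : (Σ p : B × ℕ, Fin (M * 2 ^ p.2)),
        gaussianReal 0 1 (Icc (-X k.1) (X k.1)) =
          ENNReal.ofReal ((gaussianReal 0 1).real (Icc (-X k.1) (X k.1))) := fun k => by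
      rw [measureReal_def, ENNReal.ofReal_toReal (measure_ne_top _ _)]
    simp_rw [hprod]
    rw [← ENNReal.ofReal_prod_of_nonneg fun k _ => measureReal_nonneg]
    refine ENNReal.ofReal_le_ofReal ?_
    refine le_trans ?_ (Finset.prod_le_prod (fun k _ => (Real.exp_pos _).le) fun k _ => hfin k)
    rw [← Real.exp_sum, Real.exp_le_exp, Finset.sum_neg_distrib, neg_mul, neg_le_neg_iff]
    have := sum_sigma_le_mul (n := fun j => M * 2 ^ j)
      (F := fun k => R * (K₁ * C ^ p₁ * w k.1.1 ^ (p₁ / 2) +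
        K₂ * C ^ p₂ * w k.1.1 ^ (p₂ / 2)) *
          (2 ^ k.1.2)⁻¹ * min (y k.1.2 ^ (1 / 4 : ℝ)) (y k.1.2 ^ (-(1 / 4) : ℝ)))
      (fun k => ?_)
      (u := fun b => M * R * (K₁ * C ^ p₁ * w b ^ (p₁ / 2) + K₂ * C ^ p₂ * w b ^ (p₂ / 2)))
      (v := fun j => min (y j ^ (1 / 4 : ℝ)) (y j ^ (-(1 / 4) : ℝ)))
      (fun b => by have := hw0 b; positivity)
      (fun j => le_min (Real.rpow_nonneg (hy0 j).le _) (Real.rpow_nonneg (hy0 j).le _))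
      (fun p => le_of_eq ?_)
      (U := M * R * (K₁ * C ^ p₁ * W₁ + K₂ * C ^ p₂ * W₂)) (V := G₂) (fun T => ?_)
      (fun J => hsum₂ R hR1 J) S
    · refine this.trans ?_
      nlinarith
    · have h1 := hw0 k.1.1
      have h2 : 0 ≤ min (y k.1.2 ^ (1 / 4 : ℝ)) (y k.1.2 ^ (-(1 / 4) : ℝ)) :=
        le_min (Real.rpow_nonneg (hy0 _).le _) (Real.rpow_nonneg (hy0 _).le _)
      positivity
    · simp only [Finset.sum_const, Finset.card_univ, Fintype.card_fin, nsmul_eq_mul]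
      push_cast
      field_simp
    · rw [← Finset.mul_sum, Finset.sum_add_distrib, ← Finset.mul_sum, ← Finset.mul_sum]
      have h1 := (hw (p₁ / 2) (by positivity)).sum_le_tsum T
        (fun b _ => Real.rpow_nonneg (hw0 b).le _)
      have h2 := (hw (p₂ / 2) (by positivity)).sum_le_tsum T
        (fun b _ => Real.rpow_nonneg (hw0 b).le _)
      gcongr

lemma sum_integral_div_eq_integral {V : Type*} [NormedAddCommGroup V] [NormedSpace ℝ V] (N : ℕ)
    {g : ℝ → V} (hg : IntervalIntegrable g volume 0 1) :
    ∑ m ∈ Finset.range (N + 1), ∫ x in (m / (N + 1) : ℝ)..((m + 1) / (N + 1) : ℝ), g x =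
      ∫ x in (0:ℝ)..1, g x := by
  have hN0 : (0:ℝ) < N + 1 := by positivity
  have := intervalIntegral.sum_integral_adjacent_intervals (f := g) (μ := volume)
    (a := fun m : ℕ => (m / (N + 1) : ℝ)) (n := N + 1) (fun m hm => hg.mono_set (by
      have h1 : (m / (N + 1) : ℝ) ≤ ((m + 1 : ℕ) : ℝ) / (N + 1) := by
        gcongr; exact_mod_cast m.le_succ
      rw [uIcc_of_le h1, uIcc_of_le zero_le_one]
      refine Icc_subset_Icc (by positivity) ?_
      rw [div_le_one hN0]
      exact_mod_cast hm))
  simpa [div_self hN0.ne'] using this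

lemma tendsto_sum_integral_smul_of_continuousOn {V : Type*} [NormedAddCommGroup V]
    [NormedSpace ℝ V] [CompleteSpace V] {w : ℝ → ℝ} (hw : IntervalIntegrable w volume 0 1)
    (hw0 : ∀ x ∈ Icc (0:ℝ) 1, 0 ≤ w x) {φ : ℝ → V} (hφ : ContinuousOn φ (Icc 0 1)) :
    Tendsto (fun N : ℕ => ∑ m ∈ Finset.range (N + 1),
      (∫ x in (m / (N + 1) : ℝ)..((m + 1) / (N + 1) : ℝ), w x) • φ (m / (N + 1))) atTop
      (nhds (∫ x in (0:ℝ)..1, w x • φ x)) := by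
  have hu : UniformContinuousOn φ (Icc 0 1) :=
    isCompact_Icc.uniformContinuousOn_of_continuous hφ
  rw [Metric.tendsto_atTop]
  intro ε hε
  set W := ∫ x in (0:ℝ)..1, w x with hW
  have hW0 : 0 ≤ W := intervalIntegral.integral_nonneg zero_le_one hw0
  obtain ⟨δ, hδ, hδ'⟩ := Metric.uniformContinuousOn_iff.1 hu (ε / (W + 1)) (by positivity)
  obtain ⟨N₀, hN₀⟩ := exists_nat_one_div_lt hδ
  refine ⟨N₀, fun N hN => ?_⟩
  have hN0 : (0:ℝ) < N + 1 := by positivity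
  have hNδ : (1:ℝ) / (N + 1) < δ := lt_of_le_of_lt (by gcongr) hN₀
  have hmem : ∀ m : ℕ, m ≤ N + 1 → (m / (N + 1) : ℝ) ∈ Icc (0:ℝ) 1 := fun m hm =>
    ⟨by positivity, by rw [div_le_one hN0]; exact_mod_cast hm⟩
  have hmem' : ∀ m : ℕ, m < N + 1 → ((m + 1) / (N + 1) : ℝ) ∈ Icc (0:ℝ) 1 := fun m hm => by
    simpa using hmem (m + 1) hm
  have hle : ∀ m : ℕ, (m / (N + 1) : ℝ) ≤ (m + 1) / (N + 1) := fun m => by gcongr; linarith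
  have hsub : ∀ m : ℕ, m < N + 1 → uIcc (m / (N + 1) : ℝ) ((m + 1) / (N + 1)) ⊆ uIcc 0 1 := by
    intro m hm
    rw [uIcc_of_le (hle m), uIcc_of_le zero_le_one]
    exact Icc_subset_Icc (hmem m hm.le).1 (hmem' m hm).2
  have hwφ : IntervalIntegrable (fun x => w x • φ x) volume 0 1 :=
    hw.smul_continuousOn (by rwa [uIcc_of_le zero_le_one])
  rw [dist_eq_norm, ← sum_integral_div_eq_integral N hwφ, ← Finset.sum_sub_distrib]
  refine lt_of_le_of_lt (norm_sum_le _ _) ?_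
  have hstep : ∀ m ∈ Finset.range (N + 1),
      ‖(∫ x in (m / (N + 1) : ℝ)..((m + 1) / (N + 1) : ℝ), w x) • φ (m / (N + 1)) -
        ∫ x in (m / (N + 1) : ℝ)..((m + 1) / (N + 1) : ℝ), w x • φ x‖ ≤
      ∫ x in (m / (N + 1) : ℝ)..((m + 1) / (N + 1) : ℝ), w x * (ε / (W + 1)) := by
    intro m hm
    have hm := Finset.mem_range.1 hm
    have hwi := hw.mono_set (hsub m hm)
    rw [← intervalIntegral.integral_smul_const, ← intervalIntegral.integral_sub
      (hwi.smul_continuousOn continuousOn_const) (hwφ.mono_set (hsub m hm))]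
    refine intervalIntegral.norm_integral_le_of_norm_le (hle m) ?_ (hwi.mul_const _)
    refine ae_of_all _ fun x hx => ?_
    have hx1 : x ∈ Icc (0:ℝ) 1 :=
      ⟨(hmem m hm.le).1.trans hx.1.le, hx.2.trans (hmem' m hm).2⟩
    rw [← smul_sub, norm_smul, Real.norm_of_nonneg (hw0 x hx1)]
    refine mul_le_mul_of_nonneg_left ?_ (hw0 x hx1)
    rw [← dist_eq_norm]
    refine (hδ' _ (hmem m hm.le) _ hx1 ?_).le
    rw [dist_comm, Real.dist_eq, abs_of_nonneg (sub_nonneg.2 hx.1.le)]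
    refine lt_of_le_of_lt ?_ hNδ
    have := hx.2
    rw [add_div] at this
    linarith
  refine lt_of_le_of_lt (Finset.sum_le_sum hstep) ?_
  rw [sum_integral_div_eq_integral N (hw.mul_const _), intervalIntegral.integral_mul_const, ← hW]
  rw [mul_div_assoc', div_lt_iff₀ (by positivity)]
  nlinarith

section Covariance

variable {Ω : Type*} [MeasurableSpace Ω] {P : Measure Ω}
  {E : Type*} [NormedAddCommGroup E] [InnerProductSpace ℝ E]
  {X : ℝ → Ω → ℝ} {F : ℝ → E}

lemma IsCenteredGaussianProcess.exists_map_eq (hX : IsCenteredGaussianProcess P X)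
    {ι : Type*} [Fintype ι] (t c : ι → ℝ) :
    ∃ v : NNReal, P.map (fun ω => ∑ i, c i * X (t i) ω) = gaussianReal 0 v := by
  let e := Fintype.equivFin ι
  obtain ⟨v, hv⟩ := hX _ (t ∘ e.symm) (c ∘ e.symm)
  refine ⟨v, ?_⟩
  rw [← hv]
  congr 1
  ext ω
  exact (Equiv.sum_comp e.symm fun i => c i * X (t i) ω).symm

lemma aemeasurable_of_map_eq_gaussianReal {Z : Ω → ℝ} {v : NNReal}
    (h : P.map Z = gaussianReal 0 v) : AEMeasurable Z P := by
  by_contra hZ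
  rw [Measure.map_of_not_aemeasurable hZ] at h
  exact (IsProbabilityMeasure.ne_zero (gaussianReal 0 v)) h.symm

lemma memLp_two_of_map_eq_gaussianReal {Z : Ω → ℝ} {v : NNReal}
    (h : P.map Z = gaussianReal 0 v) : MemLp Z 2 P := by
  have h1 : MemLp id 2 (P.map Z) := by
    rw [h]; exact memLp_id_gaussianReal (μ := 0) (v := v) 2
  exact (memLp_map_measure_iff h1.1 (aemeasurable_of_map_eq_gaussianReal h)).1 h1

lemma IsCenteredGaussianProcess.exists_map_eq_one (hX : IsCenteredGaussianProcess P X) (t : ℝ) :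
    ∃ v : NNReal, P.map (X t) = gaussianReal 0 v := by
  obtain ⟨v, hv⟩ := hX.exists_map_eq (ι := Unit) (fun _ => t) (fun _ => 1)
  exact ⟨v, by simpa using hv⟩

lemma IsCenteredGaussianProcess.integral_cexp (hX : IsCenteredGaussianProcess P X)
    (hF : ∀ s t : ℝ, 0 ≤ s → 0 ≤ t → ∫ ω, X s ω * X t ω ∂P = inner ℝ (F s) (F t))
    {ι : Type*} [Fintype ι] (t c : ι → ℝ) (ht : ∀ i, 0 ≤ t i) :
    ∫ ω, Complex.exp ((∑ i, c i * X (t i) ω : ℝ) * Complex.I) ∂P =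
      Complex.exp (-((‖∑ i, c i • F (t i)‖ ^ 2 : ℝ) : ℂ) / 2) := by
  obtain ⟨v, hv⟩ := hX.exists_map_eq t c
  set Z := fun ω => ∑ i, c i * X (t i) ω with hZ
  have hZm := aemeasurable_of_map_eq_gaussianReal hv
  have hL : ∀ i, MemLp (X (t i)) 2 P := fun i =>
    memLp_two_of_map_eq_gaussianReal (hX.exists_map_eq_one (t i)).choose_spec
  have hvar : ∫ ω, Z ω ^ 2 ∂P = v := by
    have h1 : ∫ y, y ^ 2 ∂(gaussianReal 0 v) = v := by
      have h2 := variance_id_gaussianReal (μ := 0) (v := v)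
      rw [variance_of_integral_eq_zero aemeasurable_id (by simp)] at h2
      simpa using h2
    rw [← h1, ← hv, integral_map hZm (by fun_prop)]
  have hnorm : ‖∑ i, c i • F (t i)‖ ^ 2 = v := by
    rw [← hvar, ← real_inner_self_eq_norm_sq, sum_inner]
    simp_rw [inner_sum, inner_smul_left, inner_smul_right, hZ, sq, Finset.sum_mul_sum]
    rw [integral_finsetSum]
    · refine Finset.sum_congr rfl fun i _ => ?_
      rw [integral_finsetSum]
      · refine Finset.sum_congr rfl fun j _ => ?_
        rw [← hF _ _ (ht i) (ht j)]
        simp only [conj_trivial]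
        rw [← integral_const_mul, ← integral_const_mul]
        refine integral_congr_ae (ae_of_all _ fun ω => ?_)
        simp only
        ring
      · exact fun j _ => ((hL i).const_mul _).integrable_mul ((hL j).const_mul _)
    · exact fun i _ => integrable_finsetSum _ fun j _ =>
        ((hL i).const_mul _).integrable_mul ((hL j).const_mul _)
  have h := charFun_gaussianReal (μ := 0) (v := v) (t := 1)
  rw [← hv, charFun_apply_real, integral_map hZm (by fun_prop)] at h
  rw [hnorm]
  simpa [neg_div, Z] using h

lemma IsCenteredGaussianProcess.continuousOn_of_inner [IsProbabilityMeasure P]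
    (hX : IsCenteredGaussianProcess P X)
    (hF : ∀ s t : ℝ, 0 ≤ s → 0 ≤ t → ∫ ω, X s ω * X t ω ∂P = inner ℝ (F s) (F t))
    (hc : ∀ ω, ContinuousOn (fun t => X t ω) (Ici 0)) : ContinuousOn F (Ici 0) := by
  intro s hs
  have h1 : ∀ t ∈ Ici (0:ℝ), ∫ ω, Complex.exp ((X t ω - X s ω : ℝ) * Complex.I) ∂P =
      Real.exp (-‖F t - F s‖ ^ 2 / 2) := by
    intro t ht
    have := hX.integral_cexp hF ![t, s] ![1, -1] (by
      intro i; fin_cases i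
      · exact ht
      · exact hs)
    simp only [Fin.sum_univ_two, Matrix.cons_val_zero, Matrix.cons_val_one, one_mul, neg_mul,
      one_smul, neg_smul, ← sub_eq_add_neg] at this
    rw [this]
    push_cast
    rfl
  have hm : ∀ t, AEMeasurable (X t) P := fun t =>
    aemeasurable_of_map_eq_gaussianReal (hX.exists_map_eq_one t).choose_spec
  have h2 : Tendsto (fun t => ∫ ω, Complex.exp ((X t ω - X s ω : ℝ) * Complex.I) ∂P)
      (nhdsWithin s (Ici 0)) (nhds (∫ ω, (1:ℂ) ∂P)) := by
    refine tendsto_integral_filter_of_dominated_convergence (fun _ => 1) ?_ ?_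
      (integrable_const _) ?_
    · refine Eventually.of_forall fun t => AEMeasurable.aestronglyMeasurable ?_
      have : Measurable fun y : ℝ => Complex.exp (y * Complex.I) := by fun_prop
      exact this.comp_aemeasurable ((hm t).sub (hm s))
    · exact Eventually.of_forall fun t => ae_of_all _ fun ω => by
        rw [Complex.norm_exp_ofReal_mul_I]
    · refine ae_of_all _ fun ω => ?_
      have h3 : Tendsto (fun t => X t ω - X s ω) (nhdsWithin s (Ici 0)) (nhds 0) := by
        have : Tendsto (fun t => X t ω) (nhdsWithin s (Ici 0)) (nhds (X s ω)) := hc ω s hs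
        simpa using this.sub_const (X s ω)
      have h4 : Continuous fun y : ℝ => Complex.exp (y * Complex.I) := by fun_prop
      simpa [Function.comp_def] using (h4.tendsto 0).comp h3
  have h5 : Tendsto (fun t => Real.exp (-‖F t - F s‖ ^ 2 / 2)) (nhdsWithin s (Ici 0))
      (nhds 1) := by
    have h6 := (Complex.continuous_re.tendsto _).comp h2
    simp only [integral_const, probReal_univ, one_smul, Complex.one_re] at h6
    refine h6.congr' ?_
    filter_upwards [self_mem_nhdsWithin] with t ht
    rw [Function.comp_apply, h1 t ht, Complex.ofReal_re]
  have h7 := (h5.log one_ne_zero).const_mul (-2)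
  simp only [Real.log_exp, Real.log_one, mul_zero] at h7
  have h8 : Tendsto (fun t => ‖F t - F s‖) (nhdsWithin s (Ici 0)) (nhds 0) := by
    have h9 := h7.sqrt
    rw [Real.sqrt_zero] at h9
    refine h9.congr fun t => ?_
    rw [show -2 * (-‖F t - F s‖ ^ 2 / 2) = ‖F t - F s‖ ^ 2 by ring,
      Real.sqrt_sq (norm_nonneg _)]
  exact tendsto_iff_norm_sub_tendsto_zero.2 h8

end Covariance

lemma fracInt_eq_rpow_mul_integral {Ω : Type*} {θ : ℝ} (hθ : 0 < θ) (X : ℝ → Ω → ℝ) {t : ℝ}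
    (ht : 0 ≤ t) (ω : Ω) :
    fracInt θ X t ω =
      t ^ θ / Real.Gamma θ * ∫ x in (0:ℝ)..1, (1 - x) ^ (θ - 1) * X (t * x) ω := by
  rcases ht.eq_or_lt with rfl | ht
  · simp [fracInt, Real.zero_rpow hθ.ne']
  have h := intervalIntegral.smul_integral_comp_mul_left (a := 0) (b := 1)
    (fun u => (t - u) ^ (θ - 1) * X u ω) t
  rw [mul_zero, mul_one] at h
  rw [fracInt, ← h, smul_eq_mul, div_eq_mul_inv, mul_comm (t ^ θ), mul_assoc]
  congr 1
  rw [← intervalIntegral.integral_const_mul, ← intervalIntegral.integral_const_mul]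
  refine intervalIntegral.integral_congr fun x hx => ?_
  rw [uIcc_of_le zero_le_one] at hx
  change t * ((t - t * x) ^ (θ - 1) * X (t * x) ω) = t ^ θ * ((1 - x) ^ (θ - 1) * X (t * x) ω)
  rw [show t - t * x = t * (1 - x) by ring, Real.mul_rpow ht.le (by linarith [hx.2]),
    Real.rpow_sub_one ht.ne']
  field_simp

lemma intervalIntegrable_one_sub_rpow {θ : ℝ} (hθ : 0 < θ) :
    IntervalIntegrable (fun x : ℝ => (1 - x) ^ (θ - 1)) volume 0 1 := by
  have h := (intervalIntegral.intervalIntegrable_rpow' (a := 0) (b := 1)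
    (r := θ - 1) (by linarith)).comp_sub_left 1
  simpa using h.symm

/-- The representing element of `fracInt θ X t` when `F s` represents `X s`. -/
noncomputable def fracElem {E : Type*} [NormedAddCommGroup E] [NormedSpace ℝ E] (θ : ℝ)
    (F : ℝ → E) (t : ℝ) : E :=
  (t ^ θ / Real.Gamma θ) • ∫ x in (0:ℝ)..1, (1 - x) ^ (θ - 1) • F (t * x)

lemma continuousOn_comp_mul_Icc {V : Type*} [TopologicalSpace V] {F : ℝ → V}
    (hF : ContinuousOn F (Ici 0)) {t : ℝ} (ht : 0 ≤ t) :
    ContinuousOn (fun x => F (t * x)) (Icc 0 1) :=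
  hF.comp (by fun_prop) fun _ hx => mul_nonneg ht hx.1

lemma continuousOn_fracInt {Ω : Type*} {θ : ℝ} (hθ : 0 < θ) {X : ℝ → Ω → ℝ} {ω : Ω}
    (hc : ContinuousOn (fun t => X t ω) (Ici 0)) :
    ContinuousOn (fun t => fracInt θ X t ω) (Icc 0 1) := by
  have h : ContinuousOn (fun t : ℝ => t ^ θ / Real.Gamma θ *
      ∫ x in (0:ℝ)..1, (1 - x) ^ (θ - 1) * X (t * x) ω) (Icc 0 1) := by
    refine ((Real.continuous_rpow_const hθ.le).div_const _).continuousOn.mul ?_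
    obtain ⟨C, hC⟩ := isCompact_Icc.exists_bound_of_continuousOn
      (hc.mono (Icc_subset_Ici_self : Icc (0:ℝ) 1 ⊆ Ici 0))
    intro t ht
    refine intervalIntegral.continuousWithinAt_of_dominated_interval
      (bound := fun x => (1 - x) ^ (θ - 1) * C) ?_ ?_
      ((intervalIntegrable_one_sub_rpow hθ).mul_const _) ?_
    · filter_upwards [self_mem_nhdsWithin] with s hs
      rw [uIoc_of_le zero_le_one]
      refine AEStronglyMeasurable.mul
        (measurable_id.const_sub 1 |>.pow_const _).aestronglyMeasurable ?_
      exact ((continuousOn_comp_mul_Icc hc hs.1).mono Ioc_subset_Icc_self).aestronglyMeasurable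
        measurableSet_Ioc
    · filter_upwards [self_mem_nhdsWithin] with s hs
      refine ae_of_all _ fun x hx => ?_
      rw [uIoc_of_le zero_le_one] at hx
      rw [norm_mul, Real.norm_of_nonneg (Real.rpow_nonneg (by linarith [hx.2]) _)]
      exact mul_le_mul_of_nonneg_left (hC _ ⟨mul_nonneg hs.1 hx.1.le,
        mul_le_one₀ hs.2 hx.1.le hx.2⟩) (Real.rpow_nonneg (by linarith [hx.2]) _)
    · refine ae_of_all _ fun x hx => ?_
      rw [uIoc_of_le zero_le_one] at hx
      refine ContinuousWithinAt.mul continuousWithinAt_const ?_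
      have h1 : ContinuousOn (fun s => X (s * x) ω) (Icc 0 1) :=
        hc.comp (f := fun s => s * x) (by fun_prop) fun s hs => mul_nonneg hs.1 hx.1.le
      exact h1 t ht
  exact h.congr fun t ht => fracInt_eq_rpow_mul_integral hθ X ht.1 ω

lemma exists_riemann_weights {Ω : Type*} {E : Type*} [NormedAddCommGroup E]
    [InnerProductSpace ℝ E] [CompleteSpace E] {X : ℝ → Ω → ℝ} {F : ℝ → E} {θ : ℝ} (hθ : 0 < θ) :
    ∃ W : ∀ N : ℕ, Fin (N + 1) → ℝ,
    (∀ {t : ℝ} {ω : Ω}, 0 ≤ t → ContinuousOn (fun t => X t ω) (Ici 0) →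
      Tendsto (fun N => t ^ θ / Real.Gamma θ * ∑ m, W N m * X (t * (m / (N + 1))) ω) atTop
        (nhds (fracInt θ X t ω))) ∧
    (∀ {t : ℝ}, 0 ≤ t → ContinuousOn F (Ici 0) →
      Tendsto (fun N => (t ^ θ / Real.Gamma θ) • ∑ m, W N m • F (t * (m / (N + 1)))) atTop
        (nhds (fracElem θ F t))) := by
  have hw := intervalIntegrable_one_sub_rpow hθ
  have hw0 : ∀ x ∈ Icc (0:ℝ) 1, 0 ≤ (1 - x) ^ (θ - 1) := fun x hx =>
    Real.rpow_nonneg (by linarith [hx.2]) _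
  refine ⟨fun N m => ∫ x in (m / (N + 1) : ℝ)..((m + 1) / (N + 1) : ℝ), (1 - x) ^ (θ - 1),
    fun {t ω} ht hc => ?_, fun {t} ht hc => ?_⟩
  · rw [fracInt_eq_rpow_mul_integral hθ X ht]
    refine Tendsto.const_mul _ ?_
    have h := tendsto_sum_integral_smul_of_continuousOn hw hw0 (continuousOn_comp_mul_Icc hc ht)
    simp_rw [Finset.sum_range] at h
    simpa only [smul_eq_mul] using h
  · refine Tendsto.const_smul ?_ _
    have h := tendsto_sum_integral_smul_of_continuousOn hw hw0 (continuousOn_comp_mul_Icc hc ht)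
    simp_rw [Finset.sum_range] at h
    exact h

lemma IsCenteredGaussianProcess.aemeasurable_fracInt {Ω : Type*} [MeasurableSpace Ω]
    {P : Measure Ω} {X : ℝ → Ω → ℝ} {θ : ℝ} (hX : IsCenteredGaussianProcess P X)
    (hc : ∀ ω, ContinuousOn (fun t => X t ω) (Ici 0)) (hθ : 0 < θ) {t : ℝ} (ht : 0 ≤ t) :
    AEMeasurable (fracInt θ X t) P := by
  obtain ⟨W, hW, -⟩ := exists_riemann_weights (X := X) (F := fun _ => (0:ℝ)) hθ
  have hm : ∀ t, AEMeasurable (X t) P := fun t =>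
    aemeasurable_of_map_eq_gaussianReal (hX.exists_map_eq_one t).choose_spec
  refine aemeasurable_of_tendsto_metrizable_ae atTop (f := fun N ω =>
    t ^ θ / Real.Gamma θ * ∑ m, W N m * X (t * (m / (N + 1))) ω) (fun N => ?_)
    (ae_of_all _ fun ω => hW ht (hc ω))
  exact (Finset.aemeasurable_fun_sum _ fun i _ => (hm _).const_mul _).const_mul _

section Frac

variable {Ω : Type*} [MeasurableSpace Ω] {P : Measure Ω} [IsProbabilityMeasure P]
  {E : Type*} [NormedAddCommGroup E] [InnerProductSpace ℝ E] [CompleteSpace E]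
  {X : ℝ → Ω → ℝ} {F : ℝ → E} {θ : ℝ}

lemma IsCenteredGaussianProcess.integral_cexp_fracInt (hX : IsCenteredGaussianProcess P X)
    (hc : ∀ ω, ContinuousOn (fun t => X t ω) (Ici 0)) (hθ : 0 < θ)
    (hF : ∀ s t : ℝ, 0 ≤ s → 0 ≤ t → ∫ ω, X s ω * X t ω ∂P = inner ℝ (F s) (F t))
    {ι : Type*} [Fintype ι] (t c : ι → ℝ) (ht : ∀ i, 0 ≤ t i) :
    ∫ ω, Complex.exp ((∑ i, c i * fracInt θ X (t i) ω : ℝ) * Complex.I) ∂P =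
      Complex.exp (-((‖∑ i, c i • fracElem θ F (t i)‖ ^ 2 : ℝ) : ℂ) / 2) := by
  obtain ⟨W, hW, hW'⟩ := exists_riemann_weights (X := X) (F := F) hθ
  have hFc := hX.continuousOn_of_inner hF hc
  have hm : ∀ t, AEMeasurable (X t) P := fun t =>
    aemeasurable_of_map_eq_gaussianReal (hX.exists_map_eq_one t).choose_spec
  have h1 : Tendsto (fun N => ∫ ω, Complex.exp ((∑ i, c i * (t i ^ θ / Real.Gamma θ *
      ∑ m, W N m * X (t i * (m / (N + 1))) ω) : ℝ) * Complex.I) ∂P) atTop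
      (nhds (∫ ω, Complex.exp ((∑ i, c i * fracInt θ X (t i) ω : ℝ) * Complex.I) ∂P)) := by
    have h4 : Continuous fun y : ℝ => Complex.exp (y * Complex.I) := by fun_prop
    refine tendsto_integral_of_dominated_convergence (fun _ => 1) (fun N => ?_)
      (integrable_const _) (fun N => ae_of_all _ fun ω => ?_) (ae_of_all _ fun ω => ?_)
    · refine AEMeasurable.aestronglyMeasurable (h4.measurable.comp_aemeasurable ?_)
      exact Finset.aemeasurable_fun_sum _ fun i _ =>
        ((Finset.aemeasurable_fun_sum _ fun i _ => (hm _).const_mul _).const_mul _).const_mul _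
    · rw [Complex.norm_exp_ofReal_mul_I]
    · exact (h4.tendsto _).comp (tendsto_finsetSum _ fun i _ =>
        (hW (ht i) (hc ω)).const_mul (c i))
  have h2 : Tendsto (fun N => Complex.exp (-((‖∑ i, c i • ((t i ^ θ / Real.Gamma θ) •
      ∑ m, W N m • F (t i * (m / (N + 1))))‖ ^ 2 : ℝ) : ℂ) / 2)) atTop
      (nhds (Complex.exp (-((‖∑ i, c i • fracElem θ F (t i)‖ ^ 2 : ℝ) : ℂ) / 2))) := by
    have h4 : Continuous fun y : E => Complex.exp (-((‖y‖ ^ 2 : ℝ) : ℂ) / 2) := by fun_prop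
    exact (h4.tendsto _).comp (tendsto_finsetSum _ fun i _ => (hW' (ht i) hFc).const_smul (c i))
  refine tendsto_nhds_unique h1 (h2.congr fun N => ?_)
  have h := hX.integral_cexp hF (ι := ι × Fin (N + 1)) (fun p => t p.1 * (p.2 / (N + 1)))
    (fun p => c p.1 * (t p.1 ^ θ / Real.Gamma θ * W N p.2))
    (fun p => mul_nonneg (ht _) (by positivity))
  simp_rw [Fintype.sum_prod_type] at h
  simp_rw [Finset.mul_sum, Finset.smul_sum, smul_smul]
  simp_rw [mul_assoc] at h ⊢
  exact h.symm

/-- Lower bound for the small balls of `fracInt θ X` out of an expansion of its representing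
elements along a wavelet-like family of vectors. -/
lemma exists_le_measure_iSup_fracInt_le (hX : IsCenteredGaussianProcess P X)
    (hc : ∀ ω, ContinuousOn (fun t => X t ω) (Ici 0)) (hθ : 0 < θ)
    (hF : ∀ s t : ℝ, 0 ≤ s → 0 ≤ t → ∫ ω, X s ω * X t ω ∂P = inner ℝ (F s) (F t))
    {B : Type*} [Countable B] {w : B → ℝ} (hw0 : ∀ b, 0 < w b)
    (hw : ∀ p : ℝ, 0 < p → Summable fun b => w b ^ p) {β : ℝ} (hβ : 0 < β) (M : ℕ)
    {D : ℝ} (hD : 0 < D) (e : (Σ p : B × ℕ, Fin (M * 2 ^ p.2)) → E)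
    (hsum : ∀ f ∈ Submodule.span ℝ (fracElem θ F '' Icc 0 1),
      HasSum (fun k => (inner ℝ (e k) f) ^ 2) (‖f‖ ^ 2))
    (hdec : ∀ t ∈ Icc (0:ℝ) 1, ∀ p : B × ℕ,
      ∑ i, |inner ℝ (e ⟨p, i⟩) (fracElem θ F t)| ≤ D * w p.1 * 2 ^ (-(β * p.2))) :
    ∃ κ : ℝ, 0 < κ ∧ ∀ ε ∈ Ioo (0:ℝ) 1,
      ENNReal.ofReal (Real.exp (-κ * ε ^ (-(1/β)))) ≤
        P {ω | ⨆ t : Icc (0:ℝ) 1, |fracInt θ X t.1 ω| ≤ ε} := by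
  obtain ⟨κ, hκ, h⟩ := exists_thresholds hw0 hw hβ M hD
  refine ⟨κ, hκ, fun ε hε => ?_⟩
  obtain ⟨x, hx1, hx2⟩ := h ε hε
  let d := TopologicalSpace.denseSeq (Icc (0:ℝ) 1)
  have hfin : ∀ n : ℕ, ENNReal.ofReal (Real.exp (-κ * ε ^ (-(1/β)))) ≤
      P {ω | ∀ i : Fin n, |fracInt θ X (d i).1 ω| ≤ ε} := by
    intro n
    refine le_measure_forall_abs_le_of_series (Z := fun ω (i : Fin n) => fracInt θ X (d i).1 ω)
      (aemeasurable_pi_lambda _ fun i => hX.aemeasurable_fracInt hc hθ (d i).2.1)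
      (q := fun c => ‖∑ i, c i • fracElem θ F (d i).1‖ ^ 2)
      (fun c => hX.integral_cexp_fracInt hc hθ hF _ c fun i => (d i).2.1)
      (a := fun k i => inner ℝ (e k) (fracElem θ F (d i).1)) (x := x) (fun c => ?_)
      (fun i S => hx1 _ (fun p => hdec _ (d i).2 p) S) hx2
    have h1 := hsum (∑ i, c i • fracElem θ F (d i).1) (Submodule.sum_mem _ fun i _ =>
      Submodule.smul_mem _ _ (Submodule.subset_span ⟨_, (d i).2, rfl⟩))
    simpa only [inner_sum, inner_smul_right] using h1
  have hanti : Antitone fun n : ℕ => {ω | ∀ i : Fin n, |fracInt θ X (d i).1 ω| ≤ ε} := by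
    intro m n hmn ω hω i
    exact hω ⟨i, i.2.trans_le hmn⟩
  have hmeas : ∀ n : ℕ, NullMeasurableSet {ω | ∀ i : Fin n, |fracInt θ X (d i).1 ω| ≤ ε} P := by
    intro n
    rw [Set.ofPred_forall]
    refine NullMeasurableSet.iInter fun i => ?_
    have := (hX.aemeasurable_fracInt hc hθ (d i).2.1).abs
    exact nullMeasurableSet_le this aemeasurable_const
  have hlim := tendsto_measure_iInter_atTop hmeas hanti ⟨0, measure_ne_top _ _⟩
  refine (ge_of_tendsto' hlim hfin).trans (measure_mono fun ω hω => ?_)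
  have hω' : ∀ n, |fracInt θ X (d n).1 ω| ≤ ε := fun n =>
    mem_iInter.1 hω (n + 1) ⟨n, n.lt_succ_self⟩
  have hcont : Continuous fun t : Icc (0:ℝ) 1 => |fracInt θ X t.1 ω| :=
    (continuousOn_iff_continuous_domRestrict.1 (continuousOn_fracInt hθ (hc ω))).abs
  have hcl : IsClosed {t : Icc (0:ℝ) 1 | |fracInt θ X t.1 ω| ≤ ε} :=
    isClosed_le hcont continuous_const
  have hall : ∀ t : Icc (0:ℝ) 1, |fracInt θ X t.1 ω| ≤ ε := by
    refine fun t => isClosed_property (TopologicalSpace.denseRange_denseSeq _) hcl hω' t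
  have : Nonempty (Icc (0:ℝ) 1) := ⟨⟨0, by simp⟩⟩
  exact ciSup_le hall

end Frac

section Multiscale

variable {E : Type*} [NormedAddCommGroup E] [InnerProductSpace ℝ E]

lemma sum_range_two_mul {M : Type*} [AddCommMonoid M] (g : ℕ → M) (n : ℕ) :
    ∑ m ∈ Finset.range (2 * n), g m = ∑ m ∈ Finset.range n, (g (2 * m) + g (2 * m + 1)) := by
  induction n with
  | zero => simp
  | succ n ih =>
    rw [Finset.sum_range_succ, ← ih, mul_add, mul_one, Finset.sum_range_succ,
      Finset.sum_range_succ, add_assoc]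

lemma exists_family_sum_inner_sq_eq (W : Submodule ℝ E) [FiniteDimensional ℝ W] {n : ℕ}
    (hn : Module.finrank ℝ W ≤ n) :
    ∃ v : Fin n → E, (∀ i, v i ∈ W) ∧ (∀ i, ‖v i‖ ≤ 1) ∧
      ∀ f, ∑ i, (inner ℝ (v i) f) ^ 2 = ‖W.starProjection f‖ ^ 2 := by
  let b := stdOrthonormalBasis ℝ W
  refine ⟨fun i => if h : i.1 < Module.finrank ℝ W then (b ⟨i, h⟩ : E) else 0, ?_, ?_, ?_⟩
  · intro i
    dsimp only
    split_ifs
    exacts [Subtype.coe_prop _, W.zero_mem]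
  · intro i
    dsimp only
    split_ifs with h
    · exact (b.orthonormal.1 ⟨i, h⟩).le
    · simp
  · intro f
    have h1 := b.sum_sq_norm_inner_right (W.orthogonalProjectionOnto f)
    have h2 : ‖W.starProjection f‖ = ‖W.orthogonalProjectionOnto f‖ := rfl
    rw [h2, ← h1]
    rw [← Finset.sum_subset (Finset.subset_univ
      (Finset.univ.map (Fin.castLEEmb hn)))]
    · rw [Finset.sum_map]
      refine Finset.sum_congr rfl fun i _ => ?_
      have : (Fin.castLEEmb hn i).1 < Module.finrank ℝ W := i.2
      dsimp only
      rw [dif_pos this, Real.norm_eq_abs, sq_abs, Submodule.coe_inner]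
      congr 1
      have h3 := W.starProjection_inner_eq_zero f (b i) (Subtype.coe_prop _)
      rw [inner_sub_left, sub_eq_zero, real_inner_comm, real_inner_comm _ (W.starProjection f)]
        at h3
      exact h3
    · intro i _ hi
      have : ¬ i.1 < Module.finrank ℝ W := by
        intro h
        exact hi (Finset.mem_map.2 ⟨⟨i, h⟩, Finset.mem_univ _, rfl⟩)
      dsimp only
      rw [dif_neg this]
      simp

lemma norm_starProjection_inf_orthogonal_sq {V₀ V₁ V₂ : Submodule ℝ E} [FiniteDimensional ℝ V₀]
    [FiniteDimensional ℝ V₁] [FiniteDimensional ℝ V₂] (h : V₀ ≤ V₁ ⊔ V₂)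
    (h12 : ∀ x ∈ V₁, ∀ y ∈ V₂, inner ℝ x y = 0)
    [((V₁ ⊔ V₂) ⊓ V₀ᗮ).HasOrthogonalProjection] (f : E) :
    ‖V₀.starProjection f‖ ^ 2 + ‖((V₁ ⊔ V₂) ⊓ V₀ᗮ).starProjection f‖ ^ 2 =
      ‖V₁.starProjection f‖ ^ 2 + ‖V₂.starProjection f‖ ^ 2 := by
  set p := V₀.starProjection f
  set p₁ := V₁.starProjection f
  set p₂ := V₂.starProjection f
  have hp : p ∈ V₀ := V₀.starProjection_apply_mem f
  have hp₁ : p₁ ∈ V₁ := V₁.starProjection_apply_mem f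
  have hp₂ : p₂ ∈ V₂ := V₂.starProjection_apply_mem f
  have hf0 : ∀ x ∈ V₀, inner ℝ (f - p) x = 0 := V₀.starProjection_inner_eq_zero f
  have hfv : ∀ x ∈ V₁ ⊔ V₂, inner ℝ (f - (p₁ + p₂)) x = 0 := by
    intro x hx
    obtain ⟨y, hy, z, hz, rfl⟩ := Submodule.mem_sup.1 hx
    have h1 := V₁.starProjection_inner_eq_zero f y hy
    have h2 := V₂.starProjection_inner_eq_zero f z hz
    have h3 := h12 p₁ hp₁ z hz
    have h4 := h12 y hy p₂ hp₂
    rw [real_inner_comm] at h4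
    rw [inner_sub_left] at h1 h2 ⊢
    rw [inner_add_left, inner_add_right, inner_add_right, inner_add_right, h3, h4]
    linarith
  have hv : p₁ + p₂ - p ∈ (V₁ ⊔ V₂) ⊓ V₀ᗮ := by
    refine ⟨Submodule.sub_mem _ (Submodule.add_mem_sup hp₁ hp₂) (h hp), ?_⟩
    rw [SetLike.mem_coe, Submodule.mem_orthogonal']
    intro x hx
    have h1 := hf0 x hx
    have h2 := hfv x (h hx)
    rw [show p₁ + p₂ - p = (f - p) - (f - (p₁ + p₂)) by abel, inner_sub_left, h1, h2, sub_zero]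
  have hW : ((V₁ ⊔ V₂) ⊓ V₀ᗮ).starProjection f = p₁ + p₂ - p := by
    refine Submodule.eq_starProjection_of_mem_of_inner_eq_zero hv fun x hx => ?_
    have h1 := hfv x hx.1
    have h2 : inner ℝ p x = 0 := (Submodule.mem_orthogonal _ _).1 hx.2 p hp
    rw [show f - (p₁ + p₂ - p) = (f - (p₁ + p₂)) + p by abel, inner_add_left, h1, h2, add_zero]
  rw [hW]
  have h3 : inner ℝ p (p₁ + p₂ - p) = 0 := (Submodule.mem_orthogonal _ _).1 hv.2 p hp
  have h4 := norm_add_sq_eq_norm_sq_add_norm_sq_of_inner_eq_zero _ _ h3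
  have h5 := norm_add_sq_eq_norm_sq_add_norm_sq_of_inner_eq_zero _ _ (h12 p₁ hp₁ p₂ hp₂)
  rw [add_sub_cancel] at h4
  nlinarith

/-- A dyadic tree of localizations `R j m` (`m < 2 ^ j`) in a Hilbert space, together with local
approximation spaces `V j m` of dimension at most `r`. -/
structure DyadicTree (E : Type*) [NormedAddCommGroup E] [InnerProductSpace ℝ E] (r : ℕ) where
  R : ℕ → ℕ → E →ₗ[ℝ] E
  V : ℕ → ℕ → Submodule ℝ E
  fin : ∀ j m, FiniteDimensional ℝ (V j m)
  finrank_le : ∀ j m, Module.finrank ℝ (V j m) ≤ r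
  symm : ∀ j m e f, inner ℝ (R j m e) f = inner ℝ e (R j m f)
  idem : ∀ j m f, R j m (R j m f) = R j m f
  norm_sq : ∀ j m f, ‖R j m f‖ ^ 2 = ‖R (j + 1) (2 * m) f‖ ^ 2 + ‖R (j + 1) (2 * m + 1) f‖ ^ 2
  R_eq : ∀ j m, ∀ v ∈ V j m, R j m v = v
  R_eq_left : ∀ j m, ∀ v ∈ V (j + 1) (2 * m), R j m v = v
  R_eq_right : ∀ j m, ∀ v ∈ V (j + 1) (2 * m + 1), R j m v = v
  le_sup : ∀ j m, V j m ≤ V (j + 1) (2 * m) ⊔ V (j + 1) (2 * m + 1)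
  inner_eq_zero : ∀ j m, ∀ v ∈ V (j + 1) (2 * m), ∀ w ∈ V (j + 1) (2 * m + 1), inner ℝ v w = 0

namespace DyadicTree

variable {r : ℕ} (T : DyadicTree E r)

instance (j m : ℕ) : FiniteDimensional ℝ (T.V j m) := T.fin j m

/-- Elements localized at `(j, m)` and orthogonal to `V j m` have small inner product with `f`. -/
def DualBound (j m : ℕ) (f : E) (δ : ℝ) : Prop :=
  0 ≤ δ ∧ ∀ e, T.R j m e = e → (∀ v ∈ T.V j m, inner ℝ v e = 0) → |inner ℝ e f| ≤ δ * ‖e‖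

lemma inner_sub_R {j m : ℕ} {v : E} (hv : v ∈ T.V j m) (f : E) :
    inner ℝ v (f - T.R j m f) = 0 := by
  rw [← T.R_eq j m v hv, T.symm, map_sub, T.idem, sub_self, inner_zero_right]

lemma inner_R_sub_proj {j m : ℕ} {v : E} (hv : v ∈ T.V j m) (f : E) :
    inner ℝ v (T.R j m f - (T.V j m).starProjection f) = 0 := by
  have h1 := T.inner_sub_R hv f
  have h2 := (T.V j m).starProjection_inner_eq_zero f v hv
  rw [real_inner_comm] at h2
  rw [inner_sub_right] at *
  linarith

lemma norm_R_sq (j m : ℕ) (f : E) :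
    ‖T.R j m f‖ ^ 2 =
      ‖(T.V j m).starProjection f‖ ^ 2 + ‖T.R j m f - (T.V j m).starProjection f‖ ^ 2 := by
  have h := norm_add_sq_eq_norm_sq_add_norm_sq_of_inner_eq_zero _ _
    (T.inner_R_sub_proj ((T.V j m).starProjection_apply_mem f) f)
  rw [add_sub_cancel] at h
  nlinarith

lemma DualBound.norm_sub_le {T : DyadicTree E r} {j m : ℕ} {f : E} {δ : ℝ}
    (h : T.DualBound j m f δ) : ‖T.R j m f - (T.V j m).starProjection f‖ ≤ δ := by
  set e := T.R j m f - (T.V j m).starProjection f with he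
  have hRe : T.R j m e = e := by
    rw [he, map_sub, T.idem, T.R_eq j m _ ((T.V j m).starProjection_apply_mem f)]
  have h1 := h.2 e hRe fun v hv => T.inner_R_sub_proj hv f
  have h2 : inner ℝ e f = ‖e‖ ^ 2 := by
    rw [← real_inner_self_eq_norm_sq]
    have h3 : inner ℝ e (f - T.R j m f) = 0 := by
      rw [← hRe, T.symm, map_sub, T.idem, sub_self, inner_zero_right]
    have h4 : inner ℝ e ((T.V j m).starProjection f) = 0 := by
      rw [real_inner_comm]
      exact T.inner_R_sub_proj ((T.V j m).starProjection_apply_mem f) f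
    rw [inner_sub_right] at h3
    conv_rhs => rw [he, inner_sub_right, ← he]
    linarith
  rw [h2, abs_of_nonneg (sq_nonneg _)] at h1
  rcases (norm_nonneg e).eq_or_lt with h0 | h0
  · rw [← h0]; exact h.1
  · nlinarith

lemma sum_norm_R_sq (j : ℕ) (f : E) :
    ∑ m ∈ Finset.range (2 ^ j), ‖T.R j m f‖ ^ 2 = ‖T.R 0 0 f‖ ^ 2 := by
  induction j with
  | zero => simp
  | succ j ih =>
    rw [← ih, pow_succ, mul_comm, sum_range_two_mul]
    exact Finset.sum_congr rfl fun m _ => (T.norm_sq j m f).symm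

/-- The details lost when approximating by `V j m` rather than by its two children. -/
noncomputable def W (j m : ℕ) : Submodule ℝ E :=
  (T.V (j + 1) (2 * m) ⊔ T.V (j + 1) (2 * m + 1)) ⊓ (T.V j m)ᗮ

instance (j m : ℕ) : FiniteDimensional ℝ (T.W j m) :=
  Submodule.finiteDimensional_of_le (inf_le_left)

lemma finrank_W_le (j m : ℕ) : Module.finrank ℝ (T.W j m) ≤ 2 * r := by
  have h1 : Module.finrank ℝ (T.W j m) ≤ _ := Submodule.finrank_mono
    (inf_le_left : T.W j m ≤ T.V (j + 1) (2 * m) ⊔ T.V (j + 1) (2 * m + 1))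
  have h2 := Submodule.finrank_add_le_finrank_add_finrank (T.V (j + 1) (2 * m))
    (T.V (j + 1) (2 * m + 1))
  have h3 := T.finrank_le (j + 1) (2 * m)
  have h4 := T.finrank_le (j + 1) (2 * m + 1)
  omega

lemma norm_proj_add_norm_proj_W (j m : ℕ) (f : E) :
    ‖(T.V j m).starProjection f‖ ^ 2 + ‖(T.W j m).starProjection f‖ ^ 2 =
      ‖(T.V (j + 1) (2 * m)).starProjection f‖ ^ 2 +
        ‖(T.V (j + 1) (2 * m + 1)).starProjection f‖ ^ 2 :=
  haveI : ((T.V (j + 1) (2 * m) ⊔ T.V (j + 1) (2 * m + 1)) ⊓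
    (T.V j m)ᗮ).HasOrthogonalProjection :=
      inferInstanceAs (T.W j m).HasOrthogonalProjection
  norm_starProjection_inf_orthogonal_sq (T.le_sup j m) (T.inner_eq_zero j m) f

lemma sum_norm_proj_W (J : ℕ) (f : E) :
    ‖(T.V 0 0).starProjection f‖ ^ 2 +
      ∑ j ∈ Finset.range J, ∑ m ∈ Finset.range (2 ^ j), ‖(T.W j m).starProjection f‖ ^ 2 =
      ∑ m ∈ Finset.range (2 ^ J), ‖(T.V J m).starProjection f‖ ^ 2 := by
  induction J with
  | zero => simp
  | succ J ih =>
    rw [Finset.sum_range_succ, ← add_assoc, ih, pow_succ, mul_comm _ 2, sum_range_two_mul,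
      ← Finset.sum_add_distrib]
    exact Finset.sum_congr rfl fun m _ => T.norm_proj_add_norm_proj_W J m f

/-- The elements approximated by the spaces `V j m` as `j → ∞`. -/
def approximable : Submodule ℝ E where
  carrier := {f | Tendsto (fun j => ∑ m ∈ Finset.range (2 ^ j),
    ‖T.R j m f - (T.V j m).starProjection f‖) atTop (nhds 0)}
  zero_mem' := by simp
  add_mem' := by
    intro f g hf hg
    have h := hf.add hg
    rw [add_zero] at h
    refine squeeze_zero (fun j => Finset.sum_nonneg fun m _ => norm_nonneg _) (fun j => ?_) h
    rw [← Finset.sum_add_distrib]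
    refine Finset.sum_le_sum fun m _ => ?_
    rw [map_add, map_add, add_sub_add_comm]
    exact norm_add_le _ _
  smul_mem' := by
    intro c f hf
    have h := hf.const_mul |c|
    rw [mul_zero] at h
    refine h.congr fun j => ?_
    rw [Finset.mul_sum]
    refine Finset.sum_congr rfl fun m _ => ?_
    rw [map_smul, map_smul, ← smul_sub, norm_smul, Real.norm_eq_abs]

lemma tendsto_sum_norm_proj {f : E} (hf : f ∈ T.approximable) :
    Tendsto (fun j => ∑ m ∈ Finset.range (2 ^ j), ‖(T.V j m).starProjection f‖ ^ 2) atTop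
      (nhds (‖T.R 0 0 f‖ ^ 2)) := by
  have hf' : Tendsto (fun j => ∑ m ∈ Finset.range (2 ^ j),
    ‖T.R j m f - (T.V j m).starProjection f‖) atTop (nhds 0) := hf
  have h1 : Tendsto (fun j => ∑ m ∈ Finset.range (2 ^ j),
      ‖T.R j m f - (T.V j m).starProjection f‖ ^ 2) atTop (nhds 0) := by
    have h2 := hf'.pow 2
    rw [zero_pow two_ne_zero] at h2
    refine squeeze_zero (fun j => Finset.sum_nonneg fun m _ => sq_nonneg _) (fun j => ?_) h2
    exact Finset.sum_sq_le_sq_sum_of_nonneg fun m _ => norm_nonneg _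
  have h3 := h1.const_sub (‖T.R 0 0 f‖ ^ 2)
  rw [sub_zero] at h3
  refine h3.congr fun j => ?_
  rw [← T.sum_norm_R_sq j f, ← Finset.sum_sub_distrib]
  refine Finset.sum_congr rfl fun m _ => ?_
  rw [T.norm_R_sq]
  ring

lemma mem_approximable_of_dualBound {f : E} {δ : ℕ → ℕ → ℝ}
    (hδ : ∀ j, ∀ m < 2 ^ j, T.DualBound j m f (δ j m))
    (hlim : Tendsto (fun j => ∑ m ∈ Finset.range (2 ^ j), δ j m) atTop (nhds 0)) :
    f ∈ T.approximable :=
  squeeze_zero (fun _ => Finset.sum_nonneg fun _ _ => norm_nonneg _)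
    (fun j => Finset.sum_le_sum fun m hm => (hδ j m (Finset.mem_range.1 hm)).norm_sub_le) hlim

/-- A Parseval family adapted to the tree. -/
lemma exists_family (T : DyadicTree E r) :
    ∃ e : ∀ j, Fin (r * 2 ^ j) → E,
      (∀ f δ, (∀ e', T.R 0 0 e' = e' → |inner ℝ e' f| ≤ δ * ‖e'‖) → 0 ≤ δ →
        ∑ i, |inner ℝ (e 0 i) f| ≤ r * δ) ∧
      (∀ f j (δ : ℕ → ℝ), (∀ m < 2 ^ j, T.DualBound j m f (δ m)) →
        ∑ i, |inner ℝ (e (j + 1) i) f| ≤ 2 * r * ∑ m ∈ Finset.range (2 ^ j), δ m) ∧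
      ∀ f ∈ T.approximable, HasSum (fun j => ∑ i, (inner ℝ (e j i) f) ^ 2) (‖T.R 0 0 f‖ ^ 2) := by
  obtain ⟨v, hv, hv1, hvf⟩ := exists_family_sum_inner_sq_eq (T.V 0 0) (T.finrank_le 0 0)
  choose u hu hu1 huf using fun j m =>
    exists_family_sum_inner_sq_eq (T.W j m) (T.finrank_W_le j m)
  have hcard : ∀ j, Fintype.card (Fin (r * 2 ^ (j + 1))) =
      Fintype.card (Fin (2 ^ j) × Fin (2 * r)) := by
    intro j
    simp only [Fintype.card_fin, Fintype.card_prod]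
    ring
  let ψ := fun j => Fintype.equivOfCardEq (hcard j)
  have hcard0 : Fintype.card (Fin (r * 2 ^ 0)) = Fintype.card (Fin r) := by simp
  let ψ₀ := Fintype.equivOfCardEq hcard0
  let e : ∀ j, Fin (r * 2 ^ j) → E := fun j => match j with
    | 0 => fun i => v (ψ₀ i)
    | j + 1 => fun i => u j (ψ j i).1 (ψ j i).2
  have he0 : ∀ g : E → ℝ, ∑ i, g (e 0 i) = ∑ i, g (v i) := fun g =>
    Equiv.sum_comp ψ₀ fun i => g (v i)
  have he : ∀ j (g : E → ℝ), ∑ i, g (e (j + 1) i) =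
      ∑ m ∈ Finset.range (2 ^ j), ∑ i, g (u j m i) := by
    intro j g
    rw [Finset.sum_range, ← Fintype.sum_prod_type' (f := fun (m : Fin (2 ^ j)) i => g (u j m i))]
    exact Equiv.sum_comp (ψ j) fun p => g (u j p.1 p.2)
  refine ⟨e, fun f δ h hδ => ?_, fun f j δ h => ?_, fun f hf => ?_⟩
  · rw [he0 fun x => |inner ℝ x f|]
    refine (Finset.sum_le_card_nsmul _ _ δ fun i _ => ?_).trans (by simp)
    exact (h _ (T.R_eq 0 0 _ (hv i))).trans (mul_le_of_le_one_right hδ (hv1 i))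
  · rw [he j fun x => |inner ℝ x f|, Finset.mul_sum]
    refine Finset.sum_le_sum fun m hm => ?_
    have hb := h m (Finset.mem_range.1 hm)
    refine (Finset.sum_le_card_nsmul _ _ (δ m) fun i _ => ?_).trans (by simp)
    have hW := hu j m i
    refine (hb.2 _ ?_ fun x hx => (Submodule.mem_orthogonal _ _).1 hW.2 x hx).trans
      (mul_le_of_le_one_right hb.1 (hu1 j m i))
    obtain ⟨y, hy, z, hz, hyz⟩ := Submodule.mem_sup.1 hW.1
    rw [← hyz, map_add, T.R_eq_left j m y hy, T.R_eq_right j m z hz]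
  · rw [hasSum_iff_tendsto_nat_of_nonneg fun j => Finset.sum_nonneg fun i _ => sq_nonneg _]
    rw [← tendsto_add_atTop_iff_nat 1]
    refine (T.tendsto_sum_norm_proj hf).congr fun J => ?_
    rw [Finset.sum_range_succ', he0 fun x => (inner ℝ x f) ^ 2, hvf, ← T.sum_norm_proj_W J f,
      add_comm]
    congr 1
    refine Finset.sum_congr rfl fun j _ => ?_
    rw [he j fun x => (inner ℝ x f) ^ 2]
    exact Finset.sum_congr rfl fun m _ => (huf j m f).symm

end DyadicTree

lemma hasSum_sigma_prod_of_nonneg {B : Type*} {n : ℕ → ℕ}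
    {g : (Σ p : B × ℕ, Fin (n p.2)) → ℝ} (hg : ∀ k, 0 ≤ g k) {s : B → ℝ} {S : ℝ}
    (h : ∀ b, HasSum (fun j => ∑ i, g ⟨(b, j), i⟩) (s b)) (hs : HasSum s S) : HasSum g S := by
  have h1 : Summable fun p : B × ℕ => ∑ i, g ⟨p, i⟩ := by
    rw [summable_prod_of_nonneg fun p => Finset.sum_nonneg fun i _ => hg _]
    refine ⟨fun b => (h b).summable, ?_⟩
    simp_rw [fun b => (h b).tsum_eq]
    exact hs.summable
  have h2 : Summable g := by
    rw [summable_sigma_of_nonneg hg]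
    refine ⟨fun p => Summable.of_finite, ?_⟩
    simpa only [tsum_fintype] using h1
  have h3 : HasSum (fun p : B × ℕ => ∑ i, g ⟨p, i⟩) (∑' k, g k) :=
    h2.hasSum.sigma fun p => hasSum_fintype _
  have h4 := h3.prod_fiberwise h
  rw [hs.unique h4]
  exact h2.hasSum

end Multiscale

section Localization

variable {μ : Measure ℝ}

/-- Restriction of an `L²` function to a measurable set. -/
noncomputable def restrictL2 (μ : Measure ℝ) {A : Set ℝ} (hA : MeasurableSet A) :
    Lp ℝ 2 μ →ₗ[ℝ] Lp ℝ 2 μ where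
  toFun f := ((Lp.memLp f).indicator hA).toLp
  map_add' f g := by
    ext1
    filter_upwards [((Lp.memLp (f + g)).indicator hA).coeFn_toLp,
      ((Lp.memLp f).indicator hA).coeFn_toLp, ((Lp.memLp g).indicator hA).coeFn_toLp,
      Lp.coeFn_add f g, Lp.coeFn_add ((Lp.memLp f).indicator hA).toLp
        ((Lp.memLp g).indicator hA).toLp] with x h1 h2 h3 h4 h5
    rw [h1, h5, Pi.add_apply, h2, h3]
    by_cases hx : x ∈ A
    · simp only [indicator_of_mem hx]
      exact h4
    · simp only [indicator_of_notMem hx, add_zero]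
  map_smul' c f := by
    ext1
    filter_upwards [((Lp.memLp (c • f)).indicator hA).coeFn_toLp,
      ((Lp.memLp f).indicator hA).coeFn_toLp,
      Lp.coeFn_smul c f, Lp.coeFn_smul c ((Lp.memLp f).indicator hA).toLp] with x h1 h2 h4 h5
    rw [RingHom.id_apply, h1, h5, Pi.smul_apply, h2]
    by_cases hx : x ∈ A <;> simp [hx, h4]

lemma coeFn_restrictL2 {A : Set ℝ} (hA : MeasurableSet A) (f : Lp ℝ 2 μ) :
    restrictL2 μ hA f =ᵐ[μ] A.indicator f :=
  ((Lp.memLp f).indicator hA).coeFn_toLp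

lemma restrictL2_restrictL2 {A B : Set ℝ} (hA : MeasurableSet A) (hB : MeasurableSet B)
    (f : Lp ℝ 2 μ) : restrictL2 μ hA (restrictL2 μ hB f) = restrictL2 μ (hA.inter hB) f := by
  ext1
  filter_upwards [coeFn_restrictL2 hA (restrictL2 μ hB f), coeFn_restrictL2 hB f,
    coeFn_restrictL2 (hA.inter hB) f] with x h1 h2 h3
  rw [h1, h3]
  by_cases hx : x ∈ A <;> by_cases hx' : x ∈ B <;> simp [hx, hx', h2]

lemma restrictL2_congr {A B : Set ℝ} (hA : MeasurableSet A) (hB : MeasurableSet B) (h : A = B) :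
    restrictL2 μ hA = restrictL2 μ hB := by
  subst h; rfl

lemma inner_restrictL2_left {A : Set ℝ} (hA : MeasurableSet A) (e f : Lp ℝ 2 μ) :
    inner ℝ (restrictL2 μ hA e) f = ∫ x in A, e x * f x ∂μ := by
  rw [L2.inner_def, ← integral_indicator hA]
  refine integral_congr_ae ?_
  filter_upwards [coeFn_restrictL2 hA e] with x h1
  rw [h1]
  by_cases hx : x ∈ A <;> simp [hx, mul_comm]

lemma inner_restrictL2_right {A : Set ℝ} (hA : MeasurableSet A) (e f : Lp ℝ 2 μ) :
    inner ℝ (restrictL2 μ hA e) f = inner ℝ e (restrictL2 μ hA f) := by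
  rw [inner_restrictL2_left, real_inner_comm, inner_restrictL2_left]
  simp_rw [mul_comm]

lemma norm_restrictL2_sq {A : Set ℝ} (hA : MeasurableSet A) (f : Lp ℝ 2 μ) :
    ‖restrictL2 μ hA f‖ ^ 2 = ∫ x in A, f x ^ 2 ∂μ := by
  rw [← real_inner_self_eq_norm_sq, ← inner_restrictL2_right, restrictL2_restrictL2,
    restrictL2_congr (hA.inter hA) hA (inter_self A), inner_restrictL2_left]
  simp_rw [sq]

/-- The monomial `x ^ i` on the set `A`, as an element of `L²`. -/
noncomputable def monoL2 (μ : Measure ℝ) (A : Set ℝ) (i : ℕ) : Lp ℝ 2 μ :=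
  open Classical in if h : MemLp (A.indicator fun x => x ^ i) 2 μ then h.toLp else 0

lemma restrictL2_monoL2 {A B : Set ℝ} (hA : MeasurableSet A) (h : B ⊆ A) (i : ℕ) :
    restrictL2 μ hA (monoL2 μ B i) = monoL2 μ B i := by
  rw [monoL2]
  split_ifs with h1
  · ext1
    filter_upwards [coeFn_restrictL2 hA h1.toLp, h1.coeFn_toLp] with x h2 h3
    rw [h2]
    by_cases hx : x ∈ A
    · simp [hx]
    · have : x ∉ B := fun hB => hx (h hB)
      simp [hx, h3, this]
  · simp

lemma monoL2_union {A B : Set ℝ} (hA : MeasurableSet A) (hB : MeasurableSet B)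
    (h : Disjoint A B) (i : ℕ) (hm : MemLp ((A ∪ B).indicator fun x => x ^ i) 2 μ) :
    monoL2 μ (A ∪ B) i = monoL2 μ A i + monoL2 μ B i := by
  have hmA : MemLp (A.indicator fun x => x ^ i) 2 μ := by
    have := hm.indicator hA
    rwa [indicator_indicator, inter_eq_left.2 subset_union_left] at this
  have hmB : MemLp (B.indicator fun x => x ^ i) 2 μ := by
    have := hm.indicator hB
    rwa [indicator_indicator, inter_eq_left.2 subset_union_right] at this
  rw [monoL2, monoL2, monoL2, dif_pos hm, dif_pos hmA, dif_pos hmB]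
  ext1
  filter_upwards [hm.coeFn_toLp, hmA.coeFn_toLp, hmB.coeFn_toLp,
    Lp.coeFn_add hmA.toLp hmB.toLp] with x h1 h2 h3 h4
  rw [h1, h4, Pi.add_apply, h2, h3, indicator_union_of_disjoint h]

/-- Polynomials of degree less than `r` on the set `A`. -/
noncomputable def polyL2 (μ : Measure ℝ) (r : ℕ) (A : Set ℝ) : Submodule ℝ (Lp ℝ 2 μ) :=
  Submodule.span ℝ (range fun i : Fin r => monoL2 μ A i)

lemma restrictL2_of_mem_polyL2 {r : ℕ} {A B : Set ℝ} (hA : MeasurableSet A) (h : B ⊆ A)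
    {v : Lp ℝ 2 μ} (hv : v ∈ polyL2 μ r B) : restrictL2 μ hA v = v := by
  have : polyL2 μ r B ≤ LinearMap.eqLocus (restrictL2 μ hA) LinearMap.id := by
    refine Submodule.span_le.2 ?_
    rintro _ ⟨i, rfl⟩
    exact restrictL2_monoL2 hA h i
  exact this hv

lemma polyL2_union_le {r : ℕ} {A B : Set ℝ} (hA : MeasurableSet A) (hB : MeasurableSet B)
    (h : Disjoint A B) : polyL2 μ r (A ∪ B) ≤ polyL2 μ r A ⊔ polyL2 μ r B := by
  refine Submodule.span_le.2 ?_
  rintro _ ⟨i, rfl⟩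
  by_cases hm : MemLp ((A ∪ B).indicator fun x => x ^ (i : ℕ)) 2 μ
  · rw [SetLike.mem_coe]
    simp only
    rw [monoL2_union hA hB h i hm]
    exact Submodule.add_mem_sup (Submodule.subset_span ⟨i, rfl⟩)
      (Submodule.subset_span ⟨i, rfl⟩)
  · simp only [monoL2, dif_neg hm]
    exact Submodule.zero_mem _

/-- The `m`-th dyadic subinterval of level `j` of `(a, a + ℓ]`. -/
def dyadicIoc (a ℓ : ℝ) (j m : ℕ) : Set ℝ :=
  Ioc (a + m * (ℓ / 2 ^ j)) (a + (m + 1) * (ℓ / 2 ^ j))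

lemma measurableSet_dyadicIoc (a ℓ : ℝ) (j m : ℕ) : MeasurableSet (dyadicIoc a ℓ j m) :=
  measurableSet_Ioc

lemma dyadicIoc_eq_union {a ℓ : ℝ} (hℓ : 0 ≤ ℓ) (j m : ℕ) :
    dyadicIoc a ℓ j m = dyadicIoc a ℓ (j + 1) (2 * m) ∪ dyadicIoc a ℓ (j + 1) (2 * m + 1) := by
  have h : 0 ≤ ℓ / 2 ^ (j + 1) := by positivity
  have h2 : ℓ / 2 ^ j = 2 * (ℓ / 2 ^ (j + 1)) := by rw [pow_succ]; field_simp
  simp only [dyadicIoc, h2]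
  push_cast
  rw [Ioc_union_Ioc_eq_Ioc (by nlinarith) (by nlinarith)]
  congr 1 <;> ring

lemma disjoint_dyadicIoc (a ℓ : ℝ) (j m : ℕ) :
    Disjoint (dyadicIoc a ℓ (j + 1) (2 * m)) (dyadicIoc a ℓ (j + 1) (2 * m + 1)) := by
  simp only [dyadicIoc]
  push_cast
  exact Ioc_disjoint_Ioc_of_le le_rfl

/-- Piecewise polynomial multiresolution of `L²(μ)` on the interval `(a, a + ℓ]`. -/
noncomputable def polyTree (μ : Measure ℝ) (r : ℕ) (a : ℝ) {ℓ : ℝ} (hℓ : 0 ≤ ℓ) :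
    DyadicTree (Lp ℝ 2 μ) r where
  R j m := restrictL2 μ (measurableSet_dyadicIoc a ℓ j m)
  V j m := polyL2 μ r (dyadicIoc a ℓ j m)
  fin j m := FiniteDimensional.span_of_finite ℝ (finite_range _)
  finrank_le j m := by
    exact (finrank_range_le_card (R := ℝ)
      fun i : Fin r => monoL2 μ (dyadicIoc a ℓ j m) i).trans_eq (Fintype.card_fin r)
  symm j m e f := inner_restrictL2_right _ e f
  idem j m f := by
    rw [restrictL2_restrictL2]
    exact LinearMap.congr_fun (restrictL2_congr _ _ (inter_self _)) f
  norm_sq j m f := by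
    simp only [norm_restrictL2_sq]
    rw [dyadicIoc_eq_union hℓ j m, setIntegral_union (disjoint_dyadicIoc a ℓ j m)
      (measurableSet_dyadicIoc _ _ _ _) (Lp.memLp f).integrable_sq.integrableOn
      (Lp.memLp f).integrable_sq.integrableOn]
  R_eq j m v hv := restrictL2_of_mem_polyL2 _ Subset.rfl hv
  R_eq_left j m v hv := restrictL2_of_mem_polyL2 _
    (by rw [dyadicIoc_eq_union hℓ j m]; exact subset_union_left) hv
  R_eq_right j m v hv := restrictL2_of_mem_polyL2 _
    (by rw [dyadicIoc_eq_union hℓ j m]; exact subset_union_right) hv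
  le_sup j m := by
    rw [dyadicIoc_eq_union hℓ j m]
    exact polyL2_union_le (measurableSet_dyadicIoc _ _ _ _) (measurableSet_dyadicIoc _ _ _ _)
      (disjoint_dyadicIoc a ℓ j m)
  inner_eq_zero j m v hv w hw := by
    rw [← restrictL2_of_mem_polyL2 (measurableSet_dyadicIoc _ _ _ _) Subset.rfl hv,
      ← restrictL2_of_mem_polyL2 (measurableSet_dyadicIoc _ _ _ _) Subset.rfl hw,
      inner_restrictL2_right, restrictL2_restrictL2,
      restrictL2_congr _ MeasurableSet.empty (disjoint_dyadicIoc a ℓ j m).inter_eq]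
    have : restrictL2 μ MeasurableSet.empty w = 0 := by
      ext1
      filter_upwards [coeFn_restrictL2 MeasurableSet.empty w, Lp.coeFn_zero ℝ 2 μ] with x h1 h2
      rw [h1, h2]
      simp
    rw [this, inner_zero_right]

lemma integrableOn_mul_of_eLpNorm_le {A : Set ℝ} {φ : ℝ → ℝ}
    (hφ : Measurable φ) {δ : ℝ} (h : eLpNorm φ 2 (μ.restrict A) ≤ ENNReal.ofReal δ)
    (e : Lp ℝ 2 μ) : IntegrableOn (fun x => e x * φ x) A μ :=
  MemLp.integrable_mul ((Lp.memLp e).restrict A)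
    ⟨hφ.aestronglyMeasurable, h.trans_lt ENNReal.ofReal_lt_top⟩

lemma abs_setIntegral_mul_le {A : Set ℝ} (hA : MeasurableSet A) {φ : ℝ → ℝ}
    (hφ : Measurable φ) {δ : ℝ} (hδ : 0 ≤ δ)
    (h : eLpNorm φ 2 (μ.restrict A) ≤ ENNReal.ofReal δ) (e : Lp ℝ 2 μ) :
    |∫ x in A, e x * φ x ∂μ| ≤ δ * ‖e‖ := by
  have hm : MemLp (A.indicator φ) 2 μ := by
    rw [memLp_indicator_iff_restrict hA]
    exact ⟨hφ.aestronglyMeasurable, h.trans_lt ENNReal.ofReal_lt_top⟩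
  have h1 : ∫ x in A, e x * φ x ∂μ = inner ℝ hm.toLp e := by
    rw [L2.inner_def, ← integral_indicator hA]
    refine integral_congr_ae ?_
    filter_upwards [hm.coeFn_toLp] with x hx
    rw [hx]
    by_cases hx : x ∈ A <;> simp [hx]
  rw [h1]
  refine (abs_real_inner_le_norm _ _).trans (mul_le_mul_of_nonneg_right ?_ (norm_nonneg _))
  rw [Lp.norm_toLp, eLpNorm_indicator_eq_eLpNorm_restrict hA]
  exact ENNReal.toReal_le_of_le_ofReal hδ h

/-- If `f` acts on `A` by integration against `φ`, and `φ` is `δ`-close to a polynomial in `L²`,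
then `f` acts with norm at most `δ` on the orthogonal of the polynomials. -/
lemma dualBound_polyTree {r : ℕ} {a ℓ : ℝ} (hℓ : 0 ≤ ℓ) {j m : ℕ} {f : Lp ℝ 2 μ} {φ : ℝ → ℝ}
    (hμ : μ (dyadicIoc a ℓ j m) ≠ ⊤)
    (hf : ∀ e, restrictL2 μ (measurableSet_dyadicIoc a ℓ j m) e = e →
      inner ℝ e f = ∫ x in dyadicIoc a ℓ j m, e x * φ x ∂μ)
    (hφ : Measurable φ) (c : Fin r → ℝ) {δ : ℝ} (hδ : 0 ≤ δ)
    (h : eLpNorm (fun x => φ x - ∑ i, c i * x ^ (i : ℕ)) 2 (μ.restrict (dyadicIoc a ℓ j m)) ≤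
      ENNReal.ofReal δ) : (polyTree μ r a hℓ).DualBound j m f δ := by
  refine ⟨hδ, fun e he hv => ?_⟩
  set A := dyadicIoc a ℓ j m with hAdef
  have hA : MeasurableSet A := measurableSet_dyadicIoc a ℓ j m
  have hmono : ∀ i : ℕ, MemLp (A.indicator fun x => x ^ i) 2 μ := by
    intro i
    rw [memLp_indicator_iff_restrict hA]
    have : IsFiniteMeasure (μ.restrict A) := ⟨by simpa using hμ.lt_top⟩
    obtain ⟨C, hC⟩ := isCompact_Icc.exists_bound_of_continuousOn
      (s := Icc (a + m * (ℓ / 2 ^ j)) (a + (m + 1) * (ℓ / 2 ^ j))) (f := fun x : ℝ => x ^ i)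
      (by fun_prop)
    refine MemLp.of_bound (by fun_prop) C ?_
    filter_upwards [ae_restrict_mem hA] with x hx
    exact hC x (Ioc_subset_Icc_self hx)
  have h_int : ∀ i : Fin r, IntegrableOn (fun x => e x * x ^ (i : ℕ)) A μ := fun i =>
    MemLp.integrable_mul ((Lp.memLp e).restrict A)
      ((memLp_indicator_iff_restrict hA).1 (hmono i))
  have hzero : ∀ i : Fin r, ∫ x in A, e x * x ^ (i : ℕ) ∂μ = 0 := by
    intro i
    rw [← hv (monoL2 μ A i) (Submodule.subset_span ⟨i, rfl⟩), L2.inner_def, monoL2,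
      dif_pos (hmono i), ← integral_indicator hA]
    refine integral_congr_ae ?_
    filter_upwards [(hmono i).coeFn_toLp] with x hx
    rw [hx]
    by_cases hx : x ∈ A <;> simp [hx]
  have hψ : Measurable fun x => φ x - ∑ i, c i * x ^ (i : ℕ) := by fun_prop
  have h1 := abs_setIntegral_mul_le hA hψ hδ h e
  have h2 := integrableOn_mul_of_eLpNorm_le hψ h e
  have h3 : ∫ x in A, e x * ∑ i, c i * x ^ (i : ℕ) ∂μ = 0 := by
    simp_rw [Finset.mul_sum, mul_left_comm]
    rw [integral_finsetSum _ fun i _ => (h_int i).const_mul (c i)]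
    refine Finset.sum_eq_zero fun i _ => ?_
    rw [integral_const_mul, hzero, mul_zero]
  have h4 : IntegrableOn (fun x => e x * ∑ i, c i * x ^ (i : ℕ)) A μ := by
    simp_rw [Finset.mul_sum, mul_left_comm]
    exact integrable_finsetSum _ fun i _ => (h_int i).const_mul (c i)
  rw [hf e he]
  convert h1 using 2
  have h5 := integral_add h2 h4
  rw [h3, add_zero] at h5
  rw [← h5]
  refine integral_congr_ae (ae_of_all _ fun x => ?_)
  simp only
  ring

end Localization

section KernelEstimates

/-- A function whose `r`-th derivative is bounded by `M` on an interval is close to a polynomial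
of degree less than `r`. -/
lemma exists_polynomial_approx (r : ℕ) (φ : ℕ → ℝ → ℝ) {a b M : ℝ}
    (hφ : ∀ i < r, ∀ u ∈ Icc a b, HasDerivAt (φ i) (φ (i + 1) u) u)
    (hM : ∀ u ∈ Icc a b, |φ r u| ≤ M) :
    ∃ c : Fin r → ℝ, ∀ u ∈ Icc a b, |φ 0 u - ∑ i, c i * u ^ (i : ℕ)| ≤ M * (b - a) ^ r := by
  induction r generalizing φ with
  | zero => exact ⟨fun _ => 0, by simpa using hM⟩
  | succ r ih =>
    obtain ⟨c, hc⟩ := ih (fun i => φ (i + 1))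
      (fun i hi u hu => hφ (i + 1) (by lia) u hu) hM
    set g : ℝ → ℝ := fun u => φ 0 u - ∑ i : Fin r, c i / (i + 1) * u ^ ((i : ℕ) + 1) with hg
    have hgd : ∀ u ∈ Icc a b, HasDerivAt g (φ 1 u - ∑ i, c i * u ^ (i : ℕ)) u := by
      intro u hu
      refine (hφ 0 (by lia) u hu).sub ?_
      refine HasDerivAt.fun_sum fun i _ => ?_
      have := (hasDerivAt_pow ((i : ℕ) + 1) u).const_mul (c i / ((i : ℕ) + 1))
      refine this.congr_deriv ?_
      have : ((i : ℕ) : ℝ) + 1 ≠ 0 := by positivity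
      push_cast
      field_simp
    refine ⟨Fin.cons (g a) fun i => c i / (i + 1), fun u hu => ?_⟩
    have hab : a ≤ b := hu.1.trans hu.2
    have h0 := (convex_Icc a b).norm_image_sub_le_of_norm_hasDerivWithin_le
      (fun x hx => (hgd x hx).hasDerivWithinAt) (fun x hx => hc x hx) (left_mem_Icc.2 hab) hu
    have hM0 : 0 ≤ M := (abs_nonneg _).trans (hM u hu)
    rw [Fin.sum_univ_succ]
    simp only [Fin.cons_zero, Fin.cons_succ, Fin.val_zero, pow_zero, mul_one, Fin.val_succ]
    have h1 : φ 0 u - (g a + ∑ i : Fin r, c i / (i + 1) * u ^ ((i : ℕ) + 1)) = g u - g a := by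
      rw [hg]; ring
    rw [h1, pow_succ, ← mul_assoc]
    refine h0.trans (mul_le_mul_of_nonneg_left ?_
      (mul_nonneg hM0 (pow_nonneg (sub_nonneg.2 hab) _)))
    rw [norm_of_nonneg (sub_nonneg.2 hu.1)]
    linarith [hu.2]

lemma hasDerivAt_prod_mul_sub_rpow {t u : ℝ} (ρ : ℝ) (i : ℕ) (h : u < t) :
    HasDerivAt (fun u => (∏ k ∈ Finset.range i, ((k : ℝ) - ρ)) * (t - u) ^ (ρ - i))
      ((∏ k ∈ Finset.range (i + 1), ((k : ℝ) - ρ)) * (t - u) ^ (ρ - (i + 1 : ℕ))) u := by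
  have h1 : HasDerivAt (fun u => t - u) (-1) u := by
    simpa using (hasDerivAt_id u).const_sub t
  have h2 := (h1.rpow_const (p := ρ - i) (Or.inl (sub_pos.2 h).ne')).const_mul
    (∏ k ∈ Finset.range i, ((k : ℝ) - ρ))
  refine h2.congr_deriv ?_
  rw [Finset.prod_range_succ]
  push_cast
  rw [show ρ - (i + 1) = ρ - i - 1 by ring]
  ring

/-- The measure `|u| ^ (-γ) du` on the real line. -/
noncomputable def powMeasure (γ : ℝ) : Measure ℝ :=
  volume.withDensity fun u => ENNReal.ofReal (|u| ^ (-γ))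

lemma powMeasure_restrict_le {γ : ℝ} (hγ : 0 ≤ γ) {l : ℝ} (hl : 0 < l) {A : Set ℝ}
    (hA : MeasurableSet A) (hAl : ∀ u ∈ A, l ≤ |u|) :
    (powMeasure γ).restrict A ≤ ENNReal.ofReal (l ^ (-γ)) • volume.restrict A := by
  rw [powMeasure, restrict_withDensity hA, ← withDensity_const]
  refine withDensity_mono ?_
  filter_upwards [ae_restrict_mem hA] with u hu
  refine ENNReal.ofReal_le_ofReal ?_
  exact rpow_le_rpow_of_nonpos hl (hAl u hu) (neg_nonpos.2 hγ)

lemma eLpNorm_powMeasure_le {γ : ℝ} (hγ : 0 ≤ γ) {l : ℝ} (hl : 0 < l) {A : Set ℝ}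
    (hA : MeasurableSet A) (hAl : ∀ u ∈ A, l ≤ |u|) {φ : ℝ → ℝ} {S : ℝ} (hS : 0 ≤ S)
    (h : ∫⁻ u in A, ENNReal.ofReal (φ u ^ 2) ≤ ENNReal.ofReal (S ^ 2)) :
    eLpNorm φ 2 ((powMeasure γ).restrict A) ≤ ENNReal.ofReal (l ^ (-γ / 2) * S) := by
  refine (eLpNorm_mono_measure φ (powMeasure_restrict_le hγ hl hA hAl)).trans ?_
  rw [eLpNorm_smul_measure_of_ne_top (by simp), smul_eq_mul,
    ENNReal.ofReal_mul (by positivity)]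
  refine mul_le_mul' (le_of_eq ?_) ?_
  · rw [ENNReal.toReal_div, ENNReal.toReal_one, ENNReal.toReal_ofNat,
      ENNReal.ofReal_rpow_of_pos (by positivity), ← rpow_mul hl.le]
    ring_nf
  · rw [eLpNorm_eq_lintegral_rpow_enorm_toReal (by simp) (by simp)]
    simp only [ENNReal.toReal_ofNat]
    calc (∫⁻ x in A, ‖φ x‖ₑ ^ (2:ℝ)) ^ (1 / (2:ℝ))
        = (∫⁻ u in A, ENNReal.ofReal (φ u ^ 2)) ^ (1 / (2:ℝ)) := by
          congr 2
          funext x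
          rw [enorm_eq_ofReal_abs, ENNReal.ofReal_rpow_of_nonneg (abs_nonneg _) (by norm_num)]
          simp
      _ ≤ ENNReal.ofReal (S ^ 2) ^ (1 / (2:ℝ)) := ENNReal.rpow_le_rpow h (by norm_num)
      _ = ENNReal.ofReal S := by
          rw [ENNReal.ofReal_rpow_of_nonneg (by positivity) (by norm_num), ← sqrt_eq_rpow,
            sqrt_sq hS]

lemma eLpNorm_powMeasure_le_of_bound {γ : ℝ} (hγ : 0 ≤ γ) {l : ℝ} (hl : 0 < l) {a h : ℝ}
    (h0 : 0 ≤ h) (hAl : ∀ u ∈ Ioc a (a + h), l ≤ |u|) {φ : ℝ → ℝ} {M : ℝ} (hM : 0 ≤ M)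
    (hb : ∀ u ∈ Ioc a (a + h), |φ u| ≤ M) :
    eLpNorm φ 2 ((powMeasure γ).restrict (Ioc a (a + h))) ≤
      ENNReal.ofReal (l ^ (-γ / 2) * (M * h ^ (1 / 2 : ℝ))) := by
  refine eLpNorm_powMeasure_le hγ hl measurableSet_Ioc hAl (by positivity) ?_
  calc ∫⁻ u in Ioc a (a + h), ENNReal.ofReal (φ u ^ 2)
      ≤ ∫⁻ u in Ioc a (a + h), ENNReal.ofReal (M ^ 2) := by
        refine setLIntegral_mono measurable_const fun u hu => ENNReal.ofReal_le_ofReal ?_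
        rw [← sq_abs]
        exact pow_le_pow_left₀ (abs_nonneg _) (hb u hu) 2
    _ = ENNReal.ofReal ((M * h ^ (1 / 2 : ℝ)) ^ 2) := by
        rw [setLIntegral_const, Real.volume_Ioc, ← ENNReal.ofReal_mul (by positivity), mul_pow,
          ← sqrt_eq_rpow, sq_sqrt h0]
        ring_nf

/-- The truncated power function `x ↦ x₊ ^ ρ`, vanishing for `x ≤ 0` whatever `ρ` is. -/
noncomputable def posRpow (ρ x : ℝ) : ℝ := if 0 < x then x ^ ρ else 0

lemma posRpow_of_pos {ρ x : ℝ} (h : 0 < x) : posRpow ρ x = x ^ ρ := if_pos h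

lemma posRpow_of_nonpos {ρ x : ℝ} (h : x ≤ 0) : posRpow ρ x = 0 := if_neg h.not_gt

lemma posRpow_nonneg (ρ x : ℝ) : 0 ≤ posRpow ρ x := by
  rw [posRpow]
  split_ifs <;> positivity

lemma measurable_posRpow (ρ : ℝ) : Measurable (posRpow ρ) :=
  Measurable.ite measurableSet_Ioi (by fun_prop) measurable_const

lemma max_zero_rpow {ρ : ℝ} (hρ : ρ ≠ 0) (x : ℝ) : max x 0 ^ ρ = posRpow ρ x := by
  rcases le_or_gt x 0 with h | h
  · rw [posRpow_of_nonpos h, max_eq_right h, zero_rpow hρ]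
  · rw [posRpow_of_pos h, max_eq_left h.le]

lemma eLpNorm_powMeasure_posRpow_le {γ : ℝ} (hγ : 0 ≤ γ) {l : ℝ} (hl : 0 < l) {a h : ℝ}
    (h0 : 0 ≤ h) (hAl : ∀ u ∈ Ioc a (a + h), l ≤ |u|) {ρ : ℝ} (hρ : -1 / 2 < ρ)
    {t : ℝ} (ht : t ≤ a + 2 * h) :
    eLpNorm (fun u => posRpow ρ (t - u)) 2 ((powMeasure γ).restrict (Ioc a (a + h))) ≤
      ENNReal.ofReal (l ^ (-γ / 2) * ((2 * h) ^ (ρ + 1 / 2) / √(2 * ρ + 1))) := by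
  have hρ1 : 0 < 2 * ρ + 1 := by linarith
  refine eLpNorm_powMeasure_le hγ hl measurableSet_Ioc hAl (by positivity) ?_
  have hi : IntervalIntegrable (fun x : ℝ => (t - x) ^ (2 * ρ)) volume t (t - 2 * h) := by
    have := (intervalIntegral.intervalIntegrable_rpow' (a := 0) (b := 2 * h) (r := 2 * ρ)
      (by linarith)).comp_sub_left t
    simpa using this
  have hn : ∀ x ∈ Ioc (t - 2 * h) t, 0 ≤ (t - x) ^ (2 * ρ) := fun x hx =>
    rpow_nonneg (sub_nonneg.2 hx.2) _
  calc ∫⁻ u in Ioc a (a + h), ENNReal.ofReal (posRpow ρ (t - u) ^ 2)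
      ≤ ∫⁻ u in Ioc (t - 2 * h) t, ENNReal.ofReal ((t - u) ^ (2 * ρ)) := by
        rw [← lintegral_indicator measurableSet_Ioc, ← lintegral_indicator measurableSet_Ioc]
        refine lintegral_mono fun u => ?_
        by_cases hu : u ∈ Ioc a (a + h)
        · rw [indicator_of_mem hu]
          by_cases hut : u < t
          · rw [indicator_of_mem (show u ∈ Ioc (t - 2 * h) t from ⟨by linarith [hu.1], hut.le⟩),
              posRpow_of_pos (by linarith),
              ← rpow_natCast, ← rpow_mul (by linarith)]
            simp [mul_comm]
          · rw [posRpow_of_nonpos (by linarith)]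
            simp
        · rw [indicator_of_notMem hu]
          exact zero_le
    _ = ENNReal.ofReal (∫ u in Ioc (t - 2 * h) t, (t - u) ^ (2 * ρ)) := by
        rw [ofReal_integral_eq_lintegral_ofReal]
        · exact (intervalIntegrable_iff_integrableOn_Ioc_of_le (by linarith)).1 hi.symm
        · exact (ae_restrict_iff' measurableSet_Ioc).2 (ae_of_all _ hn)
    _ = ENNReal.ofReal (((2 * h) ^ (ρ + 1 / 2) / √(2 * ρ + 1)) ^ 2) := by
        rw [← intervalIntegral.integral_of_le (by linarith),
          intervalIntegral.integral_comp_sub_left (fun x : ℝ => x ^ (2 * ρ)) t,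
          integral_rpow (Or.inl (by linarith)), div_pow, sq_sqrt hρ1.le, ← rpow_natCast _ 2,
          ← rpow_mul (by positivity)]
        simp only [sub_self, sub_sub_cancel]
        rw [zero_rpow hρ1.ne', sub_zero]
        congr 3
        push_cast
        ring

/-- Local polynomial approximation of `u ↦ (t - u)₊ ^ ρ` at distance at least the length of the
interval from the singularity. -/
lemma exists_eLpNorm_posRpow_sub_le {γ : ℝ} (hγ : 0 ≤ γ) (ρ : ℝ) {r : ℕ} (hr : ρ + 2 ≤ r)
    {l : ℝ} (hl : 0 < l) {a h : ℝ} (h0 : 0 < h) (hAl : ∀ u ∈ Ioc a (a + h), l ≤ |u|)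
    {t x : ℝ} (hx : 2 ≤ x) (ht : a + x * h ≤ t) :
    ∃ c : Fin r → ℝ,
      eLpNorm (fun u => posRpow ρ (t - u) - ∑ i, c i * u ^ (i : ℕ)) 2
        ((powMeasure γ).restrict (Ioc a (a + h))) ≤
      ENNReal.ofReal (|∏ k ∈ Finset.range r, ((k : ℝ) - ρ)| *
        (l ^ (-γ / 2) * h ^ (ρ + 1 / 2) * ((x - 1) ^ 2)⁻¹)) := by
  set Q := |∏ k ∈ Finset.range r, ((k : ℝ) - ρ)| with hQ
  have hlt : ∀ u ∈ Icc a (a + h), h * (x - 1) ≤ t - u := fun u hu => by linarith [hu.2]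
  have hpos : 0 < h * (x - 1) := mul_pos h0 (by linarith)
  obtain ⟨c, hc⟩ := exists_polynomial_approx r
    (fun i u => (∏ k ∈ Finset.range i, ((k : ℝ) - ρ)) * (t - u) ^ (ρ - i))
    (a := a) (b := a + h) (M := Q * (h * (x - 1)) ^ (ρ - r))
    (fun i _ u hu => hasDerivAt_prod_mul_sub_rpow ρ i
      (sub_pos.1 (hpos.trans_le (hlt u hu))))
    (fun u hu => by
      rw [abs_mul, abs_of_nonneg (rpow_nonneg (hpos.trans_le (hlt u hu)).le _)]
      exact mul_le_mul_of_nonneg_left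
        (rpow_le_rpow_of_nonpos hpos (hlt u hu) (by linarith)) (abs_nonneg _))
  refine ⟨c, ?_⟩
  have hM : 0 ≤ Q * (h * (x - 1)) ^ (ρ - r) * h ^ r := by positivity
  refine (eLpNorm_powMeasure_le_of_bound hγ hl h0.le hAl hM fun u hu => ?_).trans
    (ENNReal.ofReal_le_ofReal ?_)
  · have := hc u (Ioc_subset_Icc_self hu)
    simpa [posRpow_of_pos (hpos.trans_le (hlt u (Ioc_subset_Icc_self hu)))] using this
  · have h1 : h ^ (ρ + 1 / 2) = h ^ (ρ - r) * h ^ r * h ^ (1 / 2 : ℝ) := by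
      rw [← rpow_natCast, ← rpow_add h0, ← rpow_add h0]
      ring_nf
    have h2 : (x - 1) ^ (ρ - r) ≤ ((x - 1) ^ 2)⁻¹ := by
      rw [← rpow_natCast, ← rpow_neg (by linarith)]
      exact rpow_le_rpow_of_exponent_le (by linarith) (by push_cast; linarith)
    rw [h1, mul_rpow h0.le (by linarith)]
    calc l ^ (-γ / 2) * (Q * (h ^ (ρ - r) * (x - 1) ^ (ρ - r)) * h ^ r * h ^ (1 / 2 : ℝ))
        = Q * (l ^ (-γ / 2) * (h ^ (ρ - r) * h ^ r * h ^ (1 / 2 : ℝ)) * (x - 1) ^ (ρ - r)) := by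
          ring
      _ ≤ _ := by gcongr

/-- Local polynomial approximation of `u ↦ (t - u)₊ ^ ρ` on the dyadic subintervals of a block,
with errors that are summable over the subintervals of each level. -/
lemma exists_eLpNorm_posRpow_dyadic_le {γ : ℝ} (hγ : 0 ≤ γ) {ρ : ℝ} (hρ : -1 / 2 < ρ) {r : ℕ}
    (hr : ρ + 2 ≤ r) :
    ∃ C, 0 ≤ C ∧ ∀ (l : ℝ), 0 < l → ∀ (t : ℝ) (j : ℕ), ∃ δ : ℕ → ℝ, (∀ m, 0 ≤ δ m) ∧
      (∀ m, ∃ c : Fin r → ℝ,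
        eLpNorm (fun u => posRpow ρ (t - u) - ∑ i, c i * u ^ (i : ℕ)) 2
          ((powMeasure γ).restrict (dyadicIoc l l j m)) ≤ ENNReal.ofReal (δ m)) ∧
      ∀ N, ∑ m ∈ Finset.range N, δ m ≤ C * (l ^ (-γ / 2) * (l / 2 ^ j) ^ (ρ + 1 / 2)) := by
  have hρ1 : 0 < 2 * ρ + 1 := by linarith
  set Q := |∏ k ∈ Finset.range r, ((k : ℝ) - ρ)| with hQ
  set K := Q + 2 ^ (ρ + 1 / 2) / √(2 * ρ + 1) with hK
  have hK1 : Q ≤ K := le_add_of_nonneg_right (by positivity)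
  have hK2 : 2 ^ (ρ + 1 / 2) / √(2 * ρ + 1) ≤ K := le_add_of_nonneg_left (abs_nonneg _)
  have hK0 : 0 ≤ K := (abs_nonneg _).trans hK1
  have hs : Summable fun n : ℕ => (((n : ℝ) + 1) ^ 2)⁻¹ := by
    simpa using (summable_nat_add_iff 1).2 (Real.summable_nat_pow_inv.2 one_lt_two)
  refine ⟨K * (9 * ∑' n : ℕ, (((n : ℝ) + 1) ^ 2)⁻¹), by positivity, fun l hl t j => ?_⟩
  set h := l / 2 ^ j with hh
  have h0 : 0 < h := by positivity
  set n := ⌊(t - l) / h⌋₊ with hn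
  set L := l ^ (-γ / 2) * h ^ (ρ + 1 / 2) with hL
  have hL0 : 0 ≤ L := by positivity
  refine ⟨fun m => if m ≤ n then K * L * (9 * ((((n - m : ℕ) : ℝ) + 1) ^ 2)⁻¹) else 0,
    fun m => by dsimp only; split_ifs <;> positivity, fun m => ?_, fun N => ?_⟩
  · have hI : dyadicIoc l l j m = Ioc (l + m * h) (l + m * h + h) := by
      rw [dyadicIoc, ← hh]; congr 1; ring
    have hAl : ∀ u ∈ Ioc (l + m * h) (l + m * h + h), l ≤ |u| := fun u hu => by
      have : 0 ≤ m * h := by positivity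
      exact le_trans (by linarith [hu.1]) (le_abs_self u)
    rw [hI]
    dsimp only
    split_ifs with hm
    · rcases le_or_gt (m + 2) n with hmn | hmn
      · have hx : (2:ℝ) ≤ ((n - m : ℕ) : ℝ) := by exact_mod_cast (by lia : 2 ≤ n - m)
        have ht : l + m * h + ((n - m : ℕ) : ℝ) * h ≤ t := by
          have h1 : (n : ℝ) ≤ (t - l) / h := Nat.floor_le (by
            by_contra! hneg
            have : n = 0 := Nat.floor_of_nonpos hneg.le
            lia)
          rw [le_div_iff₀ h0] at h1
          rw [Nat.cast_sub hm]
          linarith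
        obtain ⟨c, hc⟩ := exists_eLpNorm_posRpow_sub_le hγ ρ hr hl h0 hAl hx ht
        refine ⟨c, hc.trans (ENNReal.ofReal_le_ofReal ?_)⟩
        rw [mul_assoc K]
        gcongr
        set y := ((n - m : ℕ) : ℝ)
        rw [← div_eq_mul_inv, inv_eq_one_div, div_le_div_iff₀ (by nlinarith) (by positivity)]
        nlinarith
      · refine ⟨0, ?_⟩
        have ht : t ≤ l + m * h + 2 * h := by
          have h1 : (t - l) / h < n + 1 := Nat.lt_floor_add_one _
          rw [div_lt_iff₀ h0] at h1
          have h2 : (n : ℝ) ≤ m + 1 := by exact_mod_cast (by lia : n ≤ m + 1)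
          nlinarith
        have := eLpNorm_powMeasure_posRpow_le hγ hl h0.le hAl hρ ht
        simp only [Pi.zero_apply, zero_mul, Finset.sum_const_zero, sub_zero]
        refine this.trans (ENNReal.ofReal_le_ofReal ?_)
        rw [mul_rpow (by norm_num) h0.le]
        calc l ^ (-γ / 2) * (2 ^ (ρ + 1 / 2) * h ^ (ρ + 1 / 2) / √(2 * ρ + 1))
            = 2 ^ (ρ + 1 / 2) / √(2 * ρ + 1) * L * 1 := by rw [hL]; ring
          _ ≤ K * L * (9 * ((((n - m : ℕ) : ℝ) + 1) ^ 2)⁻¹) := by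
            gcongr
            have h3 : ((n - m : ℕ) : ℝ) ≤ 1 := by exact_mod_cast (by lia : n - m ≤ 1)
            have h4 : (0:ℝ) ≤ ((n - m : ℕ) : ℝ) := Nat.cast_nonneg _
            rw [← div_eq_mul_inv, le_div_iff₀ (by positivity)]
            nlinarith
    · refine ⟨0, ?_⟩
      have ht : t ≤ l + m * h := by
        have h1 : (t - l) / h < m := (Nat.floor_lt' (by lia)).1 (not_le.1 hm)
        rw [div_lt_iff₀ h0] at h1
        linarith
      simp only [Pi.zero_apply, zero_mul, Finset.sum_const_zero, sub_zero, ENNReal.ofReal_zero]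
      refine (eLpNorm_powMeasure_le_of_bound hγ hl h0.le hAl (M := 0) le_rfl
        fun u hu => ?_).trans (by simp)
      rw [posRpow_of_nonpos (by linarith [hu.1]), abs_zero]
  · rw [← Finset.sum_filter]
    calc ∑ m ∈ Finset.range N with m ≤ n, K * L * (9 * ((((n - m : ℕ) : ℝ) + 1) ^ 2)⁻¹)
        ≤ ∑ m ∈ Finset.range (n + 1), K * L * (9 * ((((n - m : ℕ) : ℝ) + 1) ^ 2)⁻¹) := by
          refine Finset.sum_le_sum_of_subset_of_nonneg (fun m hm => ?_) fun _ _ _ => by positivity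
          rw [Finset.mem_filter] at hm
          exact Finset.mem_range.2 (by lia)
      _ = K * L * (9 * ∑ m ∈ Finset.range (n + 1), (((m : ℝ) + 1) ^ 2)⁻¹) := by
          rw [← Finset.mul_sum, ← Finset.mul_sum]
          congr 2
          rw [← Finset.sum_range_reflect (fun m => (((m : ℝ) + 1) ^ 2)⁻¹)]
          simp
      _ ≤ K * L * (9 * ∑' m : ℕ, (((m : ℝ) + 1) ^ 2)⁻¹) := by
          gcongr
          exact hs.sum_le_tsum _ fun _ _ => by positivity
      _ = _ := by ring

end KernelEstimates

section MovingAverage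

/-- The moving average kernel of the generalized fractional Brownian motion. -/
noncomputable def gfbmKernel (α s u : ℝ) : ℝ := max (s - u) 0 ^ α - max (-u) 0 ^ α

lemma measurable_gfbmKernel (α s : ℝ) : Measurable (gfbmKernel α s) := by
  unfold gfbmKernel
  fun_prop

lemma gfbmKernel_of_pos {α : ℝ} (hα : α ≠ 0) (s : ℝ) {u : ℝ} (hu : 0 < u) :
    gfbmKernel α s u = posRpow α (s - u) := by
  rw [gfbmKernel, max_zero_rpow hα, max_zero_rpow hα, posRpow_of_nonpos (x := -u) (by linarith),
    sub_zero]

lemma gfbmKernel_of_neg (α : ℝ) {s u : ℝ} (hs : 0 ≤ s) (hu : u < 0) :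
    gfbmKernel α s u = (s - u) ^ α - (0 - u) ^ α := by
  rw [gfbmKernel, max_eq_left (by linarith), max_eq_left (by linarith), zero_sub]

lemma gfbmKernel_zero_left (s : ℝ) : gfbmKernel 0 s = 0 := by
  funext u
  simp [gfbmKernel]

lemma rpow_le_min_inv_rpow {l x η : ℝ} (hl : 0 < l) (hl1 : l ≤ 1) (hx : η ≤ x) :
    l ^ x ≤ min l l⁻¹ ^ η := by
  rw [min_eq_left (hl1.trans ((one_le_inv₀ hl).2 hl1))]
  exact rpow_le_rpow_of_exponent_ge hl hl1 hx

lemma rpow_le_min_inv_rpow_of_one_le {l x η : ℝ} (hl1 : 1 ≤ l) (hx : x ≤ -η) :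
    l ^ x ≤ min l l⁻¹ ^ η := by
  have hl : 0 < l := by linarith
  rw [min_eq_right ((inv_le_one₀ hl).2 hl1 |>.trans hl1), inv_rpow hl.le, ← rpow_neg hl.le]
  exact rpow_le_rpow_of_exponent_le hl1 hx

lemma abs_rpow_sub_rpow_le {p : ℝ} (hp : p ≤ 1) {l x y : ℝ} (hl : 0 < l) (hx : l ≤ x)
    (hy : l ≤ y) : |x ^ p - y ^ p| ≤ |p| * l ^ (p - 1) * |x - y| := by
  refine (convex_Ici l).norm_image_sub_le_of_norm_hasDerivWithin_le
    (f := fun x : ℝ => x ^ p) (f' := fun x => p * x ^ (p - 1)) (fun z hz => ?_)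
    (fun z hz => ?_) hy hx
  · exact (hasDerivAt_rpow_const (Or.inl (hl.trans_le hz).ne')).hasDerivWithinAt
  · rw [norm_mul, norm_eq_abs, norm_of_nonneg (rpow_nonneg (hl.le.trans hz) _)]
    exact mul_le_mul_of_nonneg_left (rpow_le_rpow_of_nonpos hl hz (by linarith)) (abs_nonneg _)

/-- Coarse bound for the kernel on positive dyadic blocks. -/
lemma exists_eLpNorm_gfbmKernel_pos_le {γ α η : ℝ} (hγ : 0 ≤ γ) (hα : -1 / 2 < α)
    (hη : η ≤ min α 0 + 1 / 2 - γ / 2) :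
    ∃ C, 0 ≤ C ∧ ∀ l : ℝ, 0 < l → ∀ s ∈ Icc (0:ℝ) 1,
      eLpNorm (gfbmKernel α s) 2 ((powMeasure γ).restrict (dyadicIoc l l 0 0)) ≤
        ENNReal.ofReal (C * min l l⁻¹ ^ η) := by
  rcases eq_or_ne α 0 with rfl | hα0
  · exact ⟨0, le_rfl, fun l _ s _ => by simp [gfbmKernel_zero_left]⟩
  have hα1 : 0 < 2 * α + 1 := by linarith
  refine ⟨1 + 2 ^ (α + 1 / 2) / √(2 * α + 1), by positivity, fun l hl s hs => ?_⟩
  set K := 2 ^ (α + 1 / 2) / √(2 * α + 1) with hK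
  have hK0 : 0 ≤ K := by positivity
  have hW : 0 ≤ min l l⁻¹ ^ η := by positivity
  have hI : dyadicIoc l l 0 0 = Ioc l (l + l) := by
    rw [dyadicIoc]; norm_num
  have hAl : ∀ u ∈ Ioc l (l + l), l ≤ |u| := fun u hu => hu.1.le.trans (le_abs_self u)
  rw [hI]
  have hcongr : eLpNorm (gfbmKernel α s) 2 ((powMeasure γ).restrict (Ioc l (l + l))) =
      eLpNorm (fun u => posRpow α (s - u)) 2 ((powMeasure γ).restrict (Ioc l (l + l))) := by
    refine eLpNorm_congr_ae ?_
    filter_upwards [ae_restrict_mem measurableSet_Ioc] with u hu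
    exact gfbmKernel_of_pos hα0 s (hl.trans hu.1)
  rw [hcongr]
  rcases le_or_gt s l with hsl | hsl
  · refine (eLpNorm_powMeasure_le_of_bound hγ hl hl.le hAl (M := 0) le_rfl
      fun u hu => ?_).trans (ENNReal.ofReal_le_ofReal ?_)
    · rw [posRpow_of_nonpos (by linarith [hu.1]), abs_zero]
    · rw [zero_mul, mul_zero]
      positivity
  have hl1 : l ≤ 1 := hsl.le.trans hs.2
  rcases le_or_gt s (l + 2 * l) with h3 | h3
  · refine (eLpNorm_powMeasure_posRpow_le hγ hl hl.le hAl hα h3).trans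
      (ENNReal.ofReal_le_ofReal ?_)
    calc l ^ (-γ / 2) * ((2 * l) ^ (α + 1 / 2) / √(2 * α + 1))
        = K * (l ^ (-γ / 2 + (α + 1 / 2))) := by
          rw [mul_rpow (by norm_num) hl.le, rpow_add hl (-γ / 2), hK]
          ring
      _ ≤ K * min l l⁻¹ ^ η := by
          gcongr
          exact rpow_le_min_inv_rpow hl hl1 (by linarith [min_le_left α 0])
      _ ≤ (1 + K) * min l l⁻¹ ^ η := by
          gcongr
          linarith
  · refine (eLpNorm_powMeasure_le_of_bound hγ hl hl.le hAl (M := l ^ min α 0) (by positivity)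
      fun u hu => ?_).trans (ENNReal.ofReal_le_ofReal ?_)
    · have hu1 : l ≤ s - u := by linarith [hu.2]
      have hu2 : s - u ≤ 1 := by linarith [hs.2, hu.1]
      have hu0 : 0 < s - u := hl.trans_le hu1
      rw [abs_of_nonneg (posRpow_nonneg _ _), posRpow_of_pos hu0]
      exact (rpow_le_rpow_of_exponent_ge hu0 hu2 (min_le_left α 0)).trans
        (rpow_le_rpow_of_nonpos hl hu1 (min_le_right α 0))
    · calc l ^ (-γ / 2) * (l ^ min α 0 * l ^ (1 / 2 : ℝ))
          = l ^ (-γ / 2 + (min α 0 + 1 / 2)) := by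
            rw [rpow_add hl, rpow_add hl]
        _ ≤ 1 * min l l⁻¹ ^ η := by
            rw [one_mul]
            exact rpow_le_min_inv_rpow hl hl1 (by linarith)
        _ ≤ (1 + K) * min l l⁻¹ ^ η := by
            gcongr
            linarith

/-- Coarse bound for the kernel on negative dyadic blocks. -/
lemma exists_eLpNorm_gfbmKernel_neg_le {γ α η : ℝ} (hγ : 0 ≤ γ) (hα1 : α ≤ 1)
    (hη : η ≤ min α 0 + 1 / 2 - γ / 2) (hη' : η ≤ 1 / 2 - α + γ / 2) :
    ∃ C, 0 ≤ C ∧ ∀ l : ℝ, 0 < l → ∀ s ∈ Icc (0:ℝ) 1,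
      eLpNorm (gfbmKernel α s) 2 ((powMeasure γ).restrict (dyadicIoc (-(2 * l)) l 0 0)) ≤
        ENNReal.ofReal (C * min l l⁻¹ ^ η) := by
  refine ⟨3 + |α|, by positivity, fun l hl s hs => ?_⟩
  have hW : 0 ≤ min l l⁻¹ ^ η := by positivity
  have hI : dyadicIoc (-(2 * l)) l 0 0 = Ioc (-(2 * l)) (-(2 * l) + l) := by
    rw [dyadicIoc]; norm_num
  have hAl : ∀ u ∈ Ioc (-(2 * l)) (-(2 * l) + l), l ≤ |u| := fun u hu =>
    le_trans (by linarith [hu.2]) (neg_le_abs u)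
  rw [hI]
  rcases le_or_gt l 1 with hl1 | hl1
  · refine (eLpNorm_powMeasure_le_of_bound hγ hl hl.le hAl (M := 3 * l ^ min α 0) (by positivity)
      fun u hu => ?_).trans (ENNReal.ofReal_le_ofReal ?_)
    · have hu1 : l ≤ 0 - u := by linarith [hu.2]
      have hu0 : 0 < 0 - u := hl.trans_le hu1
      have key : ∀ x, l ≤ x → x ≤ 3 → x ^ α ≤ 3 * l ^ min α 0 := by
        intro x hx hx3
        rcases le_total α 0 with h | h
        · rw [min_eq_left h]
          have := rpow_le_rpow_of_nonpos hl hx h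
          have h' : 0 ≤ l ^ α := by positivity
          linarith
        · rw [min_eq_right h, rpow_zero, mul_one]
          calc x ^ α ≤ 3 ^ α := rpow_le_rpow (hl.le.trans hx) hx3 h
            _ ≤ 3 ^ (1:ℝ) := rpow_le_rpow_of_exponent_le (by norm_num) hα1
            _ = 3 := rpow_one 3
      rw [gfbmKernel_of_neg α hs.1 (by linarith)]
      have h1 := key (s - u) (by linarith [hs.1]) (by linarith [hs.2, hu.1])
      have h2 := key (0 - u) hu1 (by linarith [hu.1])
      have h3 : 0 ≤ (s - u) ^ α := rpow_nonneg (by linarith [hs.1]) _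
      have h4 : 0 ≤ (0 - u) ^ α := rpow_nonneg hu0.le _
      rw [abs_le]
      constructor <;> linarith
    · calc l ^ (-γ / 2) * (3 * l ^ min α 0 * l ^ (1 / 2 : ℝ))
          = 3 * l ^ (-γ / 2 + (min α 0 + 1 / 2)) := by
            rw [rpow_add hl, rpow_add hl]
            ring
        _ ≤ 3 * min l l⁻¹ ^ η := by
            gcongr
            exact rpow_le_min_inv_rpow hl hl1 (by linarith)
        _ ≤ (3 + |α|) * min l l⁻¹ ^ η := by
            gcongr
            linarith [abs_nonneg α]
  · refine (eLpNorm_powMeasure_le_of_bound hγ hl hl.le hAl (M := |α| * l ^ (α - 1))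
      (by positivity) fun u hu => ?_).trans (ENNReal.ofReal_le_ofReal ?_)
    · have hu1 : l ≤ 0 - u := by linarith [hu.2]
      rw [gfbmKernel_of_neg α hs.1 (by linarith)]
      refine (abs_rpow_sub_rpow_le hα1 hl (by linarith [hs.1]) hu1).trans ?_
      refine mul_le_of_le_one_right (by positivity) ?_
      rw [show s - u - (0 - u) = s by ring, abs_of_nonneg hs.1]
      exact hs.2
    · calc l ^ (-γ / 2) * (|α| * l ^ (α - 1) * l ^ (1 / 2 : ℝ))
          = |α| * l ^ (-γ / 2 + (α - 1 + 1 / 2)) := by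
            rw [rpow_add hl, rpow_add hl]
            ring
        _ ≤ |α| * min l l⁻¹ ^ η := by
            gcongr
            exact rpow_le_min_inv_rpow_of_one_le hl1.le (by linarith)
        _ ≤ (3 + |α|) * min l l⁻¹ ^ η := by
            gcongr
            linarith [abs_nonneg α]

/-- Polynomial approximation of the kernel on dyadic subintervals of negative blocks. -/
lemma exists_eLpNorm_gfbmKernel_sub_le {γ α η β : ℝ} (hγ : 0 ≤ γ) {r : ℕ} (hα1 : α ≤ r)
    (hr : β + 1 / 2 ≤ r)
    (hη : η ≤ α + 1 / 2 - γ / 2) (hη' : η ≤ 1 / 2 - α + γ / 2) :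
    ∃ C, 0 ≤ C ∧ ∀ l : ℝ, 0 < l → ∀ s ∈ Icc (0:ℝ) 1, ∀ j, ∀ m < 2 ^ j, ∃ c : Fin r → ℝ,
      eLpNorm (fun u => gfbmKernel α s u - ∑ i, c i * u ^ (i : ℕ)) 2
        ((powMeasure γ).restrict (dyadicIoc (-(2 * l)) l j m)) ≤
        ENNReal.ofReal (C * min l l⁻¹ ^ η * (2:ℝ) ^ (-((β + 1) * j))) := by
  set Q := |∏ k ∈ Finset.range r, ((k : ℝ) - α)| with hQ
  refine ⟨Q * (1 + |α - r|), by positivity, fun l hl s hs j m hm => ?_⟩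
  set h := l / 2 ^ j with hh
  have h0 : 0 < h := by positivity
  have hW : 0 ≤ min l l⁻¹ ^ η := by positivity
  have hI : dyadicIoc (-(2 * l)) l j m = Ioc (-(2 * l) + m * h) (-(2 * l) + m * h + h) := by
    rw [dyadicIoc, ← hh]; congr 1; ring
  have hend : -(2 * l) + m * h + h ≤ -l := by
    have h1 : ((m : ℝ) + 1) ≤ 2 ^ j := by exact_mod_cast hm
    have h2 : ((m : ℝ) + 1) * h ≤ 2 ^ j * h := by gcongr
    have h3 : 2 ^ j * h = l := by rw [hh]; field_simp
    linarith
  set a := -(2 * l) + m * h with ha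
  have hv : ∀ u ∈ Icc a (a + h), l ≤ 0 - u := fun u hu => by linarith [hu.2]
  have hAl : ∀ u ∈ Ioc a (a + h), l ≤ |u| := fun u hu =>
    (hv u (Ioc_subset_Icc_self hu)).trans (by simpa using neg_le_abs u)
  obtain ⟨M, hM0, hM, hMl⟩ : ∃ M, 0 ≤ M ∧ (∀ x y : ℝ, l ≤ x → l ≤ y → |x - y| ≤ 1 →
      |x ^ (α - r) - y ^ (α - r)| ≤ M) ∧
      l ^ (-γ / 2 + (r + 1 / 2)) * M ≤ (1 + |α - r|) * min l l⁻¹ ^ η := by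
    rcases le_or_gt l 1 with hl1 | hl1
    · refine ⟨l ^ (α - r), by positivity, fun x y hx hy _ => ?_, ?_⟩
      · have h1 := rpow_le_rpow_of_nonpos hl hx (sub_nonpos.2 hα1)
        have h2 := rpow_le_rpow_of_nonpos hl hy (sub_nonpos.2 hα1)
        have h3 : 0 ≤ x ^ (α - r) := rpow_nonneg (hl.le.trans hx) _
        have h4 : 0 ≤ y ^ (α - r) := rpow_nonneg (hl.le.trans hy) _
        rw [abs_le]
        constructor <;> linarith
      · rw [← rpow_add hl]
        calc _ ≤ 1 * min l l⁻¹ ^ η := by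
              rw [one_mul]
              exact rpow_le_min_inv_rpow hl hl1 (by linarith)
          _ ≤ _ := by
              gcongr
              linarith [abs_nonneg (α - r)]
    · refine ⟨|α - r| * l ^ (α - r - 1), by positivity, fun x y hx hy hxy => ?_, ?_⟩
      · refine (abs_rpow_sub_rpow_le (by linarith) hl hx hy).trans ?_
        exact mul_le_of_le_one_right (by positivity) hxy
      · rw [mul_left_comm, ← rpow_add hl]
        calc _ ≤ |α - r| * min l l⁻¹ ^ η := by
              gcongr
              exact rpow_le_min_inv_rpow_of_one_le hl1.le (by linarith)
          _ ≤ _ := by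
              gcongr
              linarith
  obtain ⟨c, hc⟩ := exists_polynomial_approx r
    (fun i u => (∏ k ∈ Finset.range i, ((k : ℝ) - α)) * (s - u) ^ (α - i) -
      (∏ k ∈ Finset.range i, ((k : ℝ) - α)) * (0 - u) ^ (α - i))
    (a := a) (b := a + h) (M := Q * M)
    (fun i _ u hu => (hasDerivAt_prod_mul_sub_rpow α i (by linarith [hv u hu, hs.1])).sub
      (hasDerivAt_prod_mul_sub_rpow α i (by linarith [hv u hu])))
    (fun u hu => by
      rw [← mul_sub, abs_mul]
      refine mul_le_mul_of_nonneg_left (hM _ _ ?_ (hv u hu) ?_) (abs_nonneg _)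
      · linarith [hv u hu, hs.1]
      · rw [show s - u - (0 - u) = s by ring, abs_of_nonneg hs.1]
        exact hs.2)
  refine ⟨c, ?_⟩
  rw [hI]
  refine (eLpNorm_powMeasure_le_of_bound hγ hl h0.le hAl (M := Q * M * h ^ r) (by positivity)
    fun u hu => ?_).trans (ENNReal.ofReal_le_ofReal ?_)
  · have := hc u (Ioc_subset_Icc_self hu)
    rw [gfbmKernel_of_neg α hs.1 (by linarith [hv u (Ioc_subset_Icc_self hu)])]
    simpa using this
  · have h1 : h ^ r * h ^ (1 / 2 : ℝ) = l ^ (r + 1 / 2 : ℝ) * (2:ℝ) ^ (-((r + 1 / 2 : ℝ) * j)) := by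
      rw [← rpow_natCast h, ← rpow_add h0, hh, div_rpow hl.le (by positivity), ← rpow_natCast 2,
        ← rpow_mul (by norm_num), rpow_neg (by norm_num), mul_comm (j : ℝ), div_eq_mul_inv]
    calc l ^ (-γ / 2) * (Q * M * h ^ r * h ^ (1 / 2 : ℝ))
        = l ^ (-γ / 2) * (Q * M * (h ^ r * h ^ (1 / 2 : ℝ))) := by ring
      _ = Q * (l ^ (-γ / 2 + (r + 1 / 2)) * M) * (2:ℝ) ^ (-((r + 1 / 2 : ℝ) * j)) := by
          rw [h1, rpow_add hl (-γ / 2)]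
          ring
      _ ≤ Q * ((1 + |α - r|) * min l l⁻¹ ^ η) * (2:ℝ) ^ (-((β + 1) * j)) := by
          have h2 : (β + 1) * j ≤ (r + 1 / 2 : ℝ) * j :=
            mul_le_mul_of_nonneg_right (by linarith) (Nat.cast_nonneg j)
          have h3 : (2:ℝ) ^ (-((r + 1 / 2 : ℝ) * j)) ≤ (2:ℝ) ^ (-((β + 1) * j)) :=
            rpow_le_rpow_of_exponent_le (by norm_num) (neg_le_neg h2)
          gcongr
      _ = _ := by ring

end MovingAverage

section Blocks

/-- Left endpoint of the dyadic block `(2 ^ k, 2 ^ (k + 1)]` or `(-2 ^ (k + 1), -2 ^ k]`. -/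
noncomputable def blockLeft : Bool × ℤ → ℝ
  | (true, k) => 2 ^ k
  | (false, k) => -(2 * 2 ^ k)

/-- The dyadic block of length `2 ^ k` with left endpoint `blockLeft b`. -/
def dyadicBlock (b : Bool × ℤ) : Set ℝ := dyadicIoc (blockLeft b) (2 ^ b.2) 0 0

lemma measurableSet_dyadicBlock (b : Bool × ℤ) : MeasurableSet (dyadicBlock b) :=
  measurableSet_dyadicIoc _ _ _ _

lemma mem_dyadicBlock_true {k : ℤ} {x : ℝ} :
    x ∈ dyadicBlock (true, k) ↔ x ∈ Ioc ((2:ℝ) ^ k) (2 ^ (k + 1)) := by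
  have : (2:ℝ) ^ (k + 1) = 2 ^ k + 2 ^ k := by rw [zpow_add_one₀ two_ne_zero]; ring
  simp [dyadicBlock, dyadicIoc, blockLeft, this]

lemma mem_dyadicBlock_false {k : ℤ} {x : ℝ} :
    x ∈ dyadicBlock (false, k) ↔ -x ∈ Ico ((2:ℝ) ^ k) (2 ^ (k + 1)) := by
  have : (2:ℝ) ^ (k + 1) = 2 * 2 ^ k := by rw [zpow_add_one₀ two_ne_zero]; ring
  simp only [dyadicBlock, dyadicIoc, blockLeft, this, mem_Ioc, mem_Ico]
  norm_num
  constructor <;> rintro ⟨h1, h2⟩ <;> constructor <;> linarith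

lemma iUnion_dyadicBlock : ⋃ b, dyadicBlock b = {0}ᶜ := by
  ext x
  simp only [mem_iUnion, mem_compl_iff, mem_singleton_iff]
  constructor
  · rintro ⟨⟨_ | _, k⟩, hx⟩ rfl
    · have := (mem_dyadicBlock_false.1 hx).1
      rw [neg_zero] at this
      exact absurd this (not_le.2 (by positivity))
    · have := (mem_dyadicBlock_true.1 hx).1
      exact absurd this (not_lt.2 (by positivity))
  · intro hx
    rcases lt_or_gt_of_ne hx with h | h
    · obtain ⟨k, hk⟩ := exists_mem_Ico_zpow (neg_pos.2 h) one_lt_two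
      exact ⟨(false, k), mem_dyadicBlock_false.2 hk⟩
    · obtain ⟨k, hk⟩ := exists_mem_Ioc_zpow h one_lt_two
      exact ⟨(true, k), mem_dyadicBlock_true.2 hk⟩

lemma pairwise_disjoint_dyadicBlock : Pairwise (Function.onFun Disjoint dyadicBlock) := by
  have key : ∀ (k k' : ℤ) (y : ℝ), (2:ℝ) ^ k < y → y < 2 ^ (k' + 1) → k ≤ k' := fun k k' y h h' =>
    Int.lt_add_one_iff.1 ((zpow_lt_zpow_iff_right₀ one_lt_two).1 (h.trans h'))
  rintro ⟨σ, k⟩ ⟨σ', k'⟩ hne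
  refine disjoint_left.2 fun x hx hx' => hne ?_
  rcases σ with _ | _ <;> rcases σ' with _ | _
  · rw [mem_dyadicBlock_false] at hx hx'
    have h1 := (zpow_lt_zpow_iff_right₀ one_lt_two).1 (hx.1.trans_lt hx'.2)
    have h2 := (zpow_lt_zpow_iff_right₀ one_lt_two).1 (hx'.1.trans_lt hx.2)
    exact Prod.ext rfl (by dsimp only; lia)
  · rw [mem_dyadicBlock_false] at hx
    rw [mem_dyadicBlock_true] at hx'
    have h1 : (0:ℝ) < 2 ^ k := by positivity
    have h2 : (0:ℝ) < 2 ^ k' := by positivity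
    linarith [hx.1, hx'.1]
  · rw [mem_dyadicBlock_true] at hx
    rw [mem_dyadicBlock_false] at hx'
    have h1 : (0:ℝ) < 2 ^ k := by positivity
    have h2 : (0:ℝ) < 2 ^ k' := by positivity
    linarith [hx.1, hx'.1]
  · rw [mem_dyadicBlock_true] at hx hx'
    have h1 := (zpow_lt_zpow_iff_right₀ one_lt_two).1 (hx.1.trans_le hx'.2)
    have h2 := (zpow_lt_zpow_iff_right₀ one_lt_two).1 (hx'.1.trans_le hx.2)
    exact Prod.ext rfl (by dsimp only; lia)

/-- The weight of a dyadic block, decaying geometrically away from unit scale. -/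
noncomputable def blockWeight (η : ℝ) (b : Bool × ℤ) : ℝ :=
  min ((2:ℝ) ^ b.2) ((2:ℝ) ^ b.2)⁻¹ ^ η

lemma blockWeight_pos (η : ℝ) (b : Bool × ℤ) : 0 < blockWeight η b := by
  unfold blockWeight
  positivity

lemma blockWeight_eq (η : ℝ) (b : Bool × ℤ) :
    blockWeight η b = ((2⁻¹ : ℝ) ^ η) ^ b.2.natAbs := by
  rw [blockWeight, ← rpow_natCast, ← rpow_mul (by norm_num), mul_comm η, rpow_mul (by norm_num),
    rpow_natCast]
  congr 1
  rcases Int.natAbs_eq b.2 with h | h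
  · rw [min_eq_right]
    · nth_rewrite 1 [h]
      rw [zpow_natCast, inv_pow]
    · have : (1:ℝ) ≤ 2 ^ b.2 := by
        rw [h, zpow_natCast]
        exact one_le_pow₀ one_le_two
      exact (inv_le_one_of_one_le₀ this).trans this
  · rw [min_eq_left]
    · nth_rewrite 1 [h]
      rw [zpow_neg, zpow_natCast, inv_pow]
    · have : (1:ℝ) ≤ (2 ^ b.2)⁻¹ := by
        rw [h, zpow_neg, zpow_natCast, inv_inv]
        exact one_le_pow₀ one_le_two
      refine le_trans ?_ this
      rwa [← one_le_inv₀ (by positivity)]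

lemma summable_blockWeight_rpow {η : ℝ} (hη : 0 < η) {p : ℝ} (hp : 0 < p) :
    Summable fun b => blockWeight η b ^ p := by
  have h1 : ∀ b, blockWeight η b ^ p = ((2⁻¹ : ℝ) ^ (η * p)) ^ b.2.natAbs := by
    intro b
    rw [blockWeight_eq, ← rpow_natCast, ← rpow_natCast, ← rpow_mul (by positivity),
      ← rpow_mul (by positivity), ← rpow_mul (by norm_num)]
    ring_nf
  simp_rw [h1]
  rw [summable_prod_of_nonneg fun b => by positivity]
  exact ⟨fun _ => summable_pow_natAbs (by positivity)
    (rpow_lt_one (by norm_num) (by norm_num) (by positivity)), Summable.of_finite⟩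

end Blocks

section GaussianSpace

lemma powMeasure_singleton_zero (γ : ℝ) : powMeasure γ {0} = 0 :=
  withDensity_absolutelyContinuous _ _ (by simp)

lemma hasSum_norm_restrictL2_dyadicBlock_sq {γ : ℝ} (f : Lp ℝ 2 (powMeasure γ)) :
    HasSum (fun b => ‖restrictL2 (powMeasure γ) (measurableSet_dyadicBlock b) f‖ ^ 2)
      (‖f‖ ^ 2) := by
  have h1 := hasSum_integral_iUnion (μ := powMeasure γ) measurableSet_dyadicBlock
    pairwise_disjoint_dyadicBlock (Lp.memLp f).integrable_sq.integrableOn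
  simp_rw [norm_restrictL2_sq]
  suffices h : ∫ x in ⋃ b, dyadicBlock b, f x ^ 2 ∂(powMeasure γ) = ‖f‖ ^ 2 by
    rwa [h] at h1
  rw [iUnion_dyadicBlock, ← real_inner_self_eq_norm_sq, L2.inner_def]
  have h2 : (powMeasure γ).restrict {0}ᶜ = powMeasure γ :=
    Measure.restrict_eq_self_of_ae_mem (compl_mem_ae_iff.2 (powMeasure_singleton_zero γ))
  rw [h2]
  refine integral_congr_ae (ae_of_all _ fun x => ?_)
  simp [sq]

lemma lintegral_enorm_sq_eq_eLpNorm_sq {μ : Measure ℝ} (φ : ℝ → ℝ) :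
    ∫⁻ u, ‖φ u‖ₑ ^ 2 ∂μ = eLpNorm φ 2 μ ^ 2 := by
  have := eLpNorm_nnreal_pow_eq_lintegral (f := φ) (μ := μ) (p := 2) two_ne_zero
  simpa using this.symm

lemma memLp_of_eLpNorm_dyadicBlock_le {γ : ℝ} {φ : ℝ → ℝ} (hφ : Measurable φ) {w : Bool × ℤ → ℝ}
    (hw0 : ∀ b, 0 ≤ w b) (hw : Summable fun b => w b ^ 2)
    (h : ∀ b, eLpNorm φ 2 ((powMeasure γ).restrict (dyadicBlock b)) ≤ ENNReal.ofReal (w b)) :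
    MemLp φ 2 (powMeasure γ) := by
  refine ⟨hφ.aestronglyMeasurable, ?_⟩
  have h2 : (powMeasure γ).restrict {0}ᶜ = powMeasure γ :=
    Measure.restrict_eq_self_of_ae_mem (compl_mem_ae_iff.2 (powMeasure_singleton_zero γ))
  suffices h3 : eLpNorm φ 2 (powMeasure γ) ^ 2 < ⊤ by simpa using h3
  rw [← lintegral_enorm_sq_eq_eLpNorm_sq,
    ← h2, ← iUnion_dyadicBlock]
  calc _ ≤ ∑' b, ∫⁻ u in dyadicBlock b, ‖φ u‖ₑ ^ 2 ∂(powMeasure γ) := lintegral_iUnion_le _ _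
    _ ≤ ∑' b, ENNReal.ofReal (w b ^ 2) := by
      refine ENNReal.tsum_le_tsum fun b => ?_
      rw [lintegral_enorm_sq_eq_eLpNorm_sq, ENNReal.ofReal_pow (hw0 b)]
      exact pow_le_pow_left' (h b) 2
    _ < ⊤ := hw.tsum_ofReal_lt_top

/-- The kernel of the generalized fractional Brownian motion at time `s`, as an element of
`L²(|u| ^ (-γ) du)`. -/
noncomputable def gfbmL2 (α γ s : ℝ) : Lp ℝ 2 (powMeasure γ) :=
  open Classical in if h : MemLp (gfbmKernel α s) 2 (powMeasure γ) then h.toLp else 0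

lemma gfbmL2_zero (γ s : ℝ) : gfbmL2 0 γ s = 0 := by
  rw [gfbmL2]
  split_ifs with h
  · simp only [gfbmKernel_zero_left]
    exact MemLp.toLp_zero _
  · rfl

lemma inner_gfbmL2_gfbmL2 {α γ s t : ℝ} (hs : MemLp (gfbmKernel α s) 2 (powMeasure γ))
    (ht : MemLp (gfbmKernel α t) 2 (powMeasure γ)) :
    inner ℝ (gfbmL2 α γ s) (gfbmL2 α γ t) = gfbmCov α γ s t := by
  rw [gfbmL2, gfbmL2, dif_pos hs, dif_pos ht, L2.inner_def]
  have h1 : ∫ u, inner ℝ (hs.toLp (gfbmKernel α s) u) (ht.toLp (gfbmKernel α t) u) ∂(powMeasure γ) =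
      ∫ u, gfbmKernel α s u * gfbmKernel α t u ∂(powMeasure γ) := by
    refine integral_congr_ae ?_
    filter_upwards [hs.coeFn_toLp, ht.coeFn_toLp] with u h1 h2
    rw [h1, h2]
    simp [mul_comm]
  rw [h1, powMeasure, integral_withDensity_eq_integral_toReal_smul (by fun_prop)
    (ae_of_all _ fun _ => ENNReal.ofReal_lt_top), gfbmCov]
  refine integral_congr_ae (ae_of_all _ fun u => ?_)
  simp only [smul_eq_mul, gfbmKernel]
  rw [ENNReal.toReal_ofReal (by positivity)]
  ring

lemma inner_gfbmL2_of_restrictL2_eq {α γ s : ℝ}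
    (hs : MemLp (gfbmKernel α s) 2 (powMeasure γ)) {A : Set ℝ} (hA : MeasurableSet A)
    {e : Lp ℝ 2 (powMeasure γ)} (he : restrictL2 (powMeasure γ) hA e = e) :
    inner ℝ e (gfbmL2 α γ s) = ∫ u in A, e u * gfbmKernel α s u ∂(powMeasure γ) := by
  rw [← he, inner_restrictL2_left, he, gfbmL2, dif_pos hs]
  refine integral_congr_ae ?_
  filter_upwards [ae_restrict_of_ae hs.coeFn_toLp] with u h1
  rw [h1]

end GaussianSpace

section FracElem

lemma inner_fracElem {E : Type*} [NormedAddCommGroup E] [InnerProductSpace ℝ E] [CompleteSpace E]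
    {θ : ℝ} (hθ : 0 < θ) {F : ℝ → E} (hF : ContinuousOn F (Ici 0)) {t : ℝ} (ht : 0 ≤ t) (e : E) :
    inner ℝ e (fracElem θ F t) =
      t ^ θ / Real.Gamma θ * ∫ x in (0:ℝ)..1, (1 - x) ^ (θ - 1) * inner ℝ e (F (t * x)) := by
  have h_int : IntervalIntegrable (fun x => (1 - x) ^ (θ - 1) • F (t * x)) volume 0 1 := by
    refine (intervalIntegrable_one_sub_rpow hθ).smul_continuousOn ?_
    rw [uIcc_of_le zero_le_one]
    exact continuousOn_comp_mul_Icc hF ht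
  rw [fracElem, inner_smul_right]
  congr 1
  have h := (innerSL ℝ e).intervalIntegral_comp_comm h_int
  simp only [innerSL_apply_apply, inner_smul_right] at h
  exact h.symm

lemma abs_inner_fracElem_le {E : Type*} [NormedAddCommGroup E] [InnerProductSpace ℝ E]
    [CompleteSpace E] {θ : ℝ} (hθ : 0 < θ) {F : ℝ → E} (hF : ContinuousOn F (Ici 0)) {t : ℝ}
    (ht : t ∈ Icc (0:ℝ) 1) {e : E} {δ : ℝ} (h : ∀ s ∈ Icc (0:ℝ) 1, |inner ℝ e (F s)| ≤ δ) :
    |inner ℝ e (fracElem θ F t)| ≤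
      (Real.Gamma θ)⁻¹ * (∫ x in (0:ℝ)..1, (1 - x) ^ (θ - 1)) * δ := by
  have hΓ : 0 < Real.Gamma θ := Real.Gamma_pos_of_pos hθ
  have hw := intervalIntegrable_one_sub_rpow hθ
  rw [inner_fracElem hθ hF ht.1, abs_mul, abs_of_nonneg (div_nonneg (rpow_nonneg ht.1 _) hΓ.le),
    mul_assoc]
  have h1 : |∫ x in (0:ℝ)..1, (1 - x) ^ (θ - 1) * inner ℝ e (F (t * x))| ≤
      (∫ x in (0:ℝ)..1, (1 - x) ^ (θ - 1)) * δ := by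
    rw [← intervalIntegral.integral_mul_const, ← norm_eq_abs]
    refine intervalIntegral.norm_integral_le_of_norm_le zero_le_one
      (ae_of_all _ fun x hx => ?_) (hw.mul_const δ)
    rw [norm_mul, norm_of_nonneg (rpow_nonneg (by linarith [hx.2]) _)]
    exact mul_le_mul_of_nonneg_left (h _ ⟨mul_nonneg ht.1 hx.1.le,
      mul_le_one₀ ht.2 hx.1.le hx.2⟩) (rpow_nonneg (by linarith [hx.2]) _)
  calc _ ≤ (Real.Gamma θ)⁻¹ * |∫ x in (0:ℝ)..1, (1 - x) ^ (θ - 1) * inner ℝ e (F (t * x))| := by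
        gcongr
        rw [div_eq_mul_inv]
        exact mul_le_of_le_one_left (by positivity) (rpow_le_one ht.1 ht.2 hθ.le)
    _ ≤ _ := by gcongr

lemma rpow_mul_integral_posRpow (α : ℝ) {θ t u : ℝ} (hu : 0 < u) (ht : 0 < t) :
    t ^ θ * ∫ x in (0:ℝ)..1, (1 - x) ^ (θ - 1) * posRpow α (t * x - u) =
      (∫ y in (0:ℝ)..1, (1 - y) ^ (θ - 1) * posRpow α y) * posRpow (α + θ) (t - u) := by
  rcases le_or_gt t u with htu | htu
  · rw [posRpow_of_nonpos (by linarith), mul_zero,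
      intervalIntegral.integral_congr (g := fun _ => 0), intervalIntegral.integral_zero, mul_zero]
    intro x hx
    rw [uIcc_of_le zero_le_one] at hx
    simp only
    rw [posRpow_of_nonpos (by nlinarith [hx.1, hx.2]), mul_zero]
  have hut : u / t < 1 := (div_lt_one ht).2 htu
  have hut0 : 0 < u / t := div_pos hu ht
  have hd : 0 < t - u := sub_pos.2 htu
  have hc : 0 < 1 - u / t := sub_pos.2 hut
  have h1 : ∫ x in (0:ℝ)..1, (1 - x) ^ (θ - 1) * posRpow α (t * x - u) =
      ∫ x in (u / t)..1, (1 - x) ^ (θ - 1) * posRpow α (t * x - u) := by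
    rw [intervalIntegral.integral_of_le zero_le_one, intervalIntegral.integral_of_le hut.le]
    refine setIntegral_eq_of_subset_of_forall_sdiff_eq_zero measurableSet_Ioc
      (Ioc_subset_Ioc_left hut0.le) fun x hx => ?_
    have : x ≤ u / t := by
      by_contra! h
      exact hx.2 ⟨h, hx.1.2⟩
    rw [le_div_iff₀ ht] at this
    rw [posRpow_of_nonpos (by linarith), mul_zero]
  have h2 := intervalIntegral.integral_comp_mul_add
    (fun x => (1 - x) ^ (θ - 1) * posRpow α (t * x - u)) (a := 0) (b := 1) hc.ne' (u / t)
  simp only [mul_zero, zero_add, mul_one, sub_add_cancel, smul_eq_mul] at h2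
  have h3 : ∫ y in (0:ℝ)..1, (1 - ((1 - u / t) * y + u / t)) ^ (θ - 1) *
      posRpow α (t * ((1 - u / t) * y + u / t) - u) =
      (1 - u / t) ^ (θ - 1) * (t - u) ^ α *
        ∫ y in (0:ℝ)..1, (1 - y) ^ (θ - 1) * posRpow α y := by
    rw [← intervalIntegral.integral_const_mul]
    refine intervalIntegral.integral_congr fun y hy => ?_
    rw [uIcc_of_le zero_le_one] at hy
    rw [show 1 - ((1 - u / t) * y + u / t) = (1 - u / t) * (1 - y) by ring,
      show t * ((1 - u / t) * y + u / t) - u = (t - u) * y by field_simp; ring,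
      mul_rpow hc.le (by linarith [hy.2])]
    rcases hy.1.eq_or_lt with h | h
    · rw [← h, mul_zero, posRpow_of_nonpos le_rfl, mul_zero, mul_zero, mul_zero]
    · rw [posRpow_of_pos h, posRpow_of_pos (mul_pos hd h), mul_rpow hd.le h.le]
      ring
  rw [h3] at h2
  have h4 : ∫ x in (u / t)..1, (1 - x) ^ (θ - 1) * posRpow α (t * x - u) =
      (1 - u / t) * ((1 - u / t) ^ (θ - 1) * (t - u) ^ α *
        ∫ y in (0:ℝ)..1, (1 - y) ^ (θ - 1) * posRpow α y) := by
    rw [h2, mul_inv_cancel_left₀ hc.ne']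
  have h5 : (1 - u / t) * (1 - u / t) ^ (θ - 1) = (1 - u / t) ^ θ := by
    rw [rpow_sub_one hc.ne']
    field_simp
  have h6 : t ^ θ * (1 - u / t) ^ θ = (t - u) ^ θ := by
    rw [← mul_rpow ht.le hc.le]
    congr 1
    field_simp
  rw [h1, h4, posRpow_of_pos hd, rpow_add hd, ← h6]
  linear_combination (t ^ θ * (t - u) ^ α *
    ∫ y in (0:ℝ)..1, (1 - y) ^ (θ - 1) * posRpow α y) * h5

/-- Elements supported on the positive half-line act on the fractional integral of the kernel by
integration against a truncated power. -/
lemma inner_fracElem_gfbmL2 {α γ θ : ℝ} (hα : α ≠ 0) (hθ : 0 < θ)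
    (hm : ∀ s ∈ Icc (0:ℝ) 1, MemLp (gfbmKernel α s) 2 (powMeasure γ))
    (hF : ContinuousOn (fun s => gfbmL2 α γ (min s 1)) (Ici 0)) {A : Set ℝ}
    (hA : MeasurableSet A) (hA0 : A ⊆ Ioi 0) {S : ℝ} (hS : 0 ≤ S)
    (hAS : ∀ s ∈ Icc (0:ℝ) 1,
      eLpNorm (gfbmKernel α s) 2 ((powMeasure γ).restrict A) ≤ ENNReal.ofReal S)
    {e : Lp ℝ 2 (powMeasure γ)} (he : restrictL2 (powMeasure γ) hA e = e) {t : ℝ}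
    (ht : t ∈ Icc (0:ℝ) 1) :
    inner ℝ e (fracElem θ (fun s => gfbmL2 α γ (min s 1)) t) =
      ∫ u in A, e u * ((Real.Gamma θ)⁻¹ * (∫ y in (0:ℝ)..1, (1 - y) ^ (θ - 1) * posRpow α y) *
        posRpow (α + θ) (t - u)) ∂(powMeasure γ) := by
  rw [inner_fracElem hθ hF ht.1]
  rcases ht.1.eq_or_lt with h0 | h0
  · rw [← h0, zero_rpow hθ.ne', zero_div, zero_mul]
    symm
    refine setIntegral_eq_zero_of_forall_eq_zero fun u hu => ?_
    have : 0 < u := hA0 hu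
    rw [posRpow_of_nonpos (by linarith), mul_zero, mul_zero]
  have htx : ∀ x ∈ Ioc (0:ℝ) 1, t * x ∈ Icc (0:ℝ) 1 := fun x hx =>
    ⟨mul_nonneg ht.1 hx.1.le, mul_le_one₀ ht.2 hx.1.le hx.2⟩
  have hw0 : ∀ x ∈ Ioc (0:ℝ) 1, 0 ≤ (1 - x) ^ (θ - 1) := fun x hx =>
    rpow_nonneg (by linarith [hx.2]) _
  have hsf : SFinite (powMeasure γ) := by
    unfold powMeasure
    infer_instance
  set ν := (powMeasure γ).restrict A with hν
  have h1 : ∫ x in (0:ℝ)..1, (1 - x) ^ (θ - 1) * inner ℝ e (gfbmL2 α γ (min (t * x) 1)) =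
      ∫ x in Ioc (0:ℝ) 1, ∫ u, (1 - x) ^ (θ - 1) * (e u * gfbmKernel α (t * x) u) ∂ν := by
    rw [intervalIntegral.integral_of_le zero_le_one]
    refine setIntegral_congr_fun measurableSet_Ioc fun x hx => ?_
    rw [min_eq_left (htx x hx).2, inner_gfbmL2_of_restrictL2_eq (hm _ (htx x hx)) hA he,
      integral_const_mul]
  have hsec : ∀ x ∈ Ioc (0:ℝ) 1, Integrable (fun u => e u * gfbmKernel α (t * x) u) ν :=
    fun x hx => integrableOn_mul_of_eLpNorm_le (measurable_gfbmKernel _ _) (hAS _ (htx x hx)) e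
  have hmeas : AEStronglyMeasurable
      (Function.uncurry fun x u => (1 - x) ^ (θ - 1) * (e u * gfbmKernel α (t * x) u))
      ((volume.restrict (Ioc (0:ℝ) 1)).prod ν) := by
    have h2 : AEStronglyMeasurable (fun p : ℝ × ℝ => e p.2)
        ((volume.restrict (Ioc (0:ℝ) 1)).prod ν) :=
      (Lp.aestronglyMeasurable e).restrict.comp_snd
    have h3 : Measurable fun p : ℝ × ℝ => gfbmKernel α (t * p.1) p.2 := by
      unfold gfbmKernel
      fun_prop
    have h4 : Measurable fun p : ℝ × ℝ => (1 - p.1) ^ (θ - 1) := by fun_prop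
    exact h4.aestronglyMeasurable.mul (h2.mul h3.aestronglyMeasurable)
  have h_int : Integrable
      (Function.uncurry fun x u => (1 - x) ^ (θ - 1) * (e u * gfbmKernel α (t * x) u))
      ((volume.restrict (Ioc (0:ℝ) 1)).prod ν) := by
    rw [integrable_prod_iff hmeas]
    have hsec' : ∀ᵐ x ∂volume.restrict (Ioc (0:ℝ) 1), x ∈ Ioc (0:ℝ) 1 :=
      ae_restrict_mem measurableSet_Ioc
    refine ⟨?_, ?_⟩
    · filter_upwards [hsec'] with x hx
      exact (hsec x hx).const_mul ((1 - x) ^ (θ - 1))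
    · have hw : Integrable (fun x : ℝ => (1 - x) ^ (θ - 1) * (S * ‖e‖))
          (volume.restrict (Ioc (0:ℝ) 1)) :=
        ((intervalIntegrable_iff_integrableOn_Ioc_of_le zero_le_one).1
          (intervalIntegrable_one_sub_rpow hθ)).mul_const _
      refine hw.mono' hmeas.norm.integral_prod_right' ?_
      filter_upwards [hsec'] with x hx
      rw [norm_of_nonneg (integral_nonneg fun _ => norm_nonneg _)]
      simp only [Function.uncurry_apply_pair, norm_mul]
      rw [integral_const_mul, norm_of_nonneg (hw0 x hx)]
      refine mul_le_mul_of_nonneg_left ?_ (hw0 x hx)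
      have h5 := abs_setIntegral_mul_le hA (φ := fun u => |gfbmKernel α (t * x) u|)
        (measurable_gfbmKernel α (t * x)).abs hS
        (by simpa [← norm_eq_abs, eLpNorm_norm] using hAS _ (htx x hx)) (Lp.memLp e).norm.toLp
      rw [Lp.norm_toLp, eLpNorm_norm, ← Lp.norm_def] at h5
      refine le_trans (le_of_eq ?_) ((le_abs_self _).trans h5)
      refine integral_congr_ae ?_
      filter_upwards [ae_restrict_of_ae (Lp.memLp e).norm.coeFn_toLp] with u hu
      rw [hu, norm_eq_abs (gfbmKernel _ _ _)]
  rw [h1, integral_integral_swap h_int, ← integral_const_mul]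
  refine setIntegral_congr_fun hA fun u hu => ?_
  have hu0 : 0 < u := hA0 hu
  have h6 : ∫ x in Ioc (0:ℝ) 1, (1 - x) ^ (θ - 1) * (e u * gfbmKernel α (t * x) u) =
      e u * ∫ x in (0:ℝ)..1, (1 - x) ^ (θ - 1) * posRpow α (t * x - u) := by
    rw [← intervalIntegral.integral_of_le zero_le_one, ← intervalIntegral.integral_const_mul]
    refine intervalIntegral.integral_congr fun x _ => ?_
    rw [gfbmKernel_of_pos hα _ hu0]
    ring
  rw [h6]
  linear_combination (e u * (Real.Gamma θ)⁻¹) * rpow_mul_integral_posRpow α (θ := θ) hu0 h0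

end FracElem

section Assembly

variable {γ η β : ℝ}

/-- Piecewise polynomial multiresolution on a dyadic block. -/
noncomputable def blockTree (γ : ℝ) (r : ℕ) (b : Bool × ℤ) :
    DyadicTree (Lp ℝ 2 (powMeasure γ)) r :=
  polyTree (powMeasure γ) r (blockLeft b) (ℓ := 2 ^ b.2) (by positivity)

lemma exists_blockTree_family {ι : Type*} {r : ℕ} {C : ℝ} (hC : 0 ≤ C) (hβ : 0 < β)
    (k : ι → Lp ℝ 2 (powMeasure γ))
    (hcoarse : ∀ t b e, (blockTree γ r b).R 0 0 e = e →
      |inner ℝ e (k t)| ≤ C * blockWeight η b * ‖e‖)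
    (hfine : ∀ t b j, ∃ δ : ℕ → ℝ, (∀ m < 2 ^ j, (blockTree γ r b).DualBound j m (k t) (δ m)) ∧
      ∑ m ∈ Finset.range (2 ^ j), δ m ≤ C * blockWeight η b * (2:ℝ) ^ (-(β * j))) :
    ∃ D, 0 < D ∧ ∃ e : (Σ p : (Bool × ℤ) × ℕ, Fin (r * 2 ^ p.2)) → Lp ℝ 2 (powMeasure γ),
      (∀ f ∈ Submodule.span ℝ (range k), HasSum (fun i => (inner ℝ (e i) f) ^ 2) (‖f‖ ^ 2)) ∧
      ∀ t p, ∑ i, |inner ℝ (e ⟨p, i⟩) (k t)| ≤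
        D * blockWeight η p.1 * (2:ℝ) ^ (-(β * p.2)) := by
  have hfam := fun b => (blockTree γ r b).exists_family
  choose e he0 hej hes using hfam
  have hD : 0 < r * C + 2 * r * C * (2:ℝ) ^ β + 1 := by positivity
  refine ⟨_, hD, fun i => e i.1.1 i.1.2 i.2, fun f hf => ?_, fun t p => ?_⟩
  · have happ : ∀ b, f ∈ (blockTree γ r b).approximable := by
      intro b
      refine (Submodule.span_le.2 ?_) hf
      rintro _ ⟨t, rfl⟩
      choose δ hδ hδs using hfine t b
      refine DyadicTree.mem_approximable_of_dualBound _ hδ (squeeze_zero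
        (fun j => Finset.sum_nonneg fun m hm => (hδ j m (Finset.mem_range.1 hm)).1) hδs ?_)
      rw [← mul_zero (C * blockWeight η b)]
      refine Tendsto.const_mul _ ?_
      have h2 : ∀ j : ℕ, (2:ℝ) ^ (-(β * j)) = ((2:ℝ) ^ (-β)) ^ j := fun j => by
        rw [← rpow_mul_natCast zero_le_two, neg_mul]
      simp only [h2]
      exact tendsto_pow_atTop_nhds_zero_of_lt_one (by positivity)
        (rpow_lt_one_of_one_lt_of_neg one_lt_two (neg_lt_zero.2 hβ))
    exact hasSum_sigma_prod_of_nonneg (n := fun j => r * 2 ^ j) (fun _ => sq_nonneg _)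
      (fun b => hes b f (happ b)) (hasSum_norm_restrictL2_dyadicBlock_sq f)
  · obtain ⟨b, j⟩ := p
    have hw := (blockWeight_pos η b).le
    have h2 : (0:ℝ) < 2 ^ β := by positivity
    rcases j with _ | j
    · refine (he0 b (k t) (C * blockWeight η b) (hcoarse t b) (by positivity)).trans ?_
      simp only [Nat.cast_zero, mul_zero, neg_zero, rpow_zero, mul_one]
      have : 0 ≤ (2 * r * C * (2:ℝ) ^ β + 1) * blockWeight η b := by positivity
      linarith
    · obtain ⟨δ, hδ, hδs⟩ := hfine t b j
      refine (hej b (k t) j δ hδ).trans ?_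
      have h3 : (2:ℝ) ^ (-(β * j)) = 2 ^ β * 2 ^ (-(β * ((j + 1 : ℕ) : ℝ))) := by
        rw [← rpow_add two_pos]
        congr 1
        push_cast
        ring
      rw [h3] at hδs
      have h4 := mul_le_mul_of_nonneg_left hδs (by positivity : (0:ℝ) ≤ 2 * r)
      have h5 : 0 ≤ (r * C + 1) * blockWeight η b * (2:ℝ) ^ (-(β * ((j + 1 : ℕ) : ℝ))) := by
        positivity
      dsimp only
      linarith

lemma dyadicIoc_subset_zero {a l : ℝ} (hl : 0 ≤ l) {j m : ℕ} (hm : m < 2 ^ j) :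
    dyadicIoc a l j m ⊆ dyadicIoc a l 0 0 := by
  have h2 : (0:ℝ) < 2 ^ j := by positivity
  have h3 : 0 ≤ l / 2 ^ j := by positivity
  have h4 : ((m:ℝ) + 1) * (l / 2 ^ j) ≤ l := by
    have : (m:ℝ) + 1 ≤ 2 ^ j := by exact_mod_cast hm
    calc _ ≤ 2 ^ j * (l / 2 ^ j) := by gcongr
      _ = l := by field_simp
  have h5 : 0 ≤ (m:ℝ) * (l / 2 ^ j) := by positivity
  refine Ioc_subset_Ioc ?_ ?_ <;> norm_num <;> linarith

lemma powMeasure_dyadicBlock_lt_top (hγ : 0 ≤ γ) (b : Bool × ℤ) :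
    powMeasure γ (dyadicBlock b) < ⊤ := by
  have hl : (0:ℝ) < 2 ^ b.2 := by positivity
  have h := powMeasure_restrict_le hγ hl (measurableSet_dyadicBlock b) (by
    rintro u hu
    obtain ⟨_ | _, k⟩ := b
    · exact (mem_dyadicBlock_false.1 hu).1.trans (neg_le_abs u)
    · exact (mem_dyadicBlock_true.1 hu).1.le.trans (le_abs_self u)) univ
  simp only [Measure.restrict_apply_univ, Measure.smul_apply, smul_eq_mul] at h
  refine h.trans_lt (ENNReal.mul_lt_top ENNReal.ofReal_lt_top ?_)
  simp [dyadicBlock, dyadicIoc]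

end Assembly

section Kernel

variable {α γ η β θ : ℝ}

lemma exists_eLpNorm_gfbmKernel_dyadicBlock_le (hγ : 0 ≤ γ) (hα : -1/2 < α) (hα1 : α ≤ 1)
    (hη : η ≤ min α 0 + 1/2 - γ/2) (hη' : η ≤ 1/2 - α + γ/2) :
    ∃ C, 0 ≤ C ∧ ∀ b, ∀ s ∈ Icc (0:ℝ) 1,
      eLpNorm (gfbmKernel α s) 2 ((powMeasure γ).restrict (dyadicBlock b)) ≤
        ENNReal.ofReal (C * blockWeight η b) := by
  obtain ⟨C₁, hC₁, h₁⟩ := exists_eLpNorm_gfbmKernel_pos_le hγ hα hη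
  obtain ⟨C₂, hC₂, h₂⟩ := exists_eLpNorm_gfbmKernel_neg_le hγ hα1 hη hη'
  refine ⟨max C₁ C₂, le_max_of_le_left hC₁, ?_⟩
  rintro ⟨_ | _, k⟩ s hs
  · exact (h₂ (2 ^ k) (by positivity) s hs).trans (ENNReal.ofReal_le_ofReal
      (mul_le_mul_of_nonneg_right (le_max_right _ _) (blockWeight_pos η (false, k)).le))
  · exact (h₁ (2 ^ k) (by positivity) s hs).trans (ENNReal.ofReal_le_ofReal
      (mul_le_mul_of_nonneg_right (le_max_left _ _) (blockWeight_pos η (true, k)).le))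

lemma memLp_gfbmKernel_of_dyadicBlock_le {C : ℝ} (hC : 0 ≤ C) (hη : 0 < η) {s : ℝ}
    (h : ∀ b, eLpNorm (gfbmKernel α s) 2 ((powMeasure γ).restrict (dyadicBlock b)) ≤
        ENNReal.ofReal (C * blockWeight η b)) : MemLp (gfbmKernel α s) 2 (powMeasure γ) := by
  refine memLp_of_eLpNorm_dyadicBlock_le (measurable_gfbmKernel α s)
    (fun b => mul_nonneg hC (blockWeight_pos η b).le) ?_ h
  have := (summable_blockWeight_rpow hη two_pos).mul_left (C ^ 2)
  simpa only [mul_pow, rpow_two] using this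

lemma exists_dualBound_fracElem_false (hγ : 0 ≤ γ) (hθ : 0 < θ) {r : ℕ} (hα1 : α ≤ r)
    (hr : β + 1/2 ≤ r) (hη : η ≤ α + 1/2 - γ/2) (hη' : η ≤ 1/2 - α + γ/2)
    (hm : ∀ s ∈ Icc (0:ℝ) 1, MemLp (gfbmKernel α s) 2 (powMeasure γ))
    (hF : ContinuousOn (fun s => gfbmL2 α γ (min s 1)) (Ici 0)) :
    ∃ C, 0 ≤ C ∧ ∀ t ∈ Icc (0:ℝ) 1, ∀ k : ℤ, ∀ j, ∃ δ : ℕ → ℝ,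
      (∀ m < 2 ^ j, (blockTree γ r (false, k)).DualBound j m
        (fracElem θ (fun s => gfbmL2 α γ (min s 1)) t) (δ m)) ∧
      ∑ m ∈ Finset.range (2 ^ j), δ m ≤
        C * blockWeight η (false, k) * (2:ℝ) ^ (-(β * j)) := by
  obtain ⟨C, hC, h⟩ := exists_eLpNorm_gfbmKernel_sub_le hγ hα1 hr hη hη'
  set A := (Real.Gamma θ)⁻¹ * (∫ x in (0:ℝ)..1, (1 - x) ^ (θ - 1)) with hA
  have hA0 : 0 ≤ A := mul_nonneg (inv_nonneg.2 (Real.Gamma_pos_of_pos hθ).le)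
    (intervalIntegral.integral_nonneg zero_le_one fun x hx =>
      rpow_nonneg (by linarith [hx.2]) _)
  refine ⟨A * C, by positivity, fun t ht k j => ?_⟩
  have hw := (blockWeight_pos η (false, k)).le
  refine ⟨fun _ => A * (C * blockWeight η (false, k) * (2:ℝ) ^ (-((β + 1) * j))),
    fun m hmj => ⟨by positivity, fun e he hv => ?_⟩, ?_⟩
  · rw [mul_assoc]
    refine abs_inner_fracElem_le hθ hF ht fun s hs => ?_
    rw [min_eq_left hs.2]
    obtain ⟨c, hc⟩ := h (2 ^ k) (by positivity) s hs j m hmj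
    exact (dualBound_polyTree (by positivity : (0:ℝ) ≤ 2 ^ k)
      ((measure_mono (dyadicIoc_subset_zero (by positivity) hmj)).trans_lt
        (powMeasure_dyadicBlock_lt_top hγ (false, k))).ne
      (fun e he => inner_gfbmL2_of_restrictL2_eq (hm s hs) _ he) (measurable_gfbmKernel α s) c
      (by positivity) hc).2 e he hv
  · rw [Finset.sum_const, Finset.card_range, nsmul_eq_mul]
    have h2 : ((2 ^ j : ℕ) : ℝ) * (2:ℝ) ^ (-((β + 1) * j)) = 2 ^ (-(β * j)) := by
      push_cast
      rw [← rpow_natCast, ← rpow_add two_pos]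
      ring_nf
    rw [← h2]
    exact le_of_eq (by ring)

lemma exists_dualBound_fracElem_true (hγ : 0 ≤ γ) (hα : -1/2 < α) (hθ : 0 < θ) {r : ℕ}
    (hβ : β = α + θ + 1/2) (hr : α + θ + 2 ≤ r) (hη : η ≤ min α 0 + 1/2 - γ/2)
    (hm : ∀ s ∈ Icc (0:ℝ) 1, MemLp (gfbmKernel α s) 2 (powMeasure γ))
    (hF : ContinuousOn (fun s => gfbmL2 α γ (min s 1)) (Ici 0)) :
    ∃ C, 0 ≤ C ∧ ∀ t ∈ Icc (0:ℝ) 1, ∀ k : ℤ, ∀ j, ∃ δ : ℕ → ℝ,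
      (∀ m < 2 ^ j, (blockTree γ r (true, k)).DualBound j m
        (fracElem θ (fun s => gfbmL2 α γ (min s 1)) t) (δ m)) ∧
      ∑ m ∈ Finset.range (2 ^ j), δ m ≤
        C * blockWeight η (true, k) * (2:ℝ) ^ (-(β * j)) := by
  obtain ⟨C, hC, h⟩ := exists_eLpNorm_posRpow_dyadic_le hγ
    (show -1/2 < α + θ by linarith) (r := r) hr
  obtain ⟨C₁, hC₁, h₁⟩ := exists_eLpNorm_gfbmKernel_pos_le hγ hα hη
  set A := (Real.Gamma θ)⁻¹ * (∫ y in (0:ℝ)..1, (1 - y) ^ (θ - 1) * posRpow α y) with hA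
  have hA0 : 0 ≤ A := mul_nonneg (inv_nonneg.2 (Real.Gamma_pos_of_pos hθ).le)
    (intervalIntegral.integral_nonneg zero_le_one fun x hx =>
      mul_nonneg (rpow_nonneg (by linarith [hx.2]) _) (posRpow_nonneg _ _))
  refine ⟨A * C, by positivity, fun t ht k j => ?_⟩
  have hw := (blockWeight_pos η (true, k)).le
  have hzero : (∀ m < 2 ^ j, ∀ e, (blockTree γ r (true, k)).R j m e = e →
      inner ℝ e (fracElem θ (fun s => gfbmL2 α γ (min s 1)) t) = 0) → ∃ δ : ℕ → ℝ,
      (∀ m < 2 ^ j, (blockTree γ r (true, k)).DualBound j m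
        (fracElem θ (fun s => gfbmL2 α γ (min s 1)) t) (δ m)) ∧
      ∑ m ∈ Finset.range (2 ^ j), δ m ≤
        A * C * blockWeight η (true, k) * (2:ℝ) ^ (-(β * j)) := fun h0 =>
    ⟨fun _ => 0, fun m hmj => ⟨le_rfl, fun e he _ => by simp [h0 m hmj e he]⟩, by
      simp only [Finset.sum_const_zero]; positivity⟩
  by_cases hα0 : α = 0
  · refine hzero fun m hmj e he => ?_
    simp [fracElem, hα0, gfbmL2_zero]
  have hl : (0:ℝ) < 2 ^ k := by positivity
  have hinner : ∀ m < 2 ^ j, ∀ e, (blockTree γ r (true, k)).R j m e = e →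
      inner ℝ e (fracElem θ (fun s => gfbmL2 α γ (min s 1)) t) =
        ∫ u in dyadicIoc (2 ^ k) (2 ^ k) j m,
          e u * (A * posRpow (α + θ) (t - u)) ∂powMeasure γ := by
    intro m hmj e he
    have hsub := dyadicIoc_subset_zero (a := (2:ℝ) ^ k) hl.le hmj
    refine inner_fracElem_gfbmL2 hα0 hθ hm hF (measurableSet_dyadicIoc (2 ^ k) (2 ^ k) j m)
      (fun u hu => ?_)
      (by positivity : 0 ≤ C₁ * blockWeight η (true, k)) (fun s hs => ?_) he ht
    · exact hl.trans (mem_dyadicBlock_true.1 (hsub hu)).1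
    · exact (eLpNorm_mono_measure _ (Measure.restrict_mono hsub le_rfl)).trans (h₁ _ hl s hs)
  by_cases hk : (1:ℝ) ≤ 2 ^ k
  · refine hzero fun m hmj e he => ?_
    rw [hinner m hmj e he]
    refine setIntegral_eq_zero_of_forall_eq_zero fun u hu => ?_
    have hu' := (mem_dyadicBlock_true.1 (dyadicIoc_subset_zero hl.le hmj hu)).1
    rw [posRpow_of_nonpos (by linarith [ht.2]), mul_zero, mul_zero]
  · obtain ⟨δ, hδ0, hδ, hδs⟩ := h _ hl t j
    refine ⟨fun m => A * δ m, fun m hmj => ?_, ?_⟩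
    · obtain ⟨c, hc⟩ := hδ m
      refine dualBound_polyTree (φ := fun u => A * posRpow (α + θ) (t - u)) hl.le
        ((measure_mono (dyadicIoc_subset_zero hl.le hmj)).trans_lt
          (powMeasure_dyadicBlock_lt_top hγ (true, k))).ne (hinner m hmj) ?_
        (fun i => A * c i) (mul_nonneg hA0 (hδ0 m)) ?_
      · exact ((measurable_posRpow _).comp (by fun_prop)).const_mul A
      · have h3 : (fun u => A * posRpow (α + θ) (t - u) - ∑ i, A * c i * u ^ (i:ℕ)) =
            A • fun u => posRpow (α + θ) (t - u) - ∑ i, c i * u ^ (i:ℕ) := by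
          funext u
          simp only [Pi.smul_apply, smul_eq_mul, mul_sub, Finset.mul_sum, mul_assoc]
        rw [h3, eLpNorm_const_smul, ENNReal.ofReal_mul hA0, Real.enorm_of_nonneg hA0]
        exact mul_le_mul_right hc _
    · rw [← Finset.mul_sum, mul_assoc A, mul_assoc A]
      refine mul_le_mul_of_nonneg_left ((hδs _).trans ?_) hA0
      rw [mul_assoc]
      refine mul_le_mul_of_nonneg_left ?_ hC
      have h5 : ((2:ℝ) ^ k / 2 ^ j) ^ (α + θ + 1/2) = (2 ^ k) ^ β * (2:ℝ) ^ (-(β * j)) := by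
        rw [← hβ, div_rpow hl.le (by positivity), div_eq_mul_inv,
          ← rpow_natCast_mul zero_le_two, ← rpow_neg zero_le_two, mul_comm (j:ℝ)]
      rw [h5, ← mul_assoc, ← rpow_add hl]
      refine mul_le_mul_of_nonneg_right ?_ (by positivity)
      refine rpow_le_min_inv_rpow hl (not_le.1 hk).le ?_
      have := min_le_left α 0
      linarith

end Kernel

lemma fracInt_comp_min {Ω : Type*} (θ : ℝ) (X : ℝ → Ω → ℝ) {t : ℝ} (ht : t ∈ Icc (0:ℝ) 1) (ω : Ω) :
    fracInt θ (fun s => X (min s 1)) t ω = fracInt θ X t ω := by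
  rw [fracInt, fracInt]
  congr 1
  refine intervalIntegral.integral_congr fun u hu => ?_
  rw [uIcc_of_le ht.1] at hu
  simp only [min_eq_left (hu.2.trans ht.2)]

/-- Lower bound for the small ball probability of the fractional integrated GFBM. -/
theorem smallBall_lower
    {Ω : Type*} [MeasurableSpace Ω] (P : Measure Ω) [IsProbabilityMeasure P]
    (γ α θ H β : ℝ) (hγ : γ ∈ Set.Ico (0:ℝ) 1)
    (hα : α ∈ Set.Ioo (-1/2 + γ/2) (1/2)) (hθ : 0 < θ)
    (hH : H = α - γ/2 + 1/2) (hβ : β = α + θ + 1/2)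
    (X : ℝ → Ω → ℝ) (hX : IsGFBM P α γ X)
    (Y : ℝ → Ω → ℝ) (hY : Y = fracInt θ X) :
    ∃ κ₄ : ℝ, 0 < κ₄ ∧ ∀ ε ∈ Set.Ioo (0:ℝ) 1,
      ENNReal.ofReal (Real.exp (-κ₄ * ε ^ (-(1/β)))) ≤
        P {ω | ⨆ t : Set.Icc (0:ℝ) 1, |Y t.1 ω| ≤ ε} := by
  subst hY
  obtain ⟨hX₁, hX₂, -, hX₄⟩ := hX
  obtain ⟨hγ0, hγ1⟩ := hγ
  obtain ⟨hα0, hα1⟩ := hα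
  have hβ0 : 0 < β := by linarith
  obtain ⟨η, hη0, hηα, hη, hη'⟩ : ∃ η, 0 < η ∧ η ≤ α + 1/2 - γ/2 ∧
      η ≤ min α 0 + 1/2 - γ/2 ∧ η ≤ 1/2 - α + γ/2 := by
    refine ⟨min (α + 1/2 - γ/2) (min (1/2 - γ/2) (1/2 - α + γ/2)), ?_, min_le_left _ _, ?_,
      (min_le_right _ _).trans (min_le_right _ _)⟩
    · refine lt_min (by linarith) (lt_min ?_ ?_) <;> linarith
    · rcases min_cases α 0 with ⟨h, -⟩ | ⟨h, -⟩ <;> rw [h]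
      · exact min_le_left _ _
      · rw [zero_add]
        exact (min_le_right _ _).trans (min_le_left _ _)
  obtain ⟨r, hr⟩ := exists_nat_ge (α + θ + 2)
  obtain ⟨C, hC, hblock⟩ := exists_eLpNorm_gfbmKernel_dyadicBlock_le hγ0
    (show -1/2 < α by linarith) (by linarith) hη hη'
  have hm : ∀ s ∈ Icc (0:ℝ) 1, MemLp (gfbmKernel α s) 2 (powMeasure γ) := fun s hs =>
    memLp_gfbmKernel_of_dyadicBlock_le hC hη0 fun b => hblock b s hs
  have hmin : ∀ s : ℝ, 0 ≤ s → min s 1 ∈ Icc (0:ℝ) 1 := fun s hs =>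
    ⟨le_min hs zero_le_one, min_le_right _ _⟩
  have hX' : IsCenteredGaussianProcess P fun t => X (min t 1) :=
    fun n t c => hX₁ n (fun i => min (t i) 1) c
  have hc' : ∀ ω, ContinuousOn (fun t => X (min t 1) ω) (Ici 0) := fun ω =>
    (hX₂ ω).comp (by fun_prop) fun s hs => (hmin s hs).1
  have hF : ∀ s t : ℝ, 0 ≤ s → 0 ≤ t → ∫ ω, X (min s 1) ω * X (min t 1) ω ∂P =
      inner ℝ (gfbmL2 α γ (min s 1)) (gfbmL2 α γ (min t 1)) := fun s t hs ht => by
    rw [inner_gfbmL2_gfbmL2 (hm _ (hmin s hs)) (hm _ (hmin t ht)),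
      hX₄ _ _ (hmin s hs).1 (hmin t ht).1]
  have hFc := hX'.continuousOn_of_inner hF hc'
  obtain ⟨C₁, hC₁, h₁⟩ := exists_dualBound_fracElem_false (β := β) (r := r) hγ0 hθ
    (by linarith) (by linarith) hηα hη' hm hFc
  obtain ⟨C₂, hC₂, h₂⟩ := exists_dualBound_fracElem_true (r := r) hγ0 (by linarith) hθ hβ hr hη
    hm hFc
  set A := (Real.Gamma θ)⁻¹ * (∫ x in (0:ℝ)..1, (1 - x) ^ (θ - 1)) with hA
  have hA0 : 0 ≤ A := mul_nonneg (inv_nonneg.2 (Real.Gamma_pos_of_pos hθ).le)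
    (intervalIntegral.integral_nonneg zero_le_one fun x hx =>
      rpow_nonneg (by linarith [hx.2]) _)
  set C₀ := max (A * C) (max C₁ C₂) with hC₀
  have hcoarse : ∀ (t : Icc (0:ℝ) 1) b e, (blockTree γ r b).R 0 0 e = e →
      |inner ℝ e (fracElem θ (fun s => gfbmL2 α γ (min s 1)) t)| ≤
        C₀ * blockWeight η b * ‖e‖ := by
    rintro ⟨t, ht⟩ b e he
    have hw := (blockWeight_pos η b).le
    have h3 : |inner ℝ e (fracElem θ (fun s => gfbmL2 α γ (min s 1)) t)| ≤
        A * (C * blockWeight η b * ‖e‖) := by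
      refine abs_inner_fracElem_le hθ hFc ht fun s hs => ?_
      rw [min_eq_left hs.2,
        inner_gfbmL2_of_restrictL2_eq (hm s hs) (measurableSet_dyadicBlock b) he]
      exact abs_setIntegral_mul_le (measurableSet_dyadicBlock b) (measurable_gfbmKernel α s)
        (by positivity) (hblock b s hs) e
    calc _ ≤ _ := h3
      _ = A * C * (blockWeight η b * ‖e‖) := by ring
      _ ≤ C₀ * (blockWeight η b * ‖e‖) := by
        gcongr
        exact le_max_left _ _
      _ = _ := by ring
  have hfine : ∀ (t : Icc (0:ℝ) 1) b j, ∃ δ : ℕ → ℝ,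
      (∀ m < 2 ^ j, (blockTree γ r b).DualBound j m
        (fracElem θ (fun s => gfbmL2 α γ (min s 1)) t) (δ m)) ∧
      ∑ m ∈ Finset.range (2 ^ j), δ m ≤ C₀ * blockWeight η b * (2:ℝ) ^ (-(β * j)) := by
    rintro ⟨t, ht⟩ ⟨_ | _, k⟩ j
    · obtain ⟨δ, hδ, hδs⟩ := h₁ t ht k j
      have hw := (blockWeight_pos η (false, k)).le
      refine ⟨δ, hδ, hδs.trans ?_⟩
      gcongr
      exact (le_max_left _ _).trans (le_max_right _ _)
    · obtain ⟨δ, hδ, hδs⟩ := h₂ t ht k j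
      have hw := (blockWeight_pos η (true, k)).le
      refine ⟨δ, hδ, hδs.trans ?_⟩
      gcongr
      exact (le_max_right _ _).trans (le_max_right _ _)
  obtain ⟨D, hD, e, hsum, hdec⟩ := exists_blockTree_family
    (hC₁.trans ((le_max_left _ _).trans (le_max_right _ _))) hβ0
    (fun t : Icc (0:ℝ) 1 => fracElem θ (fun s => gfbmL2 α γ (min s 1)) t) hcoarse hfine
  obtain ⟨κ, hκ, h⟩ := exists_le_measure_iSup_fracInt_le hX' hc' hθ hF
    (blockWeight_pos η) (fun p hp => summable_blockWeight_rpow hη0 hp) hβ0 r hD e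
    (by rwa [image_eq_range]) (fun t ht p => hdec ⟨t, ht⟩ p)
  refine ⟨κ, hκ, fun ε hε => (h ε hε).trans_eq ?_⟩
  congr 1
  ext ω
  have : ∀ t : Icc (0:ℝ) 1, fracInt θ (fun s => X (min s 1)) t.1 ω = fracInt θ X t.1 ω :=
    fun t => fracInt_comp_min θ X t.2 ω
  simp only [mem_ofPred_eq, this]
end

section
/- (L² increment bound for the fractional integral of a Gaussian process.) Let {X(t)}_{0≤t≤1} be a centered real-valued Gaussian process with continuous sample paths and X(0) = 0, and suppose there exist constants η > 0 and c_X > 0 such that (E[(X(t+h) − X(t))²])^{1/2} ≤ c_X h^{η} for all h ∈ (0,1) and 0 ≤ t ≤ t+h ≤ 1. Let θ > 0 and define Y(s) = (1/Γ(θ)) ∫₀^{s} (s−w)^{θ−1} X(w) dw for 0 ≤ s ≤ 1. Then there exists a constant c > 0 depending only on η and θ such that (E[(Y(s+h) − Y(s))²])^{1/2} ≤ c · c_X · max(h^{θ/2}, h^{1/2}) for all h ∈ (0,1) and 0 ≤ s ≤ s+h ≤ 1. -/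
open MeasureTheory ProbabilityTheory Real Set Filter

/-- Along any time grid of step `1 / n`, the step process attached to an a.e.-measurable process
is jointly a.e.-measurable. -/
lemma aemeasurable_floor_process {Ω : Type*} [MeasurableSpace Ω] {P : Measure Ω} [SFinite P]
    {X : ℝ → Ω → ℝ} (hX : ∀ t, AEMeasurable (X t) P) (μ : Measure ℝ) [SFinite μ] (n : ℕ) :
    AEMeasurable (fun z : ℝ × Ω => X (⌊z.1 * n⌋₊ / n) z.2) (μ.prod P) := by
  have hM : ∀ k : ℕ, ∃ g : Ω → ℝ, Measurable g ∧ X ((k : ℝ) / n) =ᵐ[P] g := fun k => hX _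
  choose M hMm hMe using hM
  have h1 : Measurable (fun p : ℕ × Ω => M p.1 p.2) :=
    measurable_from_prod_countable_right hMm
  have h2 : Measurable (fun z : ℝ × Ω => (⌊z.1 * n⌋₊, z.2)) := by fun_prop
  refine ⟨fun z => M ⌊z.1 * n⌋₊ z.2, h1.comp h2, ?_⟩
  filter_upwards [Measure.quasiMeasurePreserving_snd.ae (ae_all_iff.2 hMe)] with z hz
  exact hz _

/-- A process with a.e.-measurable values and continuous paths is jointly a.e.-measurable. -/
lemma aestronglyMeasurable_uncurry_of_continuousOn {Ω : Type*} [MeasurableSpace Ω]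
    {P : Measure Ω} [SFinite P] {X : ℝ → Ω → ℝ} (hX : ∀ t, AEMeasurable (X t) P)
    (hc : ∀ ω, ContinuousOn (fun t => X t ω) (Icc 0 1)) :
    AEStronglyMeasurable (fun z : ℝ × Ω => X z.1 z.2)
      ((volume.restrict (Ioc (0 : ℝ) 1)).prod P) := by
  refine aestronglyMeasurable_of_tendsto_ae atTop
    (fun n : ℕ => (aemeasurable_floor_process hX _ n).aestronglyMeasurable) ?_
  have h : ∀ᵐ t ∂(volume.restrict (Ioc (0 : ℝ) 1)), t ∈ Ioc (0 : ℝ) 1 :=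
    ae_restrict_mem measurableSet_Ioc
  filter_upwards [Measure.quasiMeasurePreserving_fst.ae h] with z hz
  have hz' : z.1 ∈ Icc (0 : ℝ) 1 := Ioc_subset_Icc_self hz
  refine (hc z.2 z.1 hz').tendsto.comp (tendsto_nhdsWithin_iff.2 ⟨?_, ?_⟩)
  · exact (tendsto_nat_floor_mul_div_atTop hz'.1).comp tendsto_natCast_atTop_atTop
  · filter_upwards [eventually_gt_atTop 0] with n hn
    have hn' : (0 : ℝ) < n := by exact_mod_cast hn
    refine ⟨by positivity, ?_⟩
    rw [div_le_one hn']
    exact (Nat.floor_le (mul_nonneg hz'.1 hn'.le)).trans (by nlinarith [hz'.2])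

/-- Weighted Cauchy–Schwarz inequality. -/
lemma sq_integral_mul_le {α : Type*} [MeasurableSpace α] {μ : Measure α} {K f : α → ℝ}
    (hK : Integrable K μ) (hKf : Integrable (fun x => K x * f x) μ)
    (hKf2 : Integrable (fun x => |K x| * f x ^ 2) μ) :
    (∫ x, K x * f x ∂μ) ^ 2 ≤ (∫ x, |K x| ∂μ) * ∫ x, |K x| * f x ^ 2 ∂μ := by
  have hB : Integrable (fun x => |K x| * |f x|) μ := by simpa only [abs_mul] using hKf.abs
  have habs : |∫ x, K x * f x ∂μ| ≤ ∫ x, |K x| * |f x| ∂μ := by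
    simpa only [abs_mul] using abs_integral_le_integral_abs (f := fun x => K x * f x) (μ := μ)
  have hd : discrim (∫ x, |K x| ∂μ) (-2 * ∫ x, |K x| * |f x| ∂μ)
      (∫ x, |K x| * f x ^ 2 ∂μ) ≤ 0 := by
    refine discrim_le_zero fun t => ?_
    have h0 : 0 ≤ ∫ x, |K x| * (|f x| - t) ^ 2 ∂μ := integral_nonneg fun x => by positivity
    have e : ∀ x, |K x| * (|f x| - t) ^ 2
        = (t * t) * |K x| + (-2 * t) * (|K x| * |f x|) + |K x| * f x ^ 2 := fun x => by
      rw [← sq_abs (f x)]; ring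
    simp_rw [e] at h0
    have i1 := hK.abs.const_mul (t * t)
    have i2 := hB.const_mul (-2 * t)
    rw [integral_add (i1.fun_add i2) hKf2, integral_add i1 i2, integral_const_mul,
      integral_const_mul] at h0
    linarith
  have hsq : (∫ x, K x * f x ∂μ) ^ 2 ≤ (∫ x, |K x| * |f x| ∂μ) ^ 2 :=
    sq_le_sq' (neg_le_of_abs_le habs) (le_of_abs_le habs)
  unfold discrim at hd
  linarith

/-- Minkowski-type second moment bound for a weighted time integral of a process with continuous
paths. -/
lemma integral_sq_integral_mul_le {Ω : Type*} [MeasurableSpace Ω] {P : Measure Ω} [SFinite P]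
    {X : ℝ → Ω → ℝ} (hX : ∀ t, AEMeasurable (X t) P)
    (hc : ∀ ω, ContinuousOn (fun t => X t ω) (Icc 0 1))
    (hX2 : ∀ t, Integrable (fun ω => X t ω ^ 2) P) {C : ℝ}
    (hC : ∀ t ∈ Ioo (0 : ℝ) 1, ∫ ω, X t ω ^ 2 ∂P ≤ C) {K : ℝ → ℝ}
    (hK : IntegrableOn K (Ioc 0 1)) :
    ∫ ω, (∫ w in Ioc (0 : ℝ) 1, K w * X w ω) ^ 2 ∂P
      ≤ (∫ w in Ioc (0 : ℝ) 1, |K w|) ^ 2 * C := by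
  have hK' : IntegrableOn K (Icc 0 1) := (integrableOn_Icc_iff_integrableOn_Ioc (by simp)).2 hK
  have i1 : ∀ ω, IntegrableOn (fun w => K w * X w ω) (Ioc 0 1) := fun ω =>
    (hK'.mul_continuousOn (hc ω) isCompact_Icc).mono_set Ioc_subset_Icc_self
  have i2 : ∀ ω, IntegrableOn (fun w => |K w| * X w ω ^ 2) (Ioc 0 1) := fun ω =>
    (IntegrableOn.mul_continuousOn (g := fun w => |K w|) hK'.abs ((hc ω).pow 2)
      isCompact_Icc).mono_set Ioc_subset_Icc_self
  have hCae : ∀ᵐ w ∂(volume.restrict (Ioc (0 : ℝ) 1)), ∫ ω, X w ω ^ 2 ∂P ≤ C := by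
    rw [← restrict_Ioo_eq_restrict_Ioc]
    filter_upwards [ae_restrict_mem measurableSet_Ioo] with w hw using hC w hw
  have hmeas : AEStronglyMeasurable (fun z : ℝ × Ω => |K z.1| * X z.1 z.2 ^ 2)
      ((volume.restrict (Ioc (0 : ℝ) 1)).prod P) :=
    (hK.abs.aestronglyMeasurable.comp_fst (ν := P)).mul
      ((aestronglyMeasurable_uncurry_of_continuousOn hX hc).pow 2)
  have hle : ∀ᵐ w ∂(volume.restrict (Ioc (0 : ℝ) 1)),
      ∫ ω, |K w| * X w ω ^ 2 ∂P ≤ |K w| * C := by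
    filter_upwards [hCae] with w hw
    rw [integral_const_mul]
    exact mul_le_mul_of_nonneg_left hw (abs_nonneg _)
  have hint : Integrable (fun z : ℝ × Ω => |K z.1| * X z.1 z.2 ^ 2)
      ((volume.restrict (Ioc (0 : ℝ) 1)).prod P) := by
    refine (integrable_prod_iff hmeas).2 ⟨ae_of_all _ fun w => (hX2 w).const_mul |K w|, ?_⟩
    refine (hK.abs.mul_const C).mono' hmeas.norm.integral_prod_right' ?_
    filter_upwards [hle] with w hw
    have e : ∀ ω, ‖|K w| * X w ω ^ 2‖ = |K w| * X w ω ^ 2 := fun ω =>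
      Real.norm_of_nonneg (by positivity)
    simp_rw [e]
    rw [Real.norm_of_nonneg (integral_nonneg fun ω => by positivity)]
    exact hw
  have hA : 0 ≤ ∫ w in Ioc (0 : ℝ) 1, |K w| := integral_nonneg fun _ => abs_nonneg _
  calc ∫ ω, (∫ w in Ioc (0 : ℝ) 1, K w * X w ω) ^ 2 ∂P
      ≤ ∫ ω, (∫ w in Ioc (0 : ℝ) 1, |K w|) * (∫ w in Ioc (0 : ℝ) 1, |K w| * X w ω ^ 2) ∂P :=
        integral_mono_of_nonneg (ae_of_all _ fun _ => sq_nonneg _)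
          (hint.integral_prod_right.const_mul _)
          (ae_of_all _ fun ω => sq_integral_mul_le hK (i1 ω) (i2 ω))
    _ = (∫ w in Ioc (0 : ℝ) 1, |K w|) *
          ∫ w in Ioc (0 : ℝ) 1, ∫ ω, |K w| * X w ω ^ 2 ∂P := by
        rw [integral_const_mul,
          ← integral_integral_swap (f := fun w ω => |K w| * X w ω ^ 2) hint]
    _ ≤ (∫ w in Ioc (0 : ℝ) 1, |K w|) * ∫ w in Ioc (0 : ℝ) 1, |K w| * C :=
        mul_le_mul_of_nonneg_left
          (integral_mono_ae hint.integral_prod_left (hK.abs.mul_const C) hle) hA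
    _ = (∫ w in Ioc (0 : ℝ) 1, |K w|) ^ 2 * C := by
        rw [integral_mul_const]; ring

/-- The fractional integration kernel `w ↦ (t - w) ^ (θ - 1)`, supported on `(0, t]`. -/
noncomputable def fracKernel (θ t : ℝ) : ℝ → ℝ :=
  (Ioc 0 t).indicator fun w => (t - w) ^ (θ - 1)

lemma intervalIntegrable_sub_rpow {θ : ℝ} (hθ : 0 < θ) (a t : ℝ) :
    IntervalIntegrable (fun w => (t - w) ^ (θ - 1)) volume a t := by
  have h := (intervalIntegral.intervalIntegrable_rpow' (a := t - a) (b := 0)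
    (show -1 < θ - 1 by linarith)).comp_sub_left t
  simpa using h

lemma integral_sub_rpow {θ : ℝ} (hθ : 0 < θ) (a t : ℝ) :
    ∫ w in a..t, (t - w) ^ (θ - 1) = (t - a) ^ θ / θ := by
  rw [intervalIntegral.integral_comp_sub_left (fun x => x ^ (θ - 1)) t,
    integral_rpow (Or.inl (by linarith))]
  simp [Real.zero_rpow hθ.ne']

lemma integrable_fracKernel {θ t : ℝ} (hθ : 0 < θ) (ht : 0 ≤ t) :
    Integrable (fracKernel θ t) :=
  (integrable_indicator_iff measurableSet_Ioc).2
    ((intervalIntegrable_iff_integrableOn_Ioc_of_le ht).1 (intervalIntegrable_sub_rpow hθ 0 t))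

lemma setIntegral_fracKernel_mul {θ t : ℝ} (ht : 0 ≤ t) (ht1 : t ≤ 1) (f : ℝ → ℝ) :
    ∫ w in Ioc (0 : ℝ) 1, fracKernel θ t w * f w = ∫ w in (0 : ℝ)..t, (t - w) ^ (θ - 1) * f w := by
  have e : (fun w => fracKernel θ t w * f w)
      = (Ioc 0 t).indicator fun w => (t - w) ^ (θ - 1) * f w := by
    ext w
    simp only [fracKernel, indicator_apply]
    split_ifs <;> simp
  rw [e, setIntegral_indicator measurableSet_Ioc, intervalIntegral.integral_of_le ht,
    inter_eq_self_of_subset_right (Ioc_subset_Ioc_right ht1)]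

lemma setIntegral_fracKernel {θ t : ℝ} (hθ : 0 < θ) (ht : 0 ≤ t) (ht1 : t ≤ 1) :
    ∫ w in Ioc (0 : ℝ) 1, fracKernel θ t w = t ^ θ / θ := by
  have h := setIntegral_fracKernel_mul (θ := θ) ht ht1 fun _ => 1
  simpa [integral_sub_rpow hθ] using h

lemma rpow_add_sub_rpow_le {θ s h : ℝ} (hθ : 1 ≤ θ) (hs : 0 ≤ s) (hh : 0 < h) (hsh : s + h ≤ 1) :
    (s + h) ^ θ - s ^ θ ≤ θ * h := by
  have hp : 0 < s + h := by linarith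
  have hb := one_add_mul_self_le_rpow_one_add (s := s / (s + h) - 1)
    (by have : 0 ≤ s / (s + h) := by positivity
        linarith) hθ
  rw [add_sub_cancel, Real.div_rpow hs hp.le, le_div_iff₀ (by positivity)] at hb
  have e : (1 + θ * (s / (s + h) - 1)) * (s + h) ^ θ
      = (s + h) ^ θ - θ * h * (s + h) ^ (θ - 1) := by
    rw [Real.rpow_sub_one hp.ne']
    field_simp
    ring
  rw [e] at hb
  have h1 : (s + h) ^ (θ - 1) ≤ 1 := Real.rpow_le_one hp.le hsh (by linarith)
  have h2 : θ * h * (s + h) ^ (θ - 1) ≤ θ * h * 1 :=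
    mul_le_mul_of_nonneg_left h1 (by positivity)
  linarith

/-- For `θ ≥ 1`, the increment of the kernel has total mass at most the step. -/
lemma setIntegral_abs_fracKernel_sub_le_of_one_le {θ s h : ℝ} (hθ : 1 ≤ θ) (hs : 0 ≤ s)
    (hh : 0 < h) (hsh : s + h ≤ 1) :
    ∫ w in Ioc (0 : ℝ) 1, |fracKernel θ (s + h) w - fracKernel θ s w| ≤ h := by
  have hθ0 : 0 < θ := by linarith
  have hpos : ∀ w, |fracKernel θ (s + h) w - fracKernel θ s w|
      = fracKernel θ (s + h) w - fracKernel θ s w := by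
    refine fun w => abs_of_nonneg (sub_nonneg.2 ?_)
    by_cases hw : w ∈ Ioc 0 s
    · have hw' : w ∈ Ioc 0 (s + h) := ⟨hw.1, by linarith [hw.2]⟩
      rw [fracKernel, fracKernel, indicator_of_mem hw, indicator_of_mem hw']
      exact Real.rpow_le_rpow (by linarith [hw.2]) (by linarith) (by linarith)
    · rw [fracKernel, fracKernel, indicator_of_notMem hw]
      exact indicator_nonneg (fun x hx => Real.rpow_nonneg (by linarith [hx.2]) _) w
  simp_rw [hpos]
  rw [integral_sub (integrable_fracKernel hθ0 (by linarith)).integrableOn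
    (integrable_fracKernel hθ0 hs).integrableOn,
    setIntegral_fracKernel hθ0 (by linarith) hsh, setIntegral_fracKernel hθ0 hs (by linarith),
    ← sub_div, div_le_iff₀ hθ0]
  linarith [rpow_add_sub_rpow_le hθ hs hh hsh]

/-- For `θ < 1`, the increment of the kernel over a step `h` has total mass at most
`2 h ^ θ / θ`. -/
lemma setIntegral_abs_fracKernel_sub_le_of_lt_one {θ s h : ℝ} (hθ0 : 0 < θ) (hθ : θ < 1)
    (hs : 0 ≤ s) (hh : 0 < h) (hsh : s + h ≤ 1) :
    ∫ w in Ioc (0 : ℝ) 1, |fracKernel θ (s + h) w - fracKernel θ s w| ≤ 2 / θ * h ^ θ := by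
  set g : ℝ → ℝ := (Ioc s (s + h)).indicator fun w => (s + h - w) ^ (θ - 1) with hg
  have hgi : Integrable g := (integrable_indicator_iff measurableSet_Ioc).2
    ((intervalIntegrable_iff_integrableOn_Ioc_of_le (by linarith)).1
      (intervalIntegrable_sub_rpow hθ0 s (s + h)))
  have hgI : ∫ w in Ioc (0 : ℝ) 1, g w = h ^ θ / θ := by
    rw [hg, setIntegral_indicator measurableSet_Ioc,
      inter_eq_self_of_subset_right (Ioc_subset_Ioc hs hsh),
      ← intervalIntegral.integral_of_le (by linarith), integral_sub_rpow hθ0, add_sub_cancel_left]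
  have ki := integrable_fracKernel hθ0 (show 0 ≤ s + h by linarith)
  have ki' := integrable_fracKernel hθ0 hs
  have hle : ∀ᵐ w ∂(volume : Measure ℝ), |fracKernel θ (s + h) w - fracKernel θ s w|
      ≤ 2 * g w + (fracKernel θ s w - fracKernel θ (s + h) w) := by
    filter_upwards [(countable_singleton s).ae_notMem volume] with w hws
    rcases lt_or_ge s w with hsw | hsw
    · have hw : w ∉ Ioc 0 s := fun hw => absurd hw.2 (not_le.2 hsw)
      have e : fracKernel θ (s + h) w = g w := by
        simp only [fracKernel, hg, indicator_apply, mem_Ioc, hsw, hs.trans_lt hsw]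
      have hg0 : 0 ≤ g w :=
        indicator_nonneg (fun x hx => Real.rpow_nonneg (by linarith [hx.2]) _) w
      rw [e, fracKernel, indicator_of_notMem hw, sub_zero, abs_of_nonneg hg0]
      linarith
    · have hlt : w < s := lt_of_le_of_ne hsw hws
      have hgw : g w = 0 := indicator_of_notMem (fun hw => absurd hw.1 (not_lt.2 hsw)) _
      rw [hgw, mul_zero, zero_add, abs_sub_comm]
      refine (abs_of_nonneg (sub_nonneg.2 ?_)).le
      by_cases hw : 0 < w
      · have hm : w ∈ Ioc 0 s := ⟨hw, hsw⟩
        have hm' : w ∈ Ioc 0 (s + h) := ⟨hw, by linarith⟩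
        rw [fracKernel, fracKernel, indicator_of_mem hm, indicator_of_mem hm']
        exact Real.rpow_le_rpow_of_nonpos (by linarith) (by linarith) (by linarith)
      · simp [fracKernel, hw]
  calc ∫ w in Ioc (0 : ℝ) 1, |fracKernel θ (s + h) w - fracKernel θ s w|
      ≤ ∫ w in Ioc (0 : ℝ) 1, (2 * g w + (fracKernel θ s w - fracKernel θ (s + h) w)) :=
        integral_mono_ae (ki.sub ki').abs.integrableOn
          ((hgi.const_mul 2).add (ki'.sub ki)).integrableOn (ae_restrict_of_ae hle)
    _ = 2 * (h ^ θ / θ) + (s ^ θ / θ - (s + h) ^ θ / θ) := by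
        have hd : Integrable (fun w => fracKernel θ s w - fracKernel θ (s + h) w) := ki'.sub ki
        rw [integral_add (hgi.const_mul 2).integrableOn hd.integrableOn,
          integral_sub ki'.integrableOn ki.integrableOn, integral_const_mul, hgI,
          setIntegral_fracKernel hθ0 hs (by linarith),
          setIntegral_fracKernel hθ0 (by linarith) hsh]
    _ ≤ 2 / θ * h ^ θ := by
        have : s ^ θ / θ ≤ (s + h) ^ θ / θ :=
          div_le_div_of_nonneg_right (Real.rpow_le_rpow hs (by linarith) hθ0.le) hθ0.le
        have e : 2 * (h ^ θ / θ) = 2 / θ * h ^ θ := by ring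
        linarith

lemma setIntegral_abs_fracKernel_sub_le {θ s h : ℝ} (hθ : 0 < θ) (hs : 0 ≤ s) (hh : 0 < h)
    (hh1 : h < 1) (hsh : s + h ≤ 1) :
    ∫ w in Ioc (0 : ℝ) 1, |fracKernel θ (s + h) w - fracKernel θ s w|
      ≤ (1 + 2 / θ) * max (h ^ (θ / 2)) (h ^ (1 / 2 : ℝ)) := by
  have hq : 0 < 2 / θ := by positivity
  have hp : 0 < h ^ (θ / 2) := by positivity
  have hp' : 0 < h ^ (1 / 2 : ℝ) := by positivity
  rcases lt_or_ge θ 1 with h1 | h1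
  · refine (setIntegral_abs_fracKernel_sub_le_of_lt_one hθ h1 hs hh hsh).trans ?_
    have h2 : h ^ θ ≤ h ^ (θ / 2) := Real.rpow_le_rpow_of_exponent_ge hh hh1.le (by linarith)
    exact mul_le_mul (by linarith) (h2.trans (le_max_left _ _)) (by positivity) (by linarith)
  · refine (setIntegral_abs_fracKernel_sub_le_of_one_le h1 hs hh hsh).trans ?_
    have h2 : h ≤ h ^ (1 / 2 : ℝ) := by
      simpa using Real.rpow_le_rpow_of_exponent_ge hh hh1.le (show (1 / 2 : ℝ) ≤ 1 by norm_num)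
    have h3 := h2.trans (le_max_right (h ^ (θ / 2)) _)
    nlinarith

lemma fracInt_sub_fracInt {Ω : Type*} {θ : ℝ} (hθ : 0 < θ) {X : ℝ → Ω → ℝ} {ω : Ω}
    (hc : ContinuousOn (fun t => X t ω) (Icc 0 1)) {s t : ℝ} (hs : s ∈ Icc (0 : ℝ) 1)
    (ht : t ∈ Icc (0 : ℝ) 1) :
    fracInt θ X t ω - fracInt θ X s ω = (Real.Gamma θ)⁻¹ *
      ∫ w in Ioc (0 : ℝ) 1, (fracKernel θ t w - fracKernel θ s w) * X w ω := by
  have hi : ∀ u ∈ Icc (0 : ℝ) 1, IntegrableOn (fun w => fracKernel θ u w * X w ω) (Ioc 0 1) :=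
    fun u hu => ((integrable_fracKernel hθ hu.1).integrableOn.mul_continuousOn hc
      isCompact_Icc).mono_set Ioc_subset_Icc_self
  simp_rw [sub_mul]
  rw [integral_sub (hi t ht) (hi s hs), fracInt, fracInt,
    setIntegral_fracKernel_mul hs.1 hs.2 fun w => X w ω,
    setIntegral_fracKernel_mul ht.1 ht.2 fun w => X w ω, mul_sub]

lemma IsCenteredGaussianProcess.aemeasurable {Ω : Type*} [MeasurableSpace Ω] {P : Measure Ω}
    {X : ℝ → Ω → ℝ} (hX : IsCenteredGaussianProcess P X) (t : ℝ) : AEMeasurable (X t) P := by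
  obtain ⟨v, hv⟩ := hX 1 (fun _ => t) (fun _ => 1)
  simp only [Finset.univ_unique, Finset.sum_const, Finset.card_singleton, one_smul, one_mul] at hv
  exact AEMeasurable.of_map_ne_zero (hv ▸ IsProbabilityMeasure.ne_zero _)

lemma IsCenteredGaussianProcess.integrable_sq {Ω : Type*} [MeasurableSpace Ω] {P : Measure Ω}
    {X : ℝ → Ω → ℝ} (hX : IsCenteredGaussianProcess P X) (t : ℝ) :
    Integrable (fun ω => X t ω ^ 2) P := by
  obtain ⟨v, hv⟩ := hX 1 (fun _ => t) (fun _ => 1)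
  simp only [Finset.univ_unique, Finset.sum_const, Finset.card_singleton, one_smul, one_mul] at hv
  have h : MemLp id 2 (P.map (X t)) := hv ▸ memLp_id_gaussianReal 2
  exact ((memLp_map_measure_iff h.1 (hX.aemeasurable t)).1 h).integrable_sq

/-- L² increment bound for the fractional integral of a Gaussian process:
the constant `c` depends only on `η` and `θ`. -/
theorem fracInt_L2_increment_bound (η θ : ℝ) (hη : 0 < η) (hθ : 0 < θ) :
    ∃ c : ℝ, 0 < c ∧
      ∀ (Ω : Type) (_ : MeasurableSpace Ω) (P : Measure Ω), IsProbabilityMeasure P →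
      ∀ (X : ℝ → Ω → ℝ) (c_X : ℝ), 0 < c_X →
        IsCenteredGaussianProcess P X →
        (∀ ω, ContinuousOn (fun t => X t ω) (Set.Icc 0 1)) →
        (∀ ω, X 0 ω = 0) →
        (∀ t h : ℝ, 0 < h → h < 1 → 0 ≤ t → t + h ≤ 1 →
          Real.sqrt (∫ ω, (X (t + h) ω - X t ω) ^ 2 ∂P) ≤ c_X * h ^ η) →
        ∀ s h : ℝ, 0 < h → h < 1 → 0 ≤ s → s + h ≤ 1 →
          Real.sqrt (∫ ω, (fracInt θ X (s + h) ω - fracInt θ X s ω) ^ 2 ∂P) ≤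
            c * c_X * max (h ^ (θ / 2)) (h ^ (1/2 : ℝ)) := by
  have hΓ : 0 < (Real.Gamma θ)⁻¹ := inv_pos.2 (Real.Gamma_pos_of_pos hθ)
  refine ⟨(Real.Gamma θ)⁻¹ * (1 + 2 / θ), by positivity, ?_⟩
  intro Ω _ P _ X c_X hcX hG hc h0 hinc s h hh hh1 hs hsh
  have hC : ∀ t ∈ Ioo (0 : ℝ) 1, ∫ ω, X t ω ^ 2 ∂P ≤ c_X ^ 2 := by
    intro t ht
    have h1 := hinc 0 t ht.1 ht.2 le_rfl (by linarith [ht.2])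
    simp only [zero_add, h0, sub_zero] at h1
    have h2 : c_X * t ^ η ≤ c_X :=
      mul_le_of_le_one_right hcX.le (Real.rpow_le_one ht.1.le ht.2.le hη.le)
    exact (Real.sqrt_le_left hcX.le).1 (h1.trans h2)
  have hK : IntegrableOn (fun w => fracKernel θ (s + h) w - fracKernel θ s w) (Ioc 0 1) :=
    ((integrable_fracKernel hθ (by linarith)).sub (integrable_fracKernel hθ hs)).integrableOn
  have hmain := integral_sq_integral_mul_le hG.aemeasurable hc hG.integrable_sq hC hK
  have hY : ∀ ω, (fracInt θ X (s + h) ω - fracInt θ X s ω) ^ 2 = (Real.Gamma θ)⁻¹ ^ 2 *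
      (∫ w in Ioc (0 : ℝ) 1, (fracKernel θ (s + h) w - fracKernel θ s w) * X w ω) ^ 2 := by
    intro ω
    rw [fracInt_sub_fracInt hθ (hc ω) ⟨hs, by linarith⟩ ⟨by linarith, hsh⟩, mul_pow]
  simp_rw [hY]
  rw [integral_const_mul]
  have hA := setIntegral_abs_fracKernel_sub_le hθ hs hh hh1 hsh
  have hA0 : 0 ≤ ∫ w in Ioc (0 : ℝ) 1, |fracKernel θ (s + h) w - fracKernel θ s w| :=
    integral_nonneg fun _ => abs_nonneg _
  set A := ∫ w in Ioc (0 : ℝ) 1, |fracKernel θ (s + h) w - fracKernel θ s w|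
  calc _ ≤ Real.sqrt (((Real.Gamma θ)⁻¹ * A * c_X) ^ 2) := by
        refine Real.sqrt_le_sqrt ?_
        rw [mul_pow, mul_pow, mul_assoc]
        exact mul_le_mul_of_nonneg_left hmain (sq_nonneg _)
    _ = (Real.Gamma θ)⁻¹ * c_X * A := by
        rw [Real.sqrt_sq (by positivity)]; ring
    _ ≤ (Real.Gamma θ)⁻¹ * c_X * ((1 + 2 / θ) * max (h ^ (θ / 2)) (h ^ (1 / 2 : ℝ))) :=
        mul_le_mul_of_nonneg_left hA (by positivity)
    _ = _ := by ring
end
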